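/- Let G be a compact Hausdorff topological group. The following four conditions are equivalent: (a) G is a simply connected AE(1)-compactum; (b) G is an AE(2)-compactum; (c) G is an AE(3)-compactum; (d) G is isomorphic as a topological group to a product ∏_{t∈T} L_t (over some index set T) of simple, connected and simply connected compact Lie groups. -/

import Mathlib

open Topology

universe u

/-- A topological space `Z` has Lebesgue covering dimension at most `n`:
every finite open cover admits a finite open refinement in which each point
lies in at most `n + 1` members. -/
def CovDimLE (Z : Type u) [TopologicalSpace Z] (n : ℕ) : Prop :=
  ∀ 𝒰 : Finset (Set Z), (∀ U ∈ 𝒰, IsOpen U) → ⋃₀ (𝒰 : Set (Set Z)) = Set.univ →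
    ∃ 𝒱 : Finset (Set Z), (∀ V ∈ 𝒱, IsOpen V) ∧ ⋃₀ (𝒱 : Set (Set Z)) = Set.univ ∧
      (∀ V ∈ 𝒱, ∃ U ∈ 𝒰, V ⊆ U) ∧
      ∀ z : Z, Nat.card {V : Set Z // V ∈ 𝒱 ∧ z ∈ V} ≤ n + 1

/-- `X` is an absolute extensor in dimension `n` (an AE(n)-space): every continuous map
into `X` from a closed subspace of a compact Hausdorff space of covering dimension
at most `n` extends continuously over the whole space. -/
def IsAE (n : ℕ) (X : Type u) [TopologicalSpace X] : Prop :=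
  ∀ (Z : Type u) [TopologicalSpace Z], CompactSpace Z → T2Space Z → CovDimLE Z n →
    ∀ Z₀ : Set Z, IsClosed Z₀ → ∀ g₀ : C(Z₀, X),
      ∃ g : C(Z, X), ∀ z : Z₀, g (z : Z) = g₀ z

/-- `X` is an absolute neighborhood extensor in dimension `4` (an ANE(4)-space):
every continuous map into `X` from a closed subspace `Z₀` of a compact Hausdorff
space of covering dimension at most `4` extends continuously over some open
neighborhood of `Z₀`. -/
def IsANE4 (X : Type u) [TopologicalSpace X] : Prop :=
  ∀ (Z : Type u) [TopologicalSpace Z], CompactSpace Z → T2Space Z → CovDimLE Z 4 →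
    ∀ Z₀ : Set Z, IsClosed Z₀ → ∀ g₀ : C(Z₀, X),
      ∃ (U : Set Z) (_ : IsOpen U) (hZ₀U : Z₀ ⊆ U) (g : C(U, X)),
        ∀ (z : Z) (hz : z ∈ Z₀), g ⟨z, hZ₀U hz⟩ = g₀ ⟨z, hz⟩

/-- The underlying space of `X` is a topological manifold: every point has an open
neighborhood homeomorphic to an open subset of some Euclidean space. -/
def IsTopManifold (X : Type u) [TopologicalSpace X] : Prop :=
  ∀ x : X, ∃ (n : ℕ) (U : Set X) (V : Set (EuclideanSpace ℝ (Fin n))),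
    IsOpen U ∧ x ∈ U ∧ IsOpen V ∧ Nonempty (U ≃ₜ V)

/-- The multiplicative equivalence `e` is an isomorphism of topological groups,
i.e. it is continuous with continuous inverse. -/
def IsTopGroupIso {G H : Type*} [Group G] [Group H] [TopologicalSpace G]
    [TopologicalSpace H] (e : G ≃* H) : Prop :=
  Continuous e ∧ Continuous e.symm

/-- A package consisting of a compact Hausdorff topological group. -/
structure CompactGroupPkg : Type (u + 1) where
  carrier : Type u
  [topology : TopologicalSpace carrier]
  [group : Group carrier]
  [topGroup : IsTopologicalGroup carrier]
  [compact : CompactSpace carrier]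
  [t2 : T2Space carrier]

attribute [instance] CompactGroupPkg.topology CompactGroupPkg.group
  CompactGroupPkg.topGroup CompactGroupPkg.compact CompactGroupPkg.t2

/-- `L` is a simple, connected and simply connected compact Lie group: a compact
Hausdorff topological group whose underlying space is a topological manifold,
which is connected, simply connected, nonabelian, and all of whose closed
normal subgroups other than the whole group are finite. -/
def IsSimpleSCSCLieGroup (L : CompactGroupPkg.{u}) : Prop :=
  IsTopManifold L.carrier ∧ ConnectedSpace L.carrier ∧ SimplyConnectedSpace L.carrier ∧
    (∃ a b : L.carrier, a * b ≠ b * a) ∧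
    ∀ N : Subgroup L.carrier, N.Normal → IsClosed (N : Set L.carrier) → N ≠ ⊤ → Finite N

set_option linter.unusedSectionVars false

namespace CompactGroupAE

open Filter NormedSpace

section RealExp

variable {A : Type*} [NormedRing A] [NormedAlgebra ℝ A] [FiniteDimensional ℝ A]

theorem exp_add_comm {x y : A} (h : Commute x y) : exp (x + y) = exp x * exp y := by
  have := FiniteDimensional.complete ℝ A
  let : NormedAlgebra ℚ A := .restrictScalars ℚ ℝ A
  exact exp_add_of_commute h

theorem exp_mul_exp_neg (x : A) : exp x * exp (-x) = 1 := by
  rw [← exp_add_comm (Commute.neg_right (Commute.refl x)), add_neg_cancel, exp_zero]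

theorem exp_neg_mul_exp (x : A) : exp (-x) * exp x = 1 := by
  rw [← exp_add_comm (Commute.neg_left (Commute.refl x)), neg_add_cancel, exp_zero]

theorem continuous_exp : Continuous (exp : A → A) := by
  have := FiniteDimensional.complete ℝ A
  let : NormedAlgebra ℚ A := .restrictScalars ℚ ℝ A
  exact exp_continuous

theorem exp_natCast_smul (n : ℕ) (x : A) : exp ((n : ℝ) • x) = exp x ^ n := by
  induction n with
  | zero => simp
  | succ k ih =>
    rw [Nat.cast_succ, add_smul, one_smul, exp_add_comm, ih, pow_succ]
    exact (Commute.refl x).smul_left _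

theorem strictDeriv_exp_zero : HasStrictFDerivAt (exp : A → A) (1 : A →L[ℝ] A) 0 := by
  have := FiniteDimensional.complete ℝ A
  exact hasStrictFDerivAt_exp_zero

theorem contDiff_exp {n : WithTop ℕ∞} : ContDiff ℝ n (exp : A → A) := by
  have := FiniteDimensional.complete ℝ A
  exact AnalyticOnNhd.contDiff (fun x _ => exp_analytic x)

theorem hasDerivAt_exp_smul (x : A) (t : ℝ) :
    HasDerivAt (fun s : ℝ => exp (s • x)) (exp (t • x) * x) t := by
  have := FiniteDimensional.complete ℝ A
  exact hasDerivAt_exp_smul_const x t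

/-- A local logarithm near the identity. -/
theorem exists_log : ∃ L : A → A, HasStrictFDerivAt L (1 : A →L[ℝ] A) 1 ∧ L 1 = 0 ∧
    (∀ᶠ y in 𝓝 (1 : A), exp (L y) = y) ∧ ∀ᶠ x in 𝓝 (0 : A), L (exp x) = x := by
  have := FiniteDimensional.complete ℝ A
  have h : HasStrictFDerivAt (exp : A → A) ((ContinuousLinearEquiv.refl ℝ A : A ≃L[ℝ] A) : A →L[ℝ] A) 0 :=
    strictDeriv_exp_zero
  have h1 := h.to_localInverse
  rw [exp_zero] at h1
  refine ⟨h.localInverse _ _ _, h1, ?_, ?_, h.eventually_left_inverse⟩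
  · have := h.localInverse_apply_image
    rwa [exp_zero] at this
  · have := h.eventually_right_inverse
    rwa [exp_zero] at this

end RealExp

/-- A compact group of invertible elements of a normed ring. -/
structure CptGrp (A : Type*) [NormedRing A] where
  /-- the underlying submonoid -/
  K : Submonoid A
  compact : IsCompact (K : Set A)
  exists_inv : ∀ k ∈ K, ∃ k' ∈ K, k * k' = 1 ∧ k' * k = 1

namespace CptGrp

theorem closed {A : Type*} [NormedRing A] (Γ : CptGrp A) : IsClosed (Γ.K : Set A) :=
  Γ.compact.isClosed

variable {A : Type*} [NormedRing A] [NormedAlgebra ℝ A] [FiniteDimensional ℝ A] (Γ : CptGrp A)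

theorem exp_mem_of_tendsto {X : ℕ → A} {c : ℕ → ℝ} {Y : A} (hX : Tendsto X atTop (𝓝 0))
    (hK : ∀ᶠ n in atTop, exp (X n) ∈ Γ.K) (hc : Tendsto c atTop atTop)
    (hY : Tendsto (fun n => c n • X n) atTop (𝓝 Y)) : exp Y ∈ Γ.K := by
  have h1 : Tendsto (fun n => ((⌊c n⌋₊ : ℕ) : ℝ) • X n) atTop (𝓝 Y) := by
    have h2 : Tendsto (fun n => (c n - ((⌊c n⌋₊ : ℕ) : ℝ)) • X n) atTop (𝓝 0) := by
      rw [tendsto_zero_iff_norm_tendsto_zero] at hX ⊢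
      refine squeeze_zero' (Eventually.of_forall fun n => norm_nonneg _) ?_ hX
      filter_upwards [hc.eventually_ge_atTop 0] with n hn
      rw [norm_smul]
      refine mul_le_of_le_one_left (norm_nonneg _) ?_
      rw [Real.norm_eq_abs, abs_le]
      constructor
      · linarith [Nat.floor_le hn]
      · linarith [Nat.lt_floor_add_one (c n)]
    have h3 := hY.sub h2
    simp only [sub_zero] at h3
    refine h3.congr fun n => ?_
    rw [← sub_smul]; congr 1; ring
  have h4 := (continuous_exp.tendsto Y).comp h1
  refine Γ.closed.mem_of_tendsto h4 ?_
  filter_upwards [hK] with n hn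
  simp only [Function.comp, exp_natCast_smul]
  exact pow_mem hn _

theorem exp_smul_add_mem {X Y : A} (hX : ∀ t : ℝ, exp (t • X) ∈ Γ.K) (hY : ∀ t : ℝ, exp (t • Y) ∈ Γ.K)
    (t : ℝ) : exp (t • (X + Y)) ∈ Γ.K := by
  obtain ⟨L, hL, hL1, hexpL, -⟩ := exists_log (A := A)
  let p : ℝ → A := fun s => exp (s • (t • X)) * exp (s • (t • Y))
  have hp : HasDerivAt p (t • X + t • Y) 0 := by
    have := (hasDerivAt_exp_smul (t • X) 0).mul (hasDerivAt_exp_smul (t • Y) 0)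
    simp only [zero_smul, exp_zero, one_mul, mul_one] at this
    exact this
  have hp0 : p 0 = 1 := by simp [p]
  have hq : HasDerivAt (fun s => L (p s)) (t • X + t • Y) 0 := by
    have h := hL.hasFDerivAt
    rw [← hp0] at h
    have := h.comp_hasDerivAt (0 : ℝ) hp
    simp only [one_apply_eq_self] at this
    exact this
  have hn : Tendsto (fun n : ℕ => ((n : ℝ) + 1)⁻¹) atTop (𝓝 0) :=
    tendsto_inv_atTop_zero.comp (tendsto_atTop_add_const_right _ _ tendsto_natCast_atTop_atTop)
  have hn' : Tendsto (fun n : ℕ => ((n : ℝ) + 1)⁻¹) atTop (𝓝[≠] 0) := by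
    refine tendsto_nhdsWithin_iff.2 ⟨hn, Eventually.of_forall fun n => ?_⟩
    simp only [Set.mem_compl_iff, Set.mem_singleton_iff]; positivity
  rw [smul_add]
  refine Γ.exp_mem_of_tendsto (X := fun n : ℕ => L (p ((n : ℝ) + 1)⁻¹)) (c := fun n => (n : ℝ) + 1)
    ?_ ?_ (tendsto_atTop_add_const_right _ _ tendsto_natCast_atTop_atTop) ?_
  · have h := hq.continuousAt.tendsto.comp hn
    simpa [hp0, hL1, Function.comp_def] using h
  · have h : ∀ᶠ s in 𝓝 (0 : ℝ), exp (L (p s)) = p s := by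
      have := hp.continuousAt.tendsto
      rw [hp0] at this
      exact this.eventually hexpL
    filter_upwards [hn.eventually h] with n hn
    rw [hn]
    simp only [p, smul_smul]
    exact mul_mem (hX _) (hY _)
  · have h := hq.tendsto_slope_zero.comp hn'
    simpa [hp0, hL1, Function.comp_def] using h

/-- The Lie algebra of a compact group of invertible elements. -/
def lie : Submodule ℝ A where
  carrier := {X | ∀ t : ℝ, exp (t • X) ∈ Γ.K}
  add_mem' hX hY t := Γ.exp_smul_add_mem hX hY t
  zero_mem' t := by simp
  smul_mem' c X hX t := by
    rw [smul_smul]; exact hX _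

theorem exp_mem {X : A} (hX : X ∈ Γ.lie) : exp X ∈ Γ.K := by
  simpa using hX 1

theorem mem_lie_of_tendsto {X : ℕ → A} {c : ℕ → ℝ} {Y : A} (hX : Tendsto X atTop (𝓝 0))
    (hK : ∀ᶠ n in atTop, exp (X n) ∈ Γ.K) (hc : Tendsto c atTop atTop)
    (hY : Tendsto (fun n => c n • X n) atTop (𝓝 Y)) : Y ∈ Γ.lie := by
  have key : ∀ t : ℝ, 0 ≤ t → exp (t • Y) ∈ Γ.K := by
    intro t ht
    rcases ht.eq_or_lt with rfl | ht
    · simp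
    · refine Γ.exp_mem_of_tendsto (c := fun n => t * c n) hX hK
        (hc.const_mul_atTop ht) ?_
      simpa [mul_smul] using hY.const_smul t
  intro t
  rcases le_total 0 t with ht | ht
  · exact key t ht
  · obtain ⟨k, hk, h1, h2⟩ := Γ.exists_inv _ (key (-t) (by linarith))
    have : exp (t • Y) = k := by
      calc exp (t • Y) = exp (t • Y) * (exp (-t • Y) * k) := by rw [h1, mul_one]
        _ = exp (t • Y) * exp (-(t • Y)) * k := by rw [neg_smul, mul_assoc]
        _ = k := by rw [exp_mul_exp_neg, one_mul]
    rwa [this]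

/-- Near the identity, `Γ` meets `1 + 𝔭` only at the identity if `𝔭` is a complement of the Lie
algebra. -/
theorem eventually_transversal {P : Submodule ℝ A} (hP : Disjoint Γ.lie P) :
    ∀ᶠ V in 𝓝 (0 : A), V ∈ P → 1 + V ∈ Γ.K → V = 0 := by
  obtain ⟨L, hL, hL1, hexpL, -⟩ := exists_log (A := A)
  by_contra hcon
  rw [not_eventually] at hcon
  obtain ⟨V, hV0, hV⟩ := exists_seq_forall_of_frequently hcon
  push Not at hV
  have hV1 : Tendsto (fun n => 1 + V n) atTop (𝓝 1) := by simpa using hV0.const_add 1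
  have hne : ∀ n, ‖V n‖ ≠ 0 := fun n => norm_ne_zero_iff.2 (hV n).2.2
  have hsph : ∀ n, ‖V n‖⁻¹ • V n ∈ Metric.sphere (0 : A) 1 := by
    intro n
    simp [norm_smul, hne n]
  have := FiniteDimensional.proper ℝ A
  obtain ⟨Y, hY, φ, hφ, hlim⟩ := (isCompact_sphere (0 : A) 1).tendsto_subseq hsph
  have hLo : Tendsto (fun n => ‖V n‖⁻¹ • (L (1 + V n) - V n)) atTop (𝓝 0) := by
    have h := (hL.hasFDerivAt.isLittleO.comp_tendsto hV1)
    rw [tendsto_zero_iff_norm_tendsto_zero]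
    have h2 := h.norm_norm.tendsto_div_nhds_zero
    refine h2.congr fun n => ?_
    simp [norm_smul, hL1, div_eq_inv_mul]
  have hYg : Y ∈ Γ.lie := by
    refine Γ.mem_lie_of_tendsto (X := fun n => L (1 + V (φ n))) (c := fun n => ‖V (φ n)‖⁻¹) ?_ ?_ ?_ ?_
    · have := hL.continuousAt.tendsto.comp (hV1.comp hφ.tendsto_atTop)
      simpa [hL1, Function.comp_def] using this
    · filter_upwards [(hV1.comp hφ.tendsto_atTop).eventually hexpL] with n hn
      simp only [Function.comp] at hn
      rw [hn]
      exact (hV _).2.1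
    · refine Tendsto.comp tendsto_inv_nhdsGT_zero ?_
      refine tendsto_nhdsWithin_iff.2 ⟨?_, Eventually.of_forall fun n => ?_⟩
      · simpa [Function.comp_def] using (hV0.comp hφ.tendsto_atTop).norm
      · exact lt_of_le_of_ne (norm_nonneg _) (hne _).symm
    · have := (hLo.comp hφ.tendsto_atTop).add hlim
      simpa [Function.comp_def, smul_sub] using this
  have hYP : Y ∈ P := by
    refine (Submodule.closed_of_finiteDimensional P).mem_of_tendsto hlim
      (Eventually.of_forall fun n => ?_)
    exact P.smul_mem _ (hV _).1
  have hY0 : Y = 0 := (Submodule.disjoint_def.1 hP) Y hYg hYP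
  simp [hY0] at hY

end CptGrp

end CompactGroupAE

namespace CompactGroupAE

open Filter NormedSpace

namespace CptGrp

variable {A : Type*} [NormedRing A] [NormedAlgebra ℝ A] [FiniteDimensional ℝ A] (Γ : CptGrp A)

/-- Left multiplication by an element of the group, as a continuous linear equivalence. -/
theorem exists_mulLeft {k : A} (hk : k ∈ Γ.K) : ∃ e : A ≃L[ℝ] A, ∀ x, e x = k * x := by
  obtain ⟨k', -, h1, h2⟩ := Γ.exists_inv k hk
  let e : A ≃ₗ[ℝ] A :=
    LinearEquiv.ofLinearMap (LinearMap.mulLeft ℝ k) (LinearMap.mulLeft ℝ k')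
      (by ext x; simp [← mul_assoc, h1]) (by ext x; simp [← mul_assoc, h2])
  exact ⟨e.toContinuousLinearEquiv, fun x => rfl⟩

/-- A map into `Γ.K` whose derivative at a point identifies the source with the
Lie algebra of `Γ` is a local homeomorphism. The transversal directions are recorded. -/
theorem exists_chart_of_hasStrictFDerivAt {E : Type*} [NormedAddCommGroup E] [NormedSpace ℝ E]
    [FiniteDimensional ℝ E] {P : Submodule ℝ A} (hP : IsCompl Γ.lie P)
    (φ : E → A) (hφK : ∀ e, φ e ∈ Γ.K) (e0 : E) (l : E ≃ₗ[ℝ] Γ.lie)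
    (φ' : E →L[ℝ] A) (hφ' : ∀ e, φ' e = φ e0 * (l e : A)) (hφ : HasStrictFDerivAt φ φ' e0) :
    ∃ Q : OpenPartialHomeomorph (E × P) A, (e0, 0) ∈ Q.source ∧
      ∀ p, Q p = φ p.1 * (1 + (p.2 : A)) := by
  have := FiniteDimensional.complete ℝ A
  have := FiniteDimensional.complete ℝ E
  obtain ⟨m, hm⟩ := Γ.exists_mulLeft (hφK e0)
  let T : (E × P) ≃L[ℝ] A :=
    ((LinearEquiv.prodCongr l (LinearEquiv.refl ℝ P)).trans
      (Submodule.prodEquivOfIsCompl _ _ hP)).toContinuousLinearEquiv.trans m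
  let F : E × P → A := fun p => φ p.1 * (1 + (p.2 : A))
  have h1 : HasStrictFDerivAt (fun p : E × P => φ p.1) (φ'.comp (ContinuousLinearMap.fst ℝ E P))
      (e0, 0) := HasStrictFDerivAt.comp (e0, (0 : P)) (f := Prod.fst) hφ hasStrictFDerivAt_fst
  have h2 : HasStrictFDerivAt (fun p : E × P => 1 + (p.2 : A))
      (P.subtypeL.comp (ContinuousLinearMap.snd ℝ E P)) (e0, 0) :=
    (P.subtypeL.comp (ContinuousLinearMap.snd ℝ E P)).hasStrictFDerivAt.const_add 1
  have h3 := h1.mul' h2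
  have hF : HasStrictFDerivAt F (T : (E × P) →L[ℝ] A) (e0, 0) := by
    refine h3.congr_fderiv ?_
    ext p
    · simp [T, hm, hφ']
    · simp [T, hm]
  exact ⟨hF.toOpenPartialHomeomorph F, hF.mem_toOpenPartialHomeomorph_source, fun p => rfl⟩

theorem exists_isCompl : ∃ P : Submodule ℝ A, IsCompl Γ.lie P := Submodule.exists_isCompl _

theorem exists_chart {E : Type*} [NormedAddCommGroup E] [NormedSpace ℝ E]
    [FiniteDimensional ℝ E] (φ : E → Γ.K) (e0 : E) (l : E ≃ₗ[ℝ] Γ.lie)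
    (φ' : E →L[ℝ] A) (hφ' : ∀ e, φ' e = φ e0 * (l e : A))
    (hφ : HasStrictFDerivAt (fun e => (φ e : A)) φ' e0) :
    ∃ Q : OpenPartialHomeomorph E Γ.K, e0 ∈ Q.source ∧ ∀ e, Q e = φ e := by
  obtain ⟨P, hP⟩ := Γ.exists_isCompl
  obtain ⟨Q, hQ0, hQ⟩ := Γ.exists_chart_of_hasStrictFDerivAt hP (fun e => φ e) (fun e => (φ e).2) e0 l φ' hφ' hφ
  have htr := Γ.eventually_transversal hP.disjoint
  have htr' : ∀ᶠ V : P in 𝓝 (0 : P), 1 + (V : A) ∈ Γ.K → V = 0 := by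
    have h : Tendsto (Subtype.val : P → A) (𝓝 0) (𝓝 0) :=
      (continuous_subtype_val (p := fun x => x ∈ P)).tendsto 0
    filter_upwards [h.eventually htr] with V hV h
    exact Subtype.ext (hV V.2 h)
  have hev : ∀ᶠ p in 𝓝 (e0, (0 : P)), p ∈ Q.source :=
    Q.open_source.mem_nhds hQ0
  rw [nhds_prod_eq] at hev
  obtain ⟨pa, ha, pb, hb, hab⟩ := eventually_prod_iff.1 hev
  obtain ⟨W, hW, hWo, h0W⟩ := eventually_nhds_iff.1 ha
  obtain ⟨B, hB, hBo, h0B⟩ := eventually_nhds_iff.1 (hb.and htr')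
  have hsrc : W ×ˢ B ⊆ Q.source := fun p hp => hab (hW _ hp.1) (hB _ hp.2).1
  have hQ0' : ∀ e, Q (e, 0) = φ e := fun e => by simp [hQ]
  have hV0 : ∀ e V, V ∈ B → Q (e, V) ∈ Γ.K → V = 0 := by
    intro e V hV h
    refine (hB V hV).2 ?_
    obtain ⟨k', hk', -, h2⟩ := Γ.exists_inv _ (φ e).2
    rw [hQ] at h
    have := mul_mem hk' h
    rwa [← mul_assoc, h2, one_mul] at this
  have htarget : IsOpen (Q '' (W ×ˢ B)) :=
    Q.isOpen_image_of_subset_source (hWo.prod hBo) hsrc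
  refine ⟨{
    toFun := φ
    invFun := fun k => (Q.symm k).1
    source := W
    target := Subtype.val ⁻¹' (Q '' (W ×ˢ B))
    map_source' := fun e he => ⟨(e, 0), ⟨he, h0B⟩, hQ0' e⟩
    map_target' := ?_
    left_inv' := ?_
    right_inv' := ?_
    open_source := hWo
    open_target := htarget.preimage continuous_subtype_val
    continuousOn_toFun := ?_
    continuousOn_invFun := ?_ }, h0W, fun e => rfl⟩
  · rintro k ⟨p, hp, hpk⟩
    rw [← hpk, Q.left_inv (hsrc hp)]
    exact hp.1
  · intro e he
    rw [← hQ0', Q.left_inv (hsrc ⟨he, h0B⟩)]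
  · rintro k ⟨⟨e, V⟩, hp, hpk⟩
    have hV : V = 0 := hV0 e V hp.2 (hpk ▸ k.2)
    subst hV
    rw [← hpk, Q.left_inv (hsrc hp)]
    refine Subtype.ext ?_
    rw [← hpk, hQ0']
  · rw [Topology.IsInducing.subtypeVal.continuousOn_iff]
    have : ContinuousOn (fun e => Q (e, 0)) W :=
      Q.continuousOn.comp (by fun_prop) (fun e he => hsrc ⟨he, h0B⟩)
    refine this.congr fun e he => ?_
    simp [hQ0']
  · refine continuous_fst.comp_continuousOn ?_
    refine Q.continuousOn_symm.comp continuous_subtype_val.continuousOn ?_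
    rintro k ⟨p, hp, hpk⟩
    rw [← hpk]
    exact Q.map_source (hsrc hp)

/-- The exponential map of the Lie algebra, translated by a group element. -/
noncomputable def expAt (k : Γ.K) (X : Γ.lie) : Γ.K := k * ⟨exp (X : A), Γ.exp_mem X.2⟩

theorem strictDeriv_exp_lie :
    HasStrictFDerivAt (fun X : Γ.lie => exp (X : A)) Γ.lie.subtypeL 0 :=
  HasStrictFDerivAt.comp (0 : Γ.lie) (f := Γ.lie.subtypeL) (g := exp)
    (g' := (1 : A →L[ℝ] A)) strictDeriv_exp_zero Γ.lie.subtypeL.hasStrictFDerivAt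

theorem exists_exp_chart (k : Γ.K) :
    ∃ Q : OpenPartialHomeomorph Γ.lie Γ.K, 0 ∈ Q.source ∧ ∀ X, Q X = Γ.expAt k X := by
  have h1 := HasStrictFDerivAt.const_mul Γ.strictDeriv_exp_lie (k : A)
  refine Γ.exists_chart (Γ.expAt k) 0 (LinearEquiv.refl ℝ Γ.lie) _ ?_ h1
  intro e
  simp [expAt]

theorem expAt_mem_nhds (k : Γ.K) {U : Set Γ.lie} (hU : U ∈ 𝓝 0) : Γ.expAt k '' U ∈ 𝓝 k := by
  obtain ⟨Q, h0, hQ⟩ := Γ.exists_exp_chart k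
  have := Q.image_mem_nhds h0 hU
  have hk : Γ.expAt k 0 = k := by ext; simp [expAt]
  rw [hQ, hk] at this
  convert this using 1
  ext; simp [hQ]

/-- A continuous retraction of a uniform neighborhood of `Γ.K` onto `Γ.K`. -/
theorem exists_tube {P : Submodule ℝ A} (hP : IsCompl Γ.lie P) :
    ∃ δ > 0, ∃ r : A → A, ContinuousOn r (Metric.thickening δ (Γ.K : Set A)) ∧
      (∀ y ∈ Metric.thickening δ (Γ.K : Set A), r y ∈ Γ.K ∧ ∃ V ∈ P, y = r y * (1 + V)) ∧
      ∀ k ∈ Γ.K, r k = k := by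
  obtain ⟨Q, hQ0, hQ⟩ := Γ.exists_chart_of_hasStrictFDerivAt hP (fun X : Γ.lie => exp (X : A))
    (fun X => Γ.exp_mem X.2) 0 (LinearEquiv.refl ℝ Γ.lie) Γ.lie.subtypeL (by simp)
    Γ.strictDeriv_exp_lie
  obtain ⟨C, hC0, hC⟩ : ∃ C > 0, ∀ k ∈ Γ.K, ‖k‖ ≤ C := by
    obtain ⟨C, hC⟩ := Γ.compact.isBounded.exists_norm_le
    exact ⟨max C 1, by positivity, fun k hk => (hC k hk).trans (le_max_left _ _)⟩
  have hev : ∀ᶠ p in 𝓝 ((0 : Γ.lie), (0 : P)), p ∈ Q.source := Q.open_source.mem_nhds hQ0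
  rw [nhds_prod_eq] at hev
  obtain ⟨pa, ha, pb, hb, hab⟩ := eventually_prod_iff.1 hev
  have hU := Γ.expAt_mem_nhds 1 ha
  rw [nhds_subtype_eq_comap, mem_comap] at hU
  obtain ⟨t, ht, htU⟩ := hU
  obtain ⟨ε₀, hε₀, hball⟩ := Metric.mem_nhds_iff.1 ht
  obtain ⟨ε₁, hε₁, hball₁⟩ := Metric.eventually_nhds_iff.1 hb
  obtain ⟨ε, hε, hεε₁, hεε₀⟩ : ∃ ε > 0, ε < ε₁ ∧ ε + C * ε < ε₀ := by
    refine ⟨min (ε₁ / 2) (ε₀ / (2 * (1 + C))), by positivity, ?_, ?_⟩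
    · exact (min_le_left _ _).trans_lt (by linarith)
    · have h := min_le_right (ε₁ / 2) (ε₀ / (2 * (1 + C)))
      rw [le_div_iff₀ (by positivity)] at h
      nlinarith
  have huniq : ∀ V ∈ P, ∀ W ∈ P, ∀ k ∈ Γ.K, ‖V‖ ≤ ε → ‖W‖ ≤ ε →
      k * (1 + V) = 1 + W → k = 1 := by
    intro V hV W hW k hk hVε hWε hkV
    have h1 : k - 1 = W - k * V := by
      rw [mul_add, mul_one] at hkV
      rw [sub_eq_sub_iff_add_eq_add, hkV, add_comm]
    have h2 : ‖k - 1‖ < ε₀ := by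
      rw [h1]
      refine (norm_sub_le _ _).trans_lt ((add_le_add hWε ?_).trans_lt hεε₀)
      exact (norm_mul_le _ _).trans (mul_le_mul (hC k hk) hVε (norm_nonneg _) hC0.le)
    obtain ⟨X, hX, hXk⟩ := @htU ⟨k, hk⟩ (hball (by simpa [dist_eq_norm] using h2))
    have hXk' : exp (X : A) = k := by simpa [expAt] using congrArg Subtype.val hXk
    have h3 : Q (X, ⟨V, hV⟩) = Q (0, ⟨W, hW⟩) := by
      simp [hQ, hXk', hkV]
    have h4 := Q.injOn (hab hX (@hball₁ ⟨V, hV⟩ (by simpa using hVε.trans_lt hεε₁)))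
      (hab ha.self_of_nhds (@hball₁ ⟨W, hW⟩ (by simpa using hWε.trans_lt hεε₁))) h3
    have h5 : X = 0 := (Prod.ext_iff.1 h4).1
    rw [← hXk', h5]; simp
  have huniq' : ∀ V ∈ P, ∀ W ∈ P, ∀ k ∈ Γ.K, ∀ h ∈ Γ.K, ‖V‖ ≤ ε → ‖W‖ ≤ ε →
      k * (1 + V) = h * (1 + W) → k = h := by
    intro V hV W hW k hk h hh hVε hWε hkV
    obtain ⟨h', hh', h1, h2⟩ := Γ.exists_inv h hh
    have := huniq V hV W hW (h' * k) (mul_mem hh' hk) hVε hWε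
      (by rw [mul_assoc, hkV, ← mul_assoc, h2, one_mul])
    calc k = h * (h' * k) := by rw [← mul_assoc, h1, one_mul]
      _ = h := by rw [this, mul_one]
  have hQU : Q '' (Set.univ ×ˢ Metric.ball 0 ε) ∈ 𝓝 (1 : A) := by
    have h1 : Set.univ ×ˢ Metric.ball (0 : P) ε ∈ 𝓝 ((0 : Γ.lie), (0 : P)) :=
      prod_mem_nhds univ_mem (Metric.ball_mem_nhds _ hε)
    have := Q.image_mem_nhds hQ0 h1
    rwa [show Q (0, 0) = 1 by simp [hQ]] at this
  obtain ⟨ρ, hρ, hρQ⟩ := Metric.mem_nhds_iff.1 hQU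
  have hdec : ∀ y ∈ Metric.thickening (ρ / C) (Γ.K : Set A),
      ∃ k ∈ Γ.K, ∃ V ∈ P, ‖V‖ ≤ ε ∧ y = k * (1 + V) := by
    intro y hy
    obtain ⟨k, hk, hyk⟩ := Metric.mem_thickening_iff.1 hy
    obtain ⟨k', hk', h1, h2⟩ := Γ.exists_inv k hk
    have h3 : k' * y ∈ Metric.ball (1 : A) ρ := by
      rw [mem_ball_iff_norm, ← h2, ← mul_sub]
      rw [dist_eq_norm, lt_div_iff₀ hC0] at hyk
      calc ‖k' * (y - k)‖ ≤ ‖k'‖ * ‖y - k‖ := norm_mul_le _ _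
        _ ≤ C * ‖y - k‖ := by gcongr; exact hC _ hk'
        _ < ρ := by linarith
    obtain ⟨⟨X, V⟩, hXV, h4⟩ := hρQ h3
    refine ⟨k * exp (X : A), mul_mem hk (Γ.exp_mem X.2), V, V.2, ?_, ?_⟩
    · have := hXV.2
      simp only [mem_ball_zero_iff] at this
      exact this.le
    · rw [hQ] at h4
      rw [mul_assoc, h4, ← mul_assoc, h1, one_mul]
  have hdec' : ∀ y, ∃ k, y ∈ Metric.thickening (ρ / C) (Γ.K : Set A) →
      (k ∈ Γ.K ∧ ∃ V ∈ P, ‖V‖ ≤ ε ∧ y = k * (1 + V)) := by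
    intro y
    by_cases hy : y ∈ Metric.thickening (ρ / C) (Γ.K : Set A)
    · obtain ⟨k, hk, h⟩ := hdec y hy
      exact ⟨k, fun _ => ⟨hk, h⟩⟩
    · exact ⟨0, fun h => (hy h).elim⟩
  choose r hr using hdec'
  refine ⟨ρ / C, by positivity, r, ?_, ?_, ?_⟩
  · rw [continuousOn_iff_isClosed]
    intro S hS
    have := FiniteDimensional.proper ℝ A
    refine ⟨(fun p : A × A => p.1 * (1 + p.2)) ''
      ((S ∩ Γ.K) ×ˢ (P ∩ Metric.closedBall 0 ε : Set A)), ?_, ?_⟩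
    · refine IsCompact.isClosed (IsCompact.image ?_ (by fun_prop))
      exact (Γ.compact.inter_left hS).prod
        ((isCompact_closedBall 0 ε).inter_left (Submodule.closed_of_finiteDimensional P))
    · ext y
      constructor
      · rintro ⟨hyS, hy⟩
        obtain ⟨hk, V, hV, hVε, hyV⟩ := hr y hy
        exact ⟨⟨(r y, V), ⟨⟨hyS, hk⟩, hV, by simpa using hVε⟩, hyV.symm⟩, hy⟩
      · rintro ⟨⟨⟨k, V⟩, ⟨⟨hkS, hk⟩, hV, hVε⟩, hyV⟩, hy⟩
        refine ⟨?_, hy⟩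
        obtain ⟨hk', V', hV', hVε', hyV'⟩ := hr y hy
        have := huniq' V hV V' hV' k hk (r y) hk' (by simpa using hVε) hVε' (hyV.trans hyV')
        rw [Set.mem_preimage, ← this]; exact hkS
  · intro y hy
    obtain ⟨hk', V', hV', -, hyV'⟩ := hr y hy
    exact ⟨hk', V', hV', hyV'⟩
  · intro k hk
    obtain ⟨hk', V', hV', hVε', hyV'⟩ := hr k (Metric.self_subset_thickening (by positivity) _ hk)
    exact (huniq' 0 P.zero_mem V' hV' k hk (r k) hk' (by simpa using hε.le) hVε'
      (by simpa using hyV')).symm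

end CptGrp

end CompactGroupAE

namespace CompactGroupAE

open Filter NormedSpace

section Hom

variable {A : Type*} [NormedRing A] {G : Type*} [Group G] [TopologicalSpace G]
  [IsTopologicalGroup G] [CompactSpace G]

/-- The image of a closed subgroup of a compact group under a representation. -/
def img (ρ : G →ₜ* A) (N : Subgroup G) (hN : IsClosed (N : Set G)) : CptGrp A where
  K := N.toSubmonoid.map ρ.toMonoidHom
  compact := hN.isCompact.image ρ.continuous_toFun
  exists_inv := by
    rintro _ ⟨n, hn, rfl⟩
    refine ⟨ρ n⁻¹, ⟨n⁻¹, N.inv_mem hn, rfl⟩, ?_, ?_⟩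
    · change ρ n * ρ n⁻¹ = 1
      rw [← map_mul]; simp
    · change ρ n⁻¹ * ρ n = 1
      rw [← map_mul]; simp

theorem rho_mul_inv (ρ : G →ₜ* A) (g : G) : ρ g * ρ g⁻¹ = 1 := by
  rw [← map_mul]; simp

theorem rho_inv_mul (ρ : G →ₜ* A) (g : G) : ρ g⁻¹ * ρ g = 1 := by
  rw [← map_mul]; simp

variable [NormedAlgebra ℝ A]

/-- Invariance of a subspace under the adjoint action. -/
def AdInv (ρ : G →ₜ* A) (S : Submodule ℝ A) : Prop :=
  ∀ g, ∀ X ∈ S, ρ g * X * ρ g⁻¹ ∈ S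

theorem AdInv.inf {ρ : G →ₜ* A} {S T : Submodule ℝ A} (hS : AdInv ρ S) (hT : AdInv ρ T) :
    AdInv ρ (S ⊓ T) := fun g X hX => ⟨hS g X hX.1, hT g X hX.2⟩

variable [FiniteDimensional ℝ A]

theorem exp_conj_rho (ρ : G →ₜ* A) (g : G) (X : A) :
    exp (ρ g * X * ρ g⁻¹) = ρ g * exp X * ρ g⁻¹ := by
  have := FiniteDimensional.complete ℝ A
  let : NormedAlgebra ℚ A := .restrictScalars ℚ ℝ A
  exact exp_units_conj (⟨ρ g, ρ g⁻¹, rho_mul_inv ρ g, rho_inv_mul ρ g⟩ : Aˣ) X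

theorem exp_commute {X Y : A} (h : Commute X Y) : Commute X (exp Y) := by
  let : NormedAlgebra ℚ A := .restrictScalars ℚ ℝ A
  exact h.exp_right

theorem lie_mono {ρ : G →ₜ* A} {N N' : Subgroup G} {hN : IsClosed (N : Set G)}
    {hN' : IsClosed (N' : Set G)} (h : N ≤ N') : (img ρ N hN).lie ≤ (img ρ N' hN').lie := by
  intro X hX t
  obtain ⟨n, hn, hnX⟩ := hX t
  exact ⟨n, h hn, hnX⟩

theorem adInv_lie {ρ : G →ₜ* A} {N : Subgroup G} (hn : N.Normal) (hN : IsClosed (N : Set G)) :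
    AdInv ρ (img ρ N hN).lie := by
  intro g X hX t
  obtain ⟨n, hn', hnX⟩ := hX t
  refine ⟨g * n * g⁻¹, hn.conj_mem _ hn' _, ?_⟩
  have h : t • (ρ g * X * ρ g⁻¹) = ρ g * (t • X) * ρ g⁻¹ := by simp
  rw [h, exp_conj_rho, ← hnX]
  change ρ _ = ρ _ * ρ _ * ρ _
  simp

/-- Elements of `N` near the identity map to exponentials of the Lie algebra. -/
theorem eventually_exp (ρ : G →ₜ* A) (N : Subgroup G) (hN : IsClosed (N : Set G))
    {U : Set A} (hU : U ∈ 𝓝 0) :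
    ∀ᶠ n in 𝓝 (1 : G), n ∈ N → ∃ X ∈ (img ρ N hN).lie, X ∈ U ∧ ρ n = exp X := by
  have h := (img ρ N hN).expAt_mem_nhds 1 (U := Subtype.val ⁻¹' U)
    (continuous_subtype_val.tendsto (0 : (img ρ N hN).lie) hU)
  rw [nhds_subtype_eq_comap, mem_comap] at h
  obtain ⟨t, ht, htU⟩ := h
  have h1 : Tendsto ρ (𝓝 1) (𝓝 1) := by
    have := ρ.continuous_toFun.tendsto 1
    simpa using this
  filter_upwards [h1 ht] with n hn hnN
  obtain ⟨X, hX, hXn⟩ := @htU ⟨ρ n, n, hnN, rfl⟩ hn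
  refine ⟨X, X.2, hX, ?_⟩
  have := congrArg Subtype.val hXn
  simp only [CptGrp.expAt] at this
  simpa using this.symm

/-- A connected closed subgroup is generated by the preimages of exponentials. -/
theorem le_of_exp {ρ : G →ₜ* A} {N : Subgroup G} {hN : IsClosed (N : Set G)}
    (hc : IsPreconnected (N : Set G)) {S : Subgroup G}
    (hS : ∀ n ∈ N, ∀ X ∈ (img ρ N hN).lie, ρ n = exp X → n ∈ S) : N ≤ S := by
  have hconn : PreconnectedSpace N := isPreconnected_iff_preconnectedSpace.1 hc
  have h1 : (S.subgroupOf N : Set N) ∈ 𝓝 (1 : N) := by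
    rw [nhds_subtype_eq_comap]
    refine mem_comap.2 ⟨_, eventually_exp ρ N hN univ_mem, ?_⟩
    intro n hn
    obtain ⟨X, hX, -, hnX⟩ := hn n.2
    exact Subgroup.mem_subgroupOf.2 (hS n n.2 X hX hnX)
  have h2 : IsOpen (S.subgroupOf N : Set N) := Subgroup.isOpen_of_mem_nhds _ h1
  have h3 : IsClosed (S.subgroupOf N : Set N) := Subgroup.isClosed_of_isOpen _ h2
  have h4 := IsClopen.eq_univ ⟨h3, h2⟩ ⟨1, (S.subgroupOf N).one_mem⟩
  intro n hn
  have : (⟨n, hn⟩ : N) ∈ (S.subgroupOf N : Set N) := by rw [h4]; trivial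
  exact Subgroup.mem_subgroupOf.1 this

theorem eq_one_of_lie_eq_bot {ρ : G →ₜ* A} {N : Subgroup G} {hN : IsClosed (N : Set G)}
    (hc : IsPreconnected (N : Set G)) (h0 : (img ρ N hN).lie = ⊥) : ∀ n ∈ N, ρ n = 1 := by
  have : N ≤ ρ.toMonoidHom.ker := by
    refine le_of_exp (ρ := ρ) (hN := hN) hc fun n _ X hX hnX => ?_
    rw [h0, Submodule.mem_bot] at hX
    rw [MonoidHom.mem_ker]
    change ρ n = 1
    rw [hnX, hX, exp_zero]
  exact this

/-- The elements acting trivially on a set of matrices by conjugation. -/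
def fixer (ρ : G →ₜ* A) (S : Set A) : Subgroup G where
  carrier := {g | ∀ X ∈ S, ρ g * X = X * ρ g}
  mul_mem' {a b} ha hb X hX := by
    rw [map_mul, mul_assoc, hb X hX, ← mul_assoc, ha X hX, mul_assoc]
  one_mem' X _ := by simp
  inv_mem' {a} ha X hX := by
    calc ρ a⁻¹ * X = ρ a⁻¹ * (X * ρ a) * ρ a⁻¹ := by
          rw [mul_assoc, mul_assoc, rho_mul_inv, mul_one]
      _ = X * ρ a⁻¹ := by rw [← ha X hX, ← mul_assoc, rho_inv_mul, one_mul]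

theorem mem_fixer {ρ : G →ₜ* A} {S : Set A} {g : G} :
    g ∈ fixer ρ S ↔ ∀ X ∈ S, ρ g * X = X * ρ g := Iff.rfl

theorem isClosed_fixer (ρ : G →ₜ* A) (S : Set A) : IsClosed (fixer ρ S : Set G) := by
  have : (fixer ρ S : Set G) = ⋂ X ∈ S, {g | ρ g * X = X * ρ g} := by
    ext; simp [mem_fixer]
  rw [this]
  have hc : Continuous ρ := ρ.continuous_toFun
  exact isClosed_biInter fun X _ => isClosed_eq (by fun_prop) (by fun_prop)

/-- Disjoint invariant subspaces of the Lie algebra commute. -/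
theorem commute_of_disjoint {ρ : G →ₜ* A} {N : Subgroup G} {hN : IsClosed (N : Set G)}
    {S T : Submodule ℝ A}
    (hS : AdInv ρ S) (hT : AdInv ρ T) (hST : Disjoint S T) (hSl : S ≤ (img ρ N hN).lie)
    (hTl : T ≤ (img ρ N hN).lie) {X Y : A} (hX : X ∈ S) (hY : Y ∈ T) : Commute X Y := by
  have key : ∀ T : Submodule ℝ A, AdInv ρ T → ∀ X ∈ (img ρ N hN).lie, ∀ Y ∈ T,
      X * Y - Y * X ∈ T := by
    intro T hT X hX Y hY
    have h1 : HasDerivAt (fun t : ℝ => exp (t • X) * Y * exp (t • (-X))) (X * Y - Y * X) 0 := by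
      have := ((hasDerivAt_exp_smul X 0).mul_const Y).mul (hasDerivAt_exp_smul (-X) 0)
      simp only [zero_smul, exp_zero, one_mul, mul_one, mul_neg] at this
      rw [← sub_eq_add_neg] at this
      exact this
    have h2 := h1.tendsto_slope_zero_right
    refine (Submodule.closed_of_finiteDimensional T).mem_of_tendsto h2
      (Eventually.of_forall fun t => ?_)
    refine T.smul_mem _ (T.sub_mem ?_ ?_)
    · obtain ⟨n, -, hn⟩ := hX (0 + t)
      have hn : ρ n = _ := hn
      have hn' : ρ n⁻¹ = exp ((0 + t) • (-X)) := by
        calc ρ n⁻¹ = ρ n⁻¹ * (exp ((0 + t) • X) * exp (-((0 + t) • X))) := by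
              rw [exp_mul_exp_neg, mul_one]
          _ = exp ((0 + t) • (-X)) := by
              rw [← mul_assoc, ← hn, rho_inv_mul, one_mul, smul_neg]
      rw [← hn, ← hn']
      exact hT n Y hY
    · simpa using hY
  have h1 := key T hT X (hSl hX) Y hY
  have h2 := key S hS Y (hTl hY) X hX
  have h3 : X * Y - Y * X ∈ S := by
    have := S.neg_mem h2
    rwa [neg_sub] at this
  exact sub_eq_zero.1 (Submodule.disjoint_def.1 hST _ h3 h1)

end Hom

end CompactGroupAE

namespace CompactGroupAE

open Filter

section Cover

theorem hom_trivial {G : Type*} [Group G] [TopologicalSpace G] [IsTopologicalGroup G]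
    [CompactSpace G] [SimplyConnectedSpace G] [LocallyPathConnectedSpace G] (χ : G →* ℂ)
    (hχ : Continuous χ) (g : G) : χ g = 1 := by
  have hne : ∀ g, χ g ≠ 0 := fun g h => by
    have : χ g * χ g⁻¹ = 1 := by rw [← map_mul]; simp
    simp [h] at this
  obtain ⟨F, ⟨hF1, hF⟩, -⟩ := Complex.isCoveringMapOn_exp.existsUnique_continuousMap_lifts
    (⟨χ, hχ⟩ : C(G, ℂ)) (a₀ := 1) (e₀ := 0) (by simp) (fun a => hne a)
  have hF' : ∀ g, Complex.exp (F g) = χ g := fun g => congrFun hF g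
  have hmul : ∀ h g, F (g * h) = F g + F h := by
    intro h
    let F2 : C(G, ℂ) := ⟨fun g => F (g * h) - F h, by fun_prop⟩
    obtain ⟨F3, -, h3⟩ := Complex.isCoveringMapOn_exp.existsUnique_continuousMap_lifts
      (⟨χ, hχ⟩ : C(G, ℂ)) (a₀ := 1) (e₀ := 0) (by simp) (fun a => hne a)
    have h1 := h3 F ⟨hF1, hF⟩
    have h2 := h3 F2 ⟨by simp [F2], by
      ext g
      simp only [F2, Function.comp, ContinuousMap.coe_mk, Complex.exp_sub, hF', map_mul]
      field_simp [hne h]⟩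
    intro g
    have : F2 g = F g := by rw [h1, h2]
    simp only [F2, ContinuousMap.coe_mk] at this
    rw [← this]; ring
  have hpow : ∀ (n : ℕ) g, F (g ^ n) = n * F g := by
    intro n g
    induction n with
    | zero => simp [hF1]
    | succ k ih => rw [pow_succ, hmul, ih]; push_cast; ring
  obtain ⟨C, hC⟩ := (isCompact_range F.continuous).isBounded.exists_norm_le
  have h0 : F g = 0 := by
    by_contra hne0
    obtain ⟨n, hn⟩ := exists_nat_gt (C / ‖F g‖)
    have h1 := hC _ ⟨g ^ n, rfl⟩
    rw [hpow, norm_mul, Complex.norm_natCast] at h1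
    rw [div_lt_iff₀ (norm_pos_iff.2 hne0)] at hn
    linarith
  rw [← hF', h0, Complex.exp_zero]

theorem simplyConnected_of_retract {X Y : Type*} [TopologicalSpace X] [TopologicalSpace Y]
    [SimplyConnectedSpace X] (π : C(X, Y)) (σ : C(Y, X)) (h : ∀ y, π (σ y) = y) :
    SimplyConnectedSpace Y := by
  rw [simply_connected_iff_paths_homotopic']
  have hsurj : Function.Surjective π := fun y => ⟨σ y, h y⟩
  refine ⟨hsurj.pathConnectedSpace π.continuous, fun {x y} p q => ?_⟩
  have h1 := SimplyConnectedSpace.paths_homotopic (p.map σ.continuous) (q.map σ.continuous)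
  obtain ⟨H⟩ := h1
  exact ⟨{ toFun := fun z => π (H z)
           continuous_toFun := π.continuous.comp H.continuous
           map_zero_left := fun z => by simp [h]
           map_one_left := fun z => by simp [h]
           prop' := fun t z hz => by
             have : H (t, z) = σ (p z) := H.prop' t z hz
             simp only [ContinuousMap.coe_mk, this, h]
             rfl }⟩

/-- An element outside the identity component of a compact group is avoided by an
open subgroup. -/
theorem exists_openSubgroup_not_mem {E : Type*} [Group E] [TopologicalSpace E]
    [IsTopologicalGroup E] [CompactSpace E] [T2Space E] {x : E}
    (hx : x ∉ connectedComponent (1 : E)) : ∃ H : OpenSubgroup E, x ∉ H := by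
  rw [connectedComponent_eq_iInter_isClopen, Set.mem_iInter] at hx
  push Not at hx
  obtain ⟨⟨W, hW, h1⟩, hxW⟩ := hx
  obtain ⟨H, hH⟩ := IsTopologicalGroup.exist_openSubgroup_sub_clopen_nhds_of_one hW h1
  exact ⟨H, fun h => hxW (hH h)⟩

variable {E Q : Type*} [Group E] [TopologicalSpace E] [IsTopologicalGroup E] [CompactSpace E]
  [T2Space E] [Group Q] [TopologicalSpace Q] [IsTopologicalGroup Q] [T2Space Q]

theorem eq_one_of_mem_ker {p : E →* Q} (hp : Continuous p) (hs : Function.Surjective p)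
    (hcent : p.ker ≤ Subgroup.center E) (htd : IsTotallyDisconnected (p.ker : Set E))
    {V : Set Q} [SimplyConnectedSpace V] [LocallyPathConnectedSpace V] (h1V : (1 : Q) ∈ V)
    {U : Set E} (hU : IsPreconnected U) (h1U : (1 : E) ∈ U) (hUV : ∀ u ∈ U, p u ∈ V)
    {u : E} (hu : u ∈ U) (hpu : p u = 1) : u = 1 := by
  by_contra hne
  have hkc : IsClosed (p.ker : Set E) := by
    have : (p.ker : Set E) = p ⁻¹' {1} := by ext; simp [MonoidHom.mem_ker]
    rw [this]; exact isClosed_singleton.preimage hp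
  have hcs : CompactSpace p.ker := isCompact_iff_compactSpace.1 hkc.isCompact
  have htd' : TotallyDisconnectedSpace p.ker := totallyDisconnectedSpace_subtype_iff.2 htd
  obtain ⟨H, hH⟩ : ∃ H : OpenSubgroup p.ker, (⟨u, hpu⟩ : p.ker) ∉ H := by
    refine exists_openSubgroup_not_mem ?_
    rw [totallyDisconnectedSpace_iff_connectedComponent_singleton.1 htd' 1]
    simpa [Subtype.ext_iff] using hne
  let F := H.toSubgroup.map p.ker.subtype
  have hFk : F ≤ p.ker := by rintro _ ⟨x, -, rfl⟩; exact x.2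
  have hFn : F.Normal := ⟨fun n hn g => by
    have := Subgroup.mem_center_iff.1 (hcent (hFk hn)) g
    rw [this, mul_inv_cancel_right]; exact hn⟩
  have hFc : IsClosed (F : Set E) := by
    have : IsCompact (H : Set p.ker) := H.isClosed.isCompact
    exact (this.image continuous_subtype_val).isClosed
  let pb : E ⧸ F →* Q := QuotientGroup.lift F p hFk
  have hpb : Continuous pb := hp.quotient_lift _
  have hpbs : Function.Surjective pb := fun q => by
    obtain ⟨e, rfl⟩ := hs q; exact ⟨(e : E ⧸ F), rfl⟩
  have hT3 : IsClosed (F : Set E) := hFc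
  have : T2Space (E ⧸ F) := inferInstance
  have hquot : IsQuotientMap pb := IsQuotientMap.of_surjective_continuous hpbs hpb
  have hker : (pb.ker : Set (E ⧸ F)).Finite := by
    have hfi : Finite (p.ker ⧸ H.toSubgroup) := H.toSubgroup.quotient_finite_of_isOpen H.isOpen
    let m : p.ker ⧸ H.toSubgroup → E ⧸ F :=
      Quotient.lift (fun x : p.ker => ((x : E) : E ⧸ F)) (by
        intro a b hab
        refine QuotientGroup.eq.2 ?_
        exact ⟨a⁻¹ * b, QuotientGroup.leftRel_apply.1 hab, rfl⟩)
    refine (Set.finite_range m).subset ?_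
    rintro ⟨x⟩ hx
    have hx' : p x = 1 := hx
    exact ⟨((⟨x, hx'⟩ : p.ker) : p.ker ⧸ H.toSubgroup), rfl⟩
  have hcov : IsCoveringMap pb :=
    (hquot.isQuotientCoveringMap_of_isDiscrete_ker_monoidHom hker.isDiscrete).isCoveringMap
  obtain ⟨s, ⟨hs1, hs⟩, -⟩ := hcov.existsUnique_continuousMap_lifts
    (⟨Subtype.val, continuous_subtype_val⟩ : C(V, Q)) ⟨1, h1V⟩ 1 (by simp)
  have hUc : PreconnectedSpace U := isPreconnected_iff_preconnectedSpace.1 hU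
  have heq : (fun x : U => ((x : E) : E ⧸ F)) = fun x : U => s ⟨p x, hUV x x.2⟩ := by
    refine hcov.eq_of_comp_eq (continuous_quotient_mk'.comp continuous_subtype_val)
      (by fun_prop) ?_ ⟨1, h1U⟩ ?_
    · ext x
      exact (congrFun hs ⟨p x, hUV x x.2⟩).symm
    · simp only [map_one]
      exact hs1.symm
  have h2 := congrFun heq ⟨u, hu⟩
  simp only [hpu] at h2
  have h3 : ((u : E) : E ⧸ F) = 1 := h2.trans hs1
  obtain ⟨x, hx, hxu⟩ := (QuotientGroup.eq_one_iff u).1 h3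
  exact hH (by
    have : x = ⟨u, hpu⟩ := Subtype.ext hxu
    rw [← this]; exact hx)

/-- A continuous surjection from a compact group to a connected one stays surjective on the
identity component. -/
theorem surjOn_connectedComponent [ConnectedSpace Q] {p : E →* Q} (hp : Continuous p)
    (hs : Function.Surjective p) (q : Q) : ∃ e ∈ connectedComponent (1 : E), p e = q := by
  have hopen : ∀ H : OpenSubgroup E, ∃ e ∈ H, p e = q := by
    intro H
    have h1 : IsClosed (H.toSubgroup.map p : Set Q) := (H.isClosed.isCompact.image hp).isClosed
    have hfi : Finite (E ⧸ H.toSubgroup) := H.toSubgroup.quotient_finite_of_isOpen H.isOpen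
    have h2 : (H.toSubgroup.map p).FiniteIndex := by
      refine ⟨fun h => ?_⟩
      have h5 := Subgroup.index_map_dvd H.toSubgroup hs
      rw [h, zero_dvd_iff] at h5
      exact (Subgroup.finiteIndex_of_finite_quotient (H := H.toSubgroup)).index_ne_zero h5
    have h3 : IsOpen (H.toSubgroup.map p : Set Q) := Subgroup.isOpen_of_isClosed_of_finiteIndex _ h1
    have h4 := IsClopen.eq_univ ⟨h1, h3⟩ ⟨1, one_mem _⟩
    have : q ∈ (H.toSubgroup.map p : Set Q) := by rw [h4]; trivial
    exact this
  by_contra! hcon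
  have hempty : (p ⁻¹' {q}) ∩ ⋂ H : OpenSubgroup E, (H : Set E) = ∅ := by
    ext e
    simp only [Set.mem_inter_iff, Set.mem_preimage, Set.mem_singleton_iff, Set.mem_iInter,
      Set.mem_empty_iff_false, iff_false, not_and, not_forall]
    intro he
    exact exists_openSubgroup_not_mem fun h => hcon e h he
  have hcl : IsCompact (p ⁻¹' {q}) := (isClosed_singleton.preimage hp).isCompact
  obtain ⟨t, ht⟩ := hcl.elim_directed_family_closed
    (fun H : OpenSubgroup E => (H : Set E)) (fun H => H.isClosed) hempty
    (fun H H' => ⟨H ⊓ H', fun x hx => hx.1, fun x hx => hx.2⟩)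
  obtain ⟨e, he, hq⟩ := hopen t
  have : e ∈ (∅ : Set E) := by rw [← ht]; exact ⟨hq, he⟩
  exact this

end Cover

end CompactGroupAE

namespace CompactGroupAE

open Filter unitInterval

section Dimension

theorem covDimLE_mono {Z : Type u} [TopologicalSpace Z] {m n : ℕ} (h : CovDimLE Z m)
    (hmn : m ≤ n) : CovDimLE Z n := by
  intro 𝒰 h1 h2
  obtain ⟨𝒱, h3, h4, h5, h6⟩ := h 𝒰 h1 h2
  exact ⟨𝒱, h3, h4, h5, fun z => (h6 z).trans (by omega)⟩

theorem isAE_mono {X : Type u} [TopologicalSpace X] {m n : ℕ} (h : IsAE n X) (hmn : m ≤ n) :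
    IsAE m X :=
  fun Z _ h1 h2 h3 Z₀ hZ g₀ => h Z h1 h2 (covDimLE_mono h3 hmn) Z₀ hZ g₀

/-- A cover whose members are coloured, members of equal colour being disjoint, bounds the
order by the number of colours. -/
theorem card_le_of_colored {Z : Type u} {n : ℕ} {α : Type*} (c : α → Fin (n + 1)) (B : α → Set Z)
    (hB : ∀ a b z, c a = c b → z ∈ B a → z ∈ B b → a = b) (𝒱 : Finset (Set Z))
    (h𝒱 : ∀ V ∈ 𝒱, ∃ a, B a = V) (z : Z) :
    Nat.card {V : Set Z // V ∈ 𝒱 ∧ z ∈ V} ≤ n + 1 := by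
  choose f hf using h𝒱
  have := Nat.card_le_card_of_injective (fun V : {V : Set Z // V ∈ 𝒱 ∧ z ∈ V} => c (f V.1 V.2.1)) (by
    rintro ⟨V, hV, hz⟩ ⟨W, hW, hz'⟩ h
    have h1 := hB _ _ z h (by rw [hf]; exact hz) (by rw [hf]; exact hz')
    have : V = W := by rw [← hf V hV, ← hf W hW, h1]
    exact Subtype.ext this)
  simpa using this

/-- The Lebesgue number lemma for the product of a profinite space and a cube. -/
theorem exists_partition {K : Type u} [TopologicalSpace K] [CompactSpace K] [T2Space K]
    [TotallyDisconnectedSpace K] {M : Type*} [MetricSpace M] [CompactSpace M]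
    {𝒰 : Finset (Set (K × M))} (hU : ∀ U ∈ 𝒰, IsOpen U)
    (hcov : ⋃₀ (𝒰 : Set (Set (K × M))) = Set.univ) :
    ∃ (n : ℕ) (W : Fin n → Set K) (ε : ℝ), (∀ i, IsClopen (W i)) ∧ 0 < ε ∧
      ∀ k x, ∃ U ∈ 𝒰, ∀ k' x', (∀ i, k ∈ W i ↔ k' ∈ W i) → dist x x' < ε → (k', x') ∈ U := by
  have key : ∀ p : K × M, ∃ (W : Set K) (ε : ℝ) (U : Set (K × M)), IsClopen W ∧ p.1 ∈ W ∧ 0 < ε ∧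
      U ∈ 𝒰 ∧ ∀ k x, k ∈ W → dist x p.2 < ε → (k, x) ∈ U := by
    intro p
    obtain ⟨U, hU𝒰, hpU⟩ := Set.mem_sUnion.1 (hcov ▸ Set.mem_univ p)
    obtain ⟨O, hO, O', hO', hOU⟩ := mem_nhds_prod_iff.1 ((hU U hU𝒰).mem_nhds hpU)
    obtain ⟨O1, hO1, hO1o, hp1⟩ := mem_nhds_iff.1 hO
    obtain ⟨W, hW, hpW, hWO⟩ := compact_exists_isClopen_in_isOpen hO1o hp1
    obtain ⟨ε, hε, hεO⟩ := Metric.mem_nhds_iff.1 hO'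
    exact ⟨W, ε, U, hW, hpW, hε, hU𝒰, fun k x hk hx => hOU ⟨hO1 (hWO hk), hεO hx⟩⟩
  choose W ε U hW hpW hε hU𝒰 hWU using key
  obtain ⟨t, ht⟩ := isCompact_univ.elim_nhds_subcover
    (fun p => W p ×ˢ Metric.ball p.2 (ε p / 2)) (fun p _ =>
      prod_mem_nhds ((hW p).isOpen.mem_nhds (hpW p)) (Metric.ball_mem_nhds _ (half_pos (hε p))))
  obtain ⟨δ, hδ, hδε⟩ : ∃ δ > 0, ∀ p ∈ t, δ ≤ ε p / 2 := by
    by_cases hne : t.Nonempty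
    · obtain ⟨p, hp, hmin⟩ := t.exists_min_image (fun p => ε p / 2) hne
      exact ⟨_, half_pos (hε p), hmin⟩
    · exact ⟨1, one_pos, fun p hp => (hne ⟨p, hp⟩).elim⟩
  refine ⟨t.card, fun i => W (t.equivFin.symm i), δ, fun i => hW _, hδ, fun k x => ?_⟩
  obtain ⟨p, hp, hkp⟩ := Set.mem_iUnion₂.1 (ht.2 (Set.mem_univ (k, x)))
  refine ⟨U p, hU𝒰 p, fun k' x' hk' hx' => hWU p k' x' ?_ ?_⟩
  · have := hk' (t.equivFin ⟨p, hp⟩)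
    simp only [Equiv.symm_apply_apply] at this
    exact this.1 hkp.1
  · have h1 : dist x p.2 < ε p / 2 := hkp.2
    have h2 := dist_triangle_left x' p.2 x
    linarith [hδε p hp]

theorem covDimLE_prod_cube {K : Type u} [TopologicalSpace K] [CompactSpace K] [T2Space K]
    [TotallyDisconnectedSpace K] (d : ℕ) : CovDimLE (K × (Fin d → I)) d := by
  classical
  intro 𝒰 hU hcov
  obtain ⟨n, W, ε, hW, hε, hWU⟩ := exists_partition hU hcov
  obtain ⟨N, hN⟩ := exists_nat_gt (1 / ε)
  have hN0 : 0 < (N : ℝ) := (by positivity : 0 < 1 / ε).trans hN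
  let B : Fin (d + 1) × (Fin d → Finset.Icc (-1 : ℤ) N) × (Fin n → Bool) → Set (K × (Fin d → I)) :=
    fun a => {z | (∀ i, z.1 ∈ W i ↔ a.2.2 i = true) ∧
      ∀ j, ((a.2.1 j : ℤ) : ℝ) < N * (z.2 j : ℝ) - (a.1 : ℕ) / (d + 1 : ℝ) ∧
        N * (z.2 j : ℝ) - (a.1 : ℕ) / (d + 1 : ℝ) < (a.2.1 j : ℤ) + 1}
  have hBo : ∀ a, IsOpen (B a) := by
    intro a
    have h1 : IsOpen {z : K × (Fin d → I) | ∀ i, z.1 ∈ W i ↔ a.2.2 i = true} := by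
      have : {z : K × (Fin d → I) | ∀ i, z.1 ∈ W i ↔ a.2.2 i = true} =
          ⋂ i, Prod.fst ⁻¹' {k | k ∈ W i ↔ a.2.2 i = true} := by ext; simp
      rw [this]
      refine isOpen_iInter_of_finite fun i => IsOpen.preimage continuous_fst ?_
      cases h : a.2.2 i
      · have := (hW i).compl.isOpen
        convert this using 1
        ext; simp
      · simpa using (hW i).isOpen
    have h2 : IsOpen {z : K × (Fin d → I) | ∀ j, ((a.2.1 j : ℤ) : ℝ) < N * (z.2 j : ℝ) - (a.1 : ℕ) / (d + 1 : ℝ) ∧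
        N * (z.2 j : ℝ) - (a.1 : ℕ) / (d + 1 : ℝ) < (a.2.1 j : ℤ) + 1} := by
      have h3 : ∀ j, Continuous fun z : K × (Fin d → I) =>
          N * (z.2 j : ℝ) - (a.1 : ℕ) / (d + 1 : ℝ) := fun j => by fun_prop
      have := isOpen_iInter_of_finite fun j : Fin d =>
        (isOpen_Ioo (a := ((a.2.1 j : ℤ) : ℝ)) (b := (a.2.1 j : ℤ) + 1)).preimage (h3 j)
      convert this
      ext; simp
    exact h1.inter h2
  have hBdisj : ∀ a b z, a.1 = b.1 → z ∈ B a → z ∈ B b → a = b := by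
    rintro ⟨i, j, s⟩ ⟨i', j', s'⟩ z h ha hb
    obtain rfl : i = i' := h
    have h1 : j = j' := by
      funext k
      have h2 := ha.2 k
      have h3 := hb.2 k
      simp only at h2 h3
      have h4 : ((j k : ℤ) : ℝ) < (j' k : ℤ) + 1 := by linarith
      have h5 : ((j' k : ℤ) : ℝ) < (j k : ℤ) + 1 := by linarith
      have h4' : (j k : ℤ) < (j' k : ℤ) + 1 := by exact_mod_cast h4
      have h5' : (j' k : ℤ) < (j k : ℤ) + 1 := by exact_mod_cast h5
      exact Subtype.ext (by omega)
    have h2 : s = s' := by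
      funext k
      have h3 := (ha.1 k).symm.trans (hb.1 k)
      exact Bool.eq_iff_iff.2 h3
    rw [h1, h2]
  have hBU : ∀ a, (B a).Nonempty → ∃ U ∈ 𝒰, B a ⊆ U := by
    rintro a ⟨⟨k, x⟩, hz⟩
    obtain ⟨U, hU, h⟩ := hWU k x
    refine ⟨U, hU, fun z' hz' => h z'.1 z'.2 (fun i => (hz.1 i).trans (hz'.1 i).symm) ?_⟩
    rw [dist_pi_lt_iff hε]
    intro j
    have h1 := hz.2 j
    have h2 := hz'.2 j
    simp only at h1 h2
    rw [Subtype.dist_eq, Real.dist_eq]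
    have h3 : |(N : ℝ) * ((x j : ℝ) - z'.2 j)| < 1 := by
      rw [abs_lt]; constructor <;> nlinarith
    rw [abs_mul, abs_of_pos hN0] at h3
    have h4 : 1 < N * ε := by rwa [div_lt_iff₀ hε] at hN
    by_contra! h5
    nlinarith
  have hBcov : ∀ z, ∃ a, z ∈ B a := by
    rintro ⟨k, x⟩
    have h1 : ∃ i : Fin (d + 1), ∀ j, ∀ m : ℤ, N * (x j : ℝ) - (i : ℕ) / (d + 1 : ℝ) ≠ m := by
      by_contra! hcon
      choose j m hm using hcon
      obtain ⟨i, i', hne, hij⟩ := Fintype.exists_ne_map_eq_of_card_lt j (by simp)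
      have h2 := hm i
      have h3 := hm i'
      rw [hij] at h2
      have hd : (0 : ℝ) < d + 1 := by positivity
      have h4 : ((i' : ℕ) : ℝ) - (i : ℕ) = (m i - m i') * (d + 1) := by
        field_simp at h2 h3
        linarith
      have h5 : ((i' : ℕ) : ℤ) - (i : ℕ) = (m i - m i') * (d + 1) := by exact_mod_cast h4
      have h6 := i.2
      have h7 := i'.2
      have h8 : m i - m i' = 0 := by
        by_contra h
        rcases lt_or_gt_of_ne h with h | h
        · have : (m i - m i') * (d + 1 : ℤ) ≤ -1 * (d + 1) := by gcongr; omega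
          omega
        · have : 1 * (d + 1 : ℤ) ≤ (m i - m i') * (d + 1) := by gcongr; omega
          omega
      rw [h8] at h5
      exact hne (Fin.ext (by omega))
    obtain ⟨i, hi⟩ := h1
    have hi1 : (0 : ℝ) ≤ (i : ℕ) / (d + 1 : ℝ) := by positivity
    have hi2 : ((i : ℕ) : ℝ) / (d + 1 : ℝ) < 1 := by
      rw [div_lt_one (by positivity)]; exact_mod_cast i.2
    refine ⟨⟨i, fun j => ⟨⌊N * (x j : ℝ) - (i : ℕ) / (d + 1 : ℝ)⌋, ?_⟩, fun l => decide (k ∈ W l)⟩, ?_, ?_⟩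
    · rw [Finset.mem_Icc]
      have hx0 := (x j).2.1
      have hx1 := (x j).2.2
      constructor
      · rw [Int.le_floor]; push_cast; nlinarith
      · have : ((⌊N * (x j : ℝ) - (i : ℕ) / (d + 1 : ℝ)⌋ : ℤ) : ℝ) ≤ N := (Int.floor_le _).trans (by nlinarith)
        exact_mod_cast this
    · intro l; simp
    · intro j
      exact ⟨lt_of_le_of_ne (Int.floor_le _) (hi j _).symm, Int.lt_floor_add_one _⟩
  refine ⟨(Finset.univ.image B).filter Set.Nonempty, ?_, ?_, ?_, ?_⟩
  · intro V hV
    obtain ⟨a, -, rfl⟩ := Finset.mem_image.1 (Finset.mem_filter.1 hV).1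
    exact hBo a
  · refine Set.eq_univ_of_forall fun z => ?_
    obtain ⟨a, ha⟩ := hBcov z
    exact ⟨B a, by simpa using ⟨z, ha⟩, ha⟩
  · intro V hV
    obtain ⟨hV, hne⟩ := Finset.mem_filter.1 hV
    obtain ⟨a, -, rfl⟩ := Finset.mem_image.1 hV
    exact hBU a hne
  · refine card_le_of_colored (fun a => a.1) B hBdisj _ fun V hV => ?_
    obtain ⟨a, -, h⟩ := Finset.mem_image.1 (Finset.mem_filter.1 hV).1
    exact ⟨a, h⟩

end Dimension

section Extension

/-- The product of a space and a cube. -/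
abbrev Cyl (K : Type u) (d : ℕ) : Type u := K × (Fin d → I)

variable {X : Type u} [TopologicalSpace X]

theorem pathConnected_of_isAE [Nonempty X] (h : IsAE 1 X) : PathConnectedSpace X := by
  refine ⟨inferInstance, fun x y => ?_⟩
  let Z₀ : Set (Cyl PUnit.{u+1} 1) := {z | z.2 0 = 0 ∨ z.2 0 = 1}
  have hZ : IsClosed Z₀ := (isClosed_eq (by fun_prop) continuous_const).union
    (isClosed_eq (by fun_prop) continuous_const)
  let f : Cyl PUnit.{u+1} 1 → X := fun z => if z.2 0 = 0 then x else y
  have hf : ContinuousOn f Z₀ := by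
    refine ContinuousOn.union_of_isClosed ?_ ?_ (isClosed_eq (by fun_prop) continuous_const)
      (isClosed_eq (by fun_prop) continuous_const)
    · exact (continuousOn_const (c := x)).congr fun z (hz : z.2 0 = 0) => by simp [f, hz]
    · exact (continuousOn_const (c := y)).congr fun z (hz : z.2 0 = 1) => by simp [f, hz]
  obtain ⟨g, hg⟩ := h (Cyl PUnit.{u+1} 1) inferInstance inferInstance (covDimLE_prod_cube 1) Z₀ hZ ⟨_, hf.domRestrict⟩
  refine ⟨⟨⟨fun t => g (PUnit.unit, fun _ => t), by fun_prop⟩, ?_, ?_⟩⟩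
  · exact (hg ⟨(PUnit.unit, fun _ => 0), Or.inl rfl⟩).trans (by simp [f])
  · exact (hg ⟨(PUnit.unit, fun _ => 1), Or.inr rfl⟩).trans (by simp [f])

theorem simplyConnected_of_isAE [Nonempty X] (h : IsAE 2 X) : SimplyConnectedSpace X := by
  rw [simply_connected_iff_paths_homotopic']
  refine ⟨pathConnected_of_isAE (isAE_mono h (by norm_num)), fun {x y} p q => ?_⟩
  let S : Fin 2 → I → Set (Cyl PUnit.{u+1} 2) := fun i t => {z | z.2 i = t}
  have hS : ∀ i t, IsClosed (S i t) := fun i t => isClosed_eq (by fun_prop) continuous_const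
  let Z₀ : Set (Cyl PUnit.{u+1} 2) := S 0 0 ∪ S 0 1 ∪ S 1 0 ∪ S 1 1
  have hZ : IsClosed Z₀ := (((hS 0 0).union (hS 0 1)).union (hS 1 0)).union (hS 1 1)
  let f : Cyl PUnit.{u+1} 2 → X := fun z => if z.2 0 = 0 then p (z.2 1) else if z.2 0 = 1 then q (z.2 1) else
    if z.2 1 = 0 then x else y
  have hf : ContinuousOn f Z₀ := by
    refine ContinuousOn.union_of_isClosed (ContinuousOn.union_of_isClosed
      (ContinuousOn.union_of_isClosed ?_ ?_ (hS 0 0) (hS 0 1)) ?_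
      ((hS 0 0).union (hS 0 1)) (hS 1 0)) ?_ (((hS 0 0).union (hS 0 1)).union (hS 1 0)) (hS 1 1)
    · exact (Continuous.continuousOn (f := fun z : Cyl PUnit.{u+1} 2 => p (z.2 1)) (by fun_prop)).congr
        fun z (hz : z.2 0 = 0) => by simp [f, hz]
    · exact (Continuous.continuousOn (f := fun z : Cyl PUnit.{u+1} 2 => q (z.2 1)) (by fun_prop)).congr
        fun z (hz : z.2 0 = 1) => by simp [f, hz]
    · exact (continuousOn_const (c := x)).congr fun z (hz : z.2 1 = 0) => by simp [f, hz]
    · exact (continuousOn_const (c := y)).congr fun z (hz : z.2 1 = 1) => by simp [f, hz]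
  obtain ⟨g, hg⟩ := h (Cyl PUnit.{u+1} 2) inferInstance inferInstance (covDimLE_prod_cube 2) Z₀ hZ ⟨_, hf.domRestrict⟩
  have hg' : ∀ z (hz : z ∈ Z₀), g z = f z := fun z hz => hg ⟨z, hz⟩
  refine ⟨{ toFun := fun z => g (PUnit.unit, ![z.1, z.2])
            continuous_toFun := ?_
            map_zero_left := fun t => ?_
            map_one_left := fun t => ?_
            prop' := ?_ }⟩
  · refine g.continuous.comp (continuous_const.prodMk (continuous_pi fun i => ?_))
    fin_cases i
    · exact continuous_fst
    · exact continuous_snd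
  · rw [hg' _ (Or.inl (Or.inl (Or.inl rfl)))]
    simp [f]
  · rw [hg' _ (Or.inl (Or.inl (Or.inr rfl)))]
    simp [f]
  · rintro t z (rfl | rfl)
    · change g (PUnit.unit, ![t, 0]) = p 0
      rw [hg' _ (Or.inl (Or.inr rfl))]
      simp [f]
    · change g (PUnit.unit, ![t, 1]) = p 1
      rw [hg' _ (Or.inr rfl)]
      simp [f]

theorem locallyPathConnected_of_isAE {G : Type u} [Group G] [TopologicalSpace G]
    [IsTopologicalGroup G] [CompactSpace G] [T2Space G] (h : IsAE 1 G) :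
    LocallyPathConnectedSpace G := by
  have key : ∀ U : Set G, IsOpen U → (1 : G) ∈ U → pathComponentIn U (1 : G) ∈ 𝓝 (1 : G) := by
    intro U hU h1U
    let π : Ultrafilter G → G := Ultrafilter.extend id
    have hπ : Continuous π := continuous_ultrafilter_extend id
    have hπs : ∀ v, π (pure v) = v := fun v => ultrafilter_extend_pure id v
    let S : I → Set (Cyl (Ultrafilter G) 1) := fun t => {z | z.2 0 = t}
    have hS : ∀ t, IsClosed (S t) := fun t => isClosed_eq (by fun_prop) continuous_const
    let S' : Set (Cyl (Ultrafilter G) 1) := {z | π z.1 = 1}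
    have hS' : IsClosed S' := isClosed_eq (by fun_prop) continuous_const
    let f : Cyl (Ultrafilter G) 1 → G := fun z => if z.2 0 = 1 then π z.1 else 1
    have hf : ContinuousOn f (S 0 ∪ S 1 ∪ S') := by
      refine ContinuousOn.union_of_isClosed (ContinuousOn.union_of_isClosed ?_ ?_ (hS 0) (hS 1)) ?_
        ((hS 0).union (hS 1)) hS'
      · exact (continuousOn_const (c := (1 : G))).congr fun z (hz : z.2 0 = 0) => by simp [f, hz]
      · exact (Continuous.continuousOn (f := fun z : Cyl (Ultrafilter G) 1 => π z.1) (by fun_prop)).congr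
          fun z (hz : z.2 0 = 1) => by simp [f, hz]
      · exact (continuousOn_const (c := (1 : G))).congr fun z (hz : π z.1 = 1) => by simp [f, hz]
    obtain ⟨g, hg⟩ := h (Cyl (Ultrafilter G) 1) inferInstance inferInstance (covDimLE_prod_cube 1) _
      (((hS 0).union (hS 1)).union hS') ⟨_, hf.domRestrict⟩
    have hg' : ∀ z (hz : z ∈ S 0 ∪ S 1 ∪ S'), g z = f z := fun z hz => hg ⟨z, hz⟩
    let B : Set (Ultrafilter G) := Prod.fst '' (g ⁻¹' Uᶜ)
    have hB : IsClosed B :=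
      ((hU.isClosed_compl.preimage g.continuous).isCompact.image continuous_fst).isClosed
    have hV : IsOpen (π '' B)ᶜ := ((hB.isCompact.image hπ).isClosed).isOpen_compl
    refine mem_of_superset (hV.mem_nhds ?_) ?_
    · rintro ⟨k, ⟨⟨k', t⟩, hkt, rfl⟩, hk⟩
      refine hkt ?_
      rw [hg' _ (Or.inr hk)]
      simp only [f]
      simp only at hk
      split_ifs
      · rw [hk]; exact h1U
      · exact h1U
    · intro v hv
      have hin : ∀ t, g (pure v, t) ∈ U := by
        intro t
        by_contra hcon
        exact hv ⟨pure v, ⟨(pure v, t), hcon, rfl⟩, hπs v⟩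
      refine ⟨⟨⟨fun t => g (pure v, fun _ => t), by fun_prop⟩, ?_, ?_⟩, fun t => hin _⟩
      · exact (hg' (pure v, fun _ => 0) (Or.inl (Or.inl rfl))).trans (by simp [f])
      · exact (hg' (pure v, fun _ => 1) (Or.inl (Or.inr rfl))).trans (by simp [f, hπs])
  rw [locallyPathConnectedSpace_iff_pathComponentIn_mem_nhds]
  intro x U hU hxU
  have hc : Continuous fun g : G => x * g := continuous_const_mul x
  have h1 := key ((fun g => x * g) ⁻¹' U) (hU.preimage hc) (by simpa using hxU)
  have hc' : Tendsto (fun g : G => x⁻¹ * g) (𝓝 x) (𝓝 1) := by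
    have := (continuous_const_mul x⁻¹).tendsto x
    simpa using this
  refine mem_of_superset (hc' h1) ?_
  rintro y ⟨p, hp⟩
  refine ⟨(p.map hc).cast (by simp) (by simp), fun t => hp t⟩

end Extension

end CompactGroupAE

namespace CompactGroupAE

open Filter MeasureTheory InnerProductSpace

section Hilbert

variable {G : Type*} [Group G] [TopologicalSpace G] [IsTopologicalGroup G] [CompactSpace G]
  [T2Space G] {H : Type*} [NormedAddCommGroup H] [InnerProductSpace ℂ H] [CompleteSpace H]

/-- In a unitary representation of a compact group, a vector orthogonal to all
finite-dimensional invariant subspaces vanishes. -/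
theorem eq_zero_of_orthogonal_invariant (U : G →* (H ≃ₗᵢ[ℂ] H))
    (hU : ∀ v, Continuous fun g => U g v) (v : H)
    (hv : ∀ F : Submodule ℂ H, FiniteDimensional ℂ F → (∀ g, ∀ x ∈ F, U g x ∈ F) →
      ∀ x ∈ F, inner ℂ x v = 0) : v = 0 := by
  let _ : MeasurableSpace G := borel G
  have : BorelSpace G := ⟨rfl⟩
  let μ : Measure G := Measure.haarMeasure ⊤
  have hμ : IsProbabilityMeasure μ := ⟨by
    have := Measure.haarMeasure_self (G := G) (K₀ := ⊤)
    simpa [μ] using this⟩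
  let k : G → H →L[ℂ] H := fun y => rankOne ℂ (U y v) (U y v)
  have hkap : ∀ y x, k y x = inner ℂ (U y v) x • U y v := fun y x => rankOne_apply _ _ _
  have hk : Continuous k := by
    have h1 : Continuous fun y => innerSL ℂ (U y v) := (innerSL ℂ).continuous.comp (hU v)
    exact (ContinuousLinearMap.smulRightL ℂ H H).continuous₂.comp (h1.prodMk (hU v))
  have hki : Integrable k μ :=
    hk.integrable_of_hasCompactSupport (HasCompactSupport.of_compactSpace k)
  let T : H →L[ℂ] H := ∫ y, k y ∂μ
  have hT : ∀ x, T x = ∫ y, k y x ∂μ := fun x => ContinuousLinearMap.integral_apply hki x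
  have hkx : ∀ x, Integrable (fun y => k y x) μ := fun x => hki.apply_continuousLinearMap x
  have hin : ∀ x z, inner ℂ z (T x) = ∫ y, inner ℂ z (k y x) ∂μ := fun x z => by
    rw [hT, integral_inner (hkx x)]
  have hcomp : IsCompactOperator T := by
    have hcl : IsClosed ((compactOperator (RingHom.id ℂ) H H : Submodule ℂ (H →L[ℂ] H)) :
        Set (H →L[ℂ] H)) := isClosed_setOfPred_isCompactOperator
    have hcv : Convex ℝ ((compactOperator (RingHom.id ℂ) H H : Submodule ℂ (H →L[ℂ] H)) :
        Set (H →L[ℂ] H)) := ((compactOperator (RingHom.id ℂ) H H).restrictScalars ℝ).convex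
    refine hcv.integral_mem hcl (ae_of_all _ fun y => ?_) hki
    have h1 : k y = (ContinuousLinearMap.toSpanSingleton ℂ (U y v)) ∘L innerSL ℂ (U y v) := rfl
    have h2 : IsCompactOperator (ContinuousLinearMap.toSpanSingleton ℂ (U y v)) :=
      isCompactOperator_of_locallyCompactSpace_rng (ContinuousLinearMap.toSpanSingleton ℂ (U y v))
    rw [SetLike.mem_coe, h1]
    exact h2.comp_clm (innerSL ℂ (U y v))
  have hsymm : T.IsSymmetric := by
    intro x z
    simp only [ContinuousLinearMap.coe_coe]
    rw [← inner_conj_symm, hin, hin, ← integral_conj]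
    refine integral_congr_ae (ae_of_all _ fun y => ?_)
    simp only [hkap, inner_smul_right, map_mul, inner_conj_symm]
    ring
  have hcomm : ∀ g x, T (U g x) = U g (T x) := by
    intro g x
    have hinv : ∀ y, inner ℂ (U y v) (U g x) = inner ℂ (U (g⁻¹ * y) v) x := fun y => by
      rw [← (U g⁻¹).inner_map_map, map_mul]
      simp only [LinearIsometryEquiv.coe_mul, Function.comp_apply]
      congr 1
      rw [← Function.comp_apply (f := U g⁻¹) (g := U g), ← LinearIsometryEquiv.coe_mul, ← map_mul]
      simp
    have h2 : U g (T x) = ∫ y, U g (k y x) ∂μ := by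
      rw [hT]; exact ((U g).toContinuousLinearEquiv.toContinuousLinearMap.integral_comp_comm (hkx x)).symm
    rw [hT, h2, ← integral_mul_left_eq_self (fun y => U g (k y x)) g⁻¹]
    refine integral_congr_ae (ae_of_all _ fun y => ?_)
    simp only [hkap, hinv, map_smul]
    congr 1
    rw [← Function.comp_apply (f := U g), ← LinearIsometryEquiv.coe_mul, ← map_mul]
    simp
  have hT0 : T = 0 := by
    rw [← ContinuousLinearMap.eq_zero_of_forall_hasEigenvalue_eq_zero hcomp hsymm]
    intro c hc
    by_contra hc0
    obtain ⟨e, he⟩ := hc.exists_hasEigenvector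
    have hfd := ContinuousLinearMap.finite_dimensional_eigenspace hcomp c hc0
    have hinvt : ∀ g, ∀ x ∈ Module.End.eigenspace T.toLinearMap c,
        U g x ∈ Module.End.eigenspace T.toLinearMap c := by
      intro g x hx
      rw [Module.End.mem_eigenspace_iff] at hx ⊢
      simp only [ContinuousLinearMap.coe_coe] at hx ⊢
      rw [hcomm, hx, map_smul]
    have hperp := hv (Module.End.eigenspace T.toLinearMap c) hfd hinvt
    have horth : ∀ y, inner ℂ (U y v) e = 0 := fun y => by
      have h1 : U y⁻¹ (U y v) = v := by
        rw [← Function.comp_apply (f := U y⁻¹), ← LinearIsometryEquiv.coe_mul, ← map_mul]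
        simp
      rw [inner_eq_zero_symm, ← (U y⁻¹).inner_map_map, h1]
      refine hperp _ (hinvt _ _ ?_)
      exact he.1
    have hTe : T e = 0 := by
      rw [hT]
      simp [hkap, horth]
    have h3 := he.apply_eq_smul
    simp only [ContinuousLinearMap.coe_coe, hTe] at h3
    rcases smul_eq_zero.1 h3.symm with h | h
    · exact hc0 h
    · exact he.2 h
  have hzero : ∫ y, ‖(inner ℂ (U y v) v : ℂ)‖ ^ 2 ∂μ = 0 := by
    have h1 := hin v v
    rw [hT0] at h1
    simp only [zero_apply, inner_zero_right, hkap, inner_smul_right] at h1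
    have h2 : ∀ y, inner ℂ (U y v) v * inner ℂ v (U y v) = ((‖(inner ℂ (U y v) v : ℂ)‖ ^ 2 : ℝ) : ℂ) := by
      intro y
      rw [← inner_conj_symm v, Complex.mul_conj, Complex.normSq_eq_norm_sq]
    simp only [h2] at h1
    have h3 := h1.trans (integral_ofReal (f := fun y => ‖(inner ℂ (U y v) v : ℂ)‖ ^ 2))
    exact (Complex.ofReal_eq_zero.1 h3.symm)
  have hcont : Continuous fun y => ‖(inner ℂ (U y v) v : ℂ)‖ ^ 2 :=
    ((hU v).inner continuous_const).norm.pow 2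
  have h0 := (integral_eq_zero_iff_of_nonneg (fun y => by positivity)
    (hcont.integrable_of_hasCompactSupport (HasCompactSupport.of_compactSpace _))).1 hzero
  have h1 := congrFun ((hcont.ae_eq_iff_eq μ continuous_const).1 h0) 1
  simp only [map_one, LinearIsometryEquiv.coe_one, id_eq] at h1
  have h2 := pow_eq_zero_iff (two_ne_zero) |>.1 h1
  exact inner_self_eq_zero.1 (norm_eq_zero.1 h2)

end Hilbert

open scoped Matrix.Norms.Operator Matrix

/-- A unitary matrix representation of a topological group. -/
structure URep (G : Type*) [Group G] [TopologicalSpace G] where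
  ι : Type
  [fintype : Fintype ι]
  [deceq : DecidableEq ι]
  ρ : G →ₜ* Matrix ι ι ℂ
  unitary : ∀ g, (ρ g)ᴴ = ρ g⁻¹

attribute [instance] URep.fintype URep.deceq

section PeterWeyl

variable {G : Type*} [Group G] [TopologicalSpace G] [IsTopologicalGroup G] [CompactSpace G]
  [T2Space G]

/-- The matrix representation on a finite-dimensional invariant subspace. -/
theorem exists_urep_of_invariant {H : Type*} [NormedAddCommGroup H] [InnerProductSpace ℂ H]
    (U : G →* (H ≃ₗᵢ[ℂ] H)) (hU : ∀ v, Continuous fun g => U g v) (F : Submodule ℂ H)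
    [FiniteDimensional ℂ F] (hF : ∀ g, ∀ x ∈ F, U g x ∈ F) :
    ∃ R : URep G, ∀ g, R.ρ g = 1 → ∀ x ∈ F, U g x = x := by
  let b := stdOrthonormalBasis ℂ F
  have hadj : ∀ g (x y : H), inner ℂ (U g x) y = inner ℂ x (U g⁻¹ y) := fun g x y => by
    rw [← (U g⁻¹).inner_map_map, ← Function.comp_apply (f := U g⁻¹) (g := U g),
      ← LinearIsometryEquiv.coe_mul, ← map_mul]
    simp
  let M : G → Matrix (Fin (Module.finrank ℂ F)) (Fin (Module.finrank ℂ F)) ℂ :=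
    fun g => Matrix.of fun i j => inner ℂ (b i : H) (U g (b j))
  have hone : M 1 = 1 := by
    ext i j
    have := orthonormal_iff_ite.1 b.orthonormal i j
    simpa [M, Matrix.one_apply] using this
  have hmul : ∀ g h, M (g * h) = M g * M h := by
    intro g h
    ext i j
    have h1 := b.sum_inner_mul_inner ⟨U g⁻¹ (b i), hF _ _ (b i).2⟩ ⟨U h (b j), hF _ _ (b j).2⟩
    simp only [Submodule.coe_inner, hadj, inv_inv] at h1
    simp only [M, Matrix.of_apply, Matrix.mul_apply, h1, map_mul, LinearIsometryEquiv.coe_mul,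
      Function.comp_apply]
  have hcont : Continuous M := by
    refine continuous_matrix fun i j => ?_
    exact continuous_const.inner (hU _)
  refine ⟨⟨Fin (Module.finrank ℂ F), ⟨⟨⟨M, hone⟩, hmul⟩, hcont⟩, fun g => ?_⟩, fun g hg x hx => ?_⟩
  · ext i j
    change star (inner ℂ (b j : H) (U g (b i))) = inner ℂ (b i : H) (U g⁻¹ (b j))
    rw [← hadj, RCLike.star_def, inner_conj_symm]
  · have hg' : M g = 1 := hg
    have hb : ∀ j, (⟨U g (b j), hF _ _ (b j).2⟩ : F) = b j := fun j => by
      refine b.repr.injective ?_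
      ext i
      rw [b.repr_apply_apply, b.repr_apply_apply, Submodule.coe_inner,
        orthonormal_iff_ite.1 b.orthonormal i j]
      have h1 := congrFun (congrFun hg' i) j
      rw [Matrix.one_apply] at h1
      exact h1
    have hb' : ∀ j, U g (b j : H) = b j := fun j => congrArg Subtype.val (hb j)
    have h2 := congrArg Subtype.val (b.sum_repr ⟨x, hx⟩)
    simp only [AddSubmonoidClass.coe_finsetSum, Submodule.coe_smul] at h2
    rw [← h2, map_sum]
    simp only [map_smul, hb']

/-- Unitary representations of a compact group separate points. -/
theorem exists_urep_ne_one {g : G} (hg : g ≠ 1) : ∃ R : URep G, R.ρ g ≠ 1 := by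
  let _ : MeasurableSpace G := borel G
  have : BorelSpace G := ⟨rfl⟩
  let μ : Measure G := Measure.haar
  have : Fact ((2 : ENNReal) ≠ ⊤) := ⟨by simp⟩
  let U0 : G → (Lp ℂ 2 μ ≃ₗᵢ[ℂ] Lp ℂ 2 μ) := fun h =>
    { toFun := fun f => DomMulAct.mk h⁻¹ • f
      invFun := fun f => DomMulAct.mk h • f
      map_add' := fun f f' => smul_add _ f f'
      map_smul' := fun c f => smul_comm _ c f
      left_inv := fun f => by simp [smul_smul]
      right_inv := fun f => by simp [smul_smul]
      norm_map' := fun f => DomMulAct.norm_smul_Lp _ f }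
  let U : G →* (Lp ℂ 2 μ ≃ₗᵢ[ℂ] Lp ℂ 2 μ) :=
    { toFun := U0
      map_one' := by ext1 f; simp [U0]
      map_mul' := fun h h' => by
        ext1 f
        change DomMulAct.mk (h * h')⁻¹ • f = DomMulAct.mk h⁻¹ • DomMulAct.mk h'⁻¹ • f
        rw [smul_smul, ← DomMulAct.mk_mul, mul_inv_rev] }
  have hU : ∀ v, Continuous fun h => U h v := by
    intro v
    change Continuous fun h => DomMulAct.mk h⁻¹ • v
    have h1 : Continuous fun h : G => DomMulAct.mk h⁻¹ :=
      DomMulAct.continuous_mk.comp continuous_inv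
    exact h1.smul continuous_const
  by_contra! hcon
  have hfix : ∀ f : Lp ℂ 2 μ, U g f = f := by
    intro f
    rw [← sub_eq_zero]
    refine eq_zero_of_orthogonal_invariant U hU _ fun F hFd hF x hx => ?_
    obtain ⟨R, hR⟩ := exists_urep_of_invariant U hU F hF
    have h1 := hR g (hcon R) _ (hF g⁻¹ x hx)
    have h2 : U g (U g⁻¹ x) = x := by
      rw [← Function.comp_apply (f := U g), ← LinearIsometryEquiv.coe_mul, ← map_mul]
      simp
    rw [h2] at h1
    rw [inner_sub_right, sub_eq_zero]
    conv_lhs => rw [← h2]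
    rw [(U g).inner_map_map, ← h1]
  obtain ⟨φ, hφ0, hφ1, -⟩ := exists_continuous_zero_one_of_isClosed (X := G)
    (isClosed_singleton (x := g⁻¹)) (isClosed_singleton (x := (1 : G))) (by simpa using hg)
  have hmem : MemLp (fun x => (φ x : ℂ)) 2 μ :=
    (Complex.continuous_ofReal.comp φ.continuous).memLp_of_hasCompactSupport
      (HasCompactSupport.of_compactSpace _)
  have h1 := hfix hmem.toLp
  change DomMulAct.mk g⁻¹ • hmem.toLp = _ at h1
  rw [DomMulAct.mk_smul_toLp] at h1
  have h2 := (MemLp.toLp_eq_toLp_iff _ _).1 h1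
  have h3 := (Continuous.ae_eq_iff_eq μ (by simp; fun_prop) (by fun_prop)).1 h2
  have h4 := congrFun h3 1
  simp at h4
  rw [hφ1 rfl, hφ0 rfl] at h4
  simp at h4

/-- The direct sum of two unitary matrix representations. -/
noncomputable def URep.sum {G : Type*} [Group G] [TopologicalSpace G] (R R' : URep G) : URep G where
  ι := R.ι ⊕ R'.ι
  ρ :=
    { toFun := fun g => Matrix.fromBlocks (R.ρ g) 0 0 (R'.ρ g)
      map_one' := by simp
      map_mul' := fun g h => by simp [Matrix.fromBlocks_multiply]
      continuous_toFun := R.ρ.continuous_toFun.matrix_fromBlocks continuous_const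
        continuous_const R'.ρ.continuous_toFun }
  unitary := fun g => by
    change (Matrix.fromBlocks (R.ρ g) 0 0 (R'.ρ g))ᴴ = Matrix.fromBlocks (R.ρ g⁻¹) 0 0 (R'.ρ g⁻¹)
    rw [Matrix.fromBlocks_conjTranspose, R.unitary, R'.unitary]
    simp

theorem URep.sum_eq_iff {G : Type*} [Group G] [TopologicalSpace G] (R R' : URep G) (g h : G) :
    (R.sum R').ρ g = (R.sum R').ρ h ↔ R.ρ g = R.ρ h ∧ R'.ρ g = R'.ρ h := by
  change Matrix.fromBlocks (R.ρ g) 0 0 (R'.ρ g) = Matrix.fromBlocks (R.ρ h) 0 0 (R'.ρ h) ↔ _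
  rw [Matrix.fromBlocks_inj]
  simp

/-- A closed condition on `G` that can be met up to every unitary representation can be met. -/
theorem exists_mem_of_forall_urep {C : Set G} (hC : IsClosed C) (P : URep G → Set G)
    (hP : ∀ R, IsClosed (P R)) (hmono : ∀ R R', P (R.sum R') ⊆ P R ∩ P R')
    (hne : ∀ R, (C ∩ P R).Nonempty) : (C ∩ ⋂ R, P R).Nonempty := by
  by_contra hcon
  rw [Set.not_nonempty_iff_eq_empty] at hcon
  have : Nonempty (URep G) := ⟨⟨Unit, 1, fun g => by simp⟩⟩
  obtain ⟨R, hR⟩ := hC.isCompact.elim_directed_family_closed P hP hcon fun R R' =>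
    ⟨R.sum R', (hmono R R').trans Set.inter_subset_left, (hmono R R').trans Set.inter_subset_right⟩
  exact (hne R).ne_empty hR

/-- Every neighbourhood of the identity contains the kernel of a unitary representation. -/
theorem exists_urep_ker_subset {W : Set G} (hW : W ∈ 𝓝 (1 : G)) :
    ∃ R : URep G, ∀ g, R.ρ g = 1 → g ∈ W := by
  by_contra! hcon
  obtain ⟨O, hOW, hO, h1⟩ := mem_nhds_iff.1 hW
  obtain ⟨g, hg, hgP⟩ := exists_mem_of_forall_urep hO.isClosed_compl (fun R => {g | R.ρ g = 1})
    (fun R => isClosed_singleton.preimage R.ρ.continuous_toFun) (fun R R' g hg => by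
      have := (R.sum_eq_iff R' g 1).1 (hg.trans (map_one _).symm)
      simpa using this) (fun R => by
      obtain ⟨g, hg, hgW⟩ := hcon R
      exact ⟨g, fun h => hgW (hOW h), hg⟩)
  by_cases hg1 : g = 1
  · exact hg (hg1 ▸ h1)
  · obtain ⟨R, hR⟩ := exists_urep_ne_one hg1
    exact hR (Set.mem_iInter.1 hgP R)

end PeterWeyl

end CompactGroupAE

namespace CompactGroupAE

open Filter NormedSpace
open scoped Matrix.Norms.Operator Matrix ComplexOrder

section Invariant

variable {G : Type*} [Group G] [TopologicalSpace G] [IsTopologicalGroup G] [CompactSpace G]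

/-- Nested invariant subspaces have invariant complements. -/
theorem URep.exists_inv_compl (R : URep G) {S T : Submodule ℝ (Matrix R.ι R.ι ℂ)}
    (hS : AdInv R.ρ S) (hT : AdInv R.ρ T) (hST : S ≤ T) :
    ∃ S', AdInv R.ρ S' ∧ S' ≤ T ∧ Disjoint S S' ∧ S ⊔ S' = T := by
  let B : LinearMap.BilinForm ℝ (Matrix R.ι R.ι ℂ) :=
    LinearMap.mk₂ ℝ (fun X Y => (Matrix.trace (Xᴴ * Y)).re)
      (by intros; simp [add_mul]) (by intros; simp) (by intros; simp [mul_add]) (by intros; simp)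
  have hB : ∀ X Y, B X Y = (Matrix.trace (Xᴴ * Y)).re := fun X Y => rfl
  have hsymm : ∀ X Y, B X Y = B Y X := fun X Y => by
    rw [hB, hB, ← Complex.conj_re, ← Complex.star_def, ← Matrix.trace_conjTranspose]
    simp
  have hpos : ∀ X, B X X = 0 → X = 0 := fun X hX => by
    rw [← Matrix.trace_conjTranspose_mul_self_eq_zero_iff]
    apply Complex.ext
    · exact hX
    · have : star (Matrix.trace (Xᴴ * X)) = Matrix.trace (Xᴴ * X) := by
        rw [← Matrix.trace_conjTranspose]; simp
      exact Complex.conj_eq_iff_im.1 this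
  have hinv : ∀ g X Y, B (R.ρ g * X * R.ρ g⁻¹) Y = B X (R.ρ g⁻¹ * Y * R.ρ g) := fun g X Y => by
    have h1 := R.unitary g
    have h2 := R.unitary g⁻¹
    rw [inv_inv] at h2
    rw [hB, hB, Matrix.conjTranspose_mul, Matrix.conjTranspose_mul, h1, h2, mul_assoc, mul_assoc,
      Matrix.trace_mul_comm]
    simp only [mul_assoc]
  have hrefl : B.IsRefl := fun X Y h => by rw [hsymm, h]
  have hc : IsCompl S (B.orthogonal S) := by
    refine B.isCompl_orthogonal_of_restrict_nondegenerate hrefl ?_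
    refine (LinearMap.IsRefl.nondegenerate_iff_separatingLeft ?_).2 ?_
    · intro X Y h; exact hrefl _ _ h
    · intro X h
      exact Subtype.ext (hpos X (h X))
  refine ⟨B.orthogonal S ⊓ T, AdInv.inf ?_ hT, inf_le_right, hc.disjoint.mono_right inf_le_left, ?_⟩
  · intro g X hX Y hY
    have h1 := hS g⁻¹ Y hY
    rw [inv_inv] at h1
    exact (hsymm _ _).trans ((hinv g X Y).trans ((hsymm _ _).trans (hX _ h1)))
  · exact (sup_inf_assoc_of_le (B.orthogonal S) hST).symm.trans
      (by rw [hc.sup_eq_top, top_inf_eq])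

end Invariant

section Exp

variable {A : Type*} [NormedRing A] [NormedAlgebra ℝ A] [FiniteDimensional ℝ A]

theorem eq_of_exp_smul_eq {X Y : A} (h : ∀ t : ℝ, exp (t • X) = exp (t • Y)) : X = Y := by
  have h1 := hasDerivAt_exp_smul X 0
  have h2 := hasDerivAt_exp_smul Y 0
  rw [funext h] at h1
  simpa using h1.unique h2

theorem rho_inv_eq_exp {G : Type*} [Group G] [TopologicalSpace G] [IsTopologicalGroup G]
    [CompactSpace G] {ρ : G →ₜ* A} {g : G} {X : A} (h : ρ g = exp X) : ρ g⁻¹ = exp (-X) := by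
  calc ρ g⁻¹ = ρ g⁻¹ * (exp X * exp (-X)) := by rw [exp_mul_exp_neg, mul_one]
    _ = exp (-X) := by rw [← h, ← mul_assoc, rho_inv_mul, one_mul]

end Exp

theorem exp_mul_of_mul_eq {ι κ : Type*} [Fintype ι] [DecidableEq ι] [Fintype κ] [DecidableEq κ]
    {X : Matrix ι ι ℂ} {J : Matrix ι κ ℂ} {z : ℂ} (h : X * J = z • J) :
    exp X * J = Complex.exp z • J := by
  have h1 := exp_series_hasSum_exp' (𝕂 := ℂ) X
  have h2 := exp_series_hasSum_exp' (𝕂 := ℂ) z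
  have hc : Continuous fun Y : Matrix ι ι ℂ => Y * J := by fun_prop
  have h3 := h1.map (AddMonoidHom.mk' (fun Y : Matrix ι ι ℂ => Y * J)
    (fun a b => Matrix.add_mul a b J)) hc
  have hc' : Continuous fun w : ℂ => w • J := by fun_prop
  have h4 := h2.map (AddMonoidHom.mk' (fun w : ℂ => w • J) (fun a b => add_smul a b J)) hc'
  have hp : ∀ n : ℕ, X ^ n * J = z ^ n • J := by
    intro n
    induction n with
    | zero => simp
    | succ k ih =>
      rw [pow_succ, Matrix.mul_assoc, h, Matrix.mul_smul, ih, smul_smul, pow_succ, mul_comm]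
  rw [Complex.exp_eq_exp_ℂ]
  have h5 : (fun n : ℕ => ((n.factorial : ℂ)⁻¹ • X ^ n) * J) =
      fun n : ℕ => ((n.factorial : ℂ)⁻¹ • z ^ n) • J := by
    funext n
    rw [Matrix.smul_mul, hp, smul_smul, smul_eq_mul]
  have h6 : HasSum (fun n : ℕ => ((n.factorial : ℂ)⁻¹ • X ^ n) * J) (exp X * J) := h3
  rw [h5] at h6
  exact h6.unique h4

section Center

variable {G : Type*} [Group G] [TopologicalSpace G] [IsTopologicalGroup G] [CompactSpace G]

theorem URep.skew (R : URep G) {X : Matrix R.ι R.ι ℂ} (hX : ∀ t : ℝ, ∃ g, R.ρ g = exp (t • X)) :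
    Xᴴ = -X := by
  refine eq_of_exp_smul_eq fun t => ?_
  obtain ⟨g, hg⟩ := hX t
  have h1 : exp (t • Xᴴ) = R.ρ g⁻¹ := by
    rw [← R.unitary, hg, ← Matrix.exp_conjTranspose, Matrix.conjTranspose_smul]
    simp
  refine h1.trans ((rho_inv_eq_exp hg).trans ?_)
  rw [smul_neg]

theorem URep.eq_zero_of_commute [SimplyConnectedSpace G] [LocallyPathConnectedSpace G]
    (R : URep G) {X : Matrix R.ι R.ι ℂ} (hX : ∀ t : ℝ, ∃ g, R.ρ g = exp (t • X))
    (hc : ∀ g, R.ρ g * X = X * R.ρ g) : X = 0 := by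
  have hskew := R.skew hX
  have hH : (Complex.I • X).IsHermitian := by
    rw [Matrix.IsHermitian, Matrix.conjTranspose_smul, hskew]
    simp
  by_contra hne
  have hev : hH.eigenvalues ≠ 0 := fun h => by
    rw [hH.eigenvalues_eq_zero_iff] at h
    exact hne ((smul_eq_zero.1 h).resolve_left Complex.I_ne_zero)
  obtain ⟨i, hi⟩ := Function.ne_iff.1 hev
  set z : ℂ := -Complex.I * hH.eigenvalues i with hz
  have hz0 : z ≠ 0 := mul_ne_zero (neg_ne_zero.2 Complex.I_ne_zero) (by exact_mod_cast hi)
  let V : Submodule ℂ (R.ι → ℂ) := Module.End.eigenspace (Matrix.toLin' X) z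
  have hV : ∀ v, v ∈ V ↔ X *ᵥ v = z • v := fun v => by
    rw [Module.End.mem_eigenspace_iff, Matrix.toLin'_apply]
  have hVne : V ≠ ⊥ := by
    have h1 := hH.mulVec_eigenvectorBasis i
    rw [Matrix.smul_mulVec] at h1
    refine (Submodule.ne_bot_iff _).2 ⟨(hH.eigenvectorBasis i).ofLp, ?_, ?_⟩
    · rw [hV]
      calc X *ᵥ (hH.eigenvectorBasis i).ofLp
          = (-Complex.I) • Complex.I • (X *ᵥ (hH.eigenvectorBasis i).ofLp) := by
            rw [smul_smul]; simp
        _ = z • (hH.eigenvectorBasis i).ofLp := by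
            rw [h1, hz, mul_smul]
            rfl
    · intro h
      have h2 := hH.eigenvectorBasis.orthonormal.ne_zero i
      exact h2 (by ext k; exact congrFun h k)
  let b := Module.finBasis ℂ V
  obtain ⟨π, hπ⟩ := V.subtype.exists_leftInverse_of_injective V.ker_subtype
  let J := LinearMap.toMatrix' (V.subtype ∘ₗ b.equivFun.symm.toLinearMap)
  let Q := LinearMap.toMatrix' (b.equivFun.toLinearMap ∘ₗ π)
  have hJV : ∀ w, J *ᵥ w ∈ V := fun w => by
    change LinearMap.toMatrix' _ *ᵥ w ∈ V
    rw [LinearMap.toMatrix'_mulVec]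
    exact (b.equivFun.symm w).2
  have hJQ : ∀ v ∈ V, J *ᵥ (Q *ᵥ v) = v := fun v hv => by
    change LinearMap.toMatrix' _ *ᵥ (LinearMap.toMatrix' _ *ᵥ v) = v
    rw [LinearMap.toMatrix'_mulVec, LinearMap.toMatrix'_mulVec]
    have := LinearMap.congr_fun hπ ⟨v, hv⟩
    simp only [LinearMap.comp_apply, Submodule.subtype_apply, LinearMap.id_apply] at this
    simp [this]
  have hQJ : Q * J = 1 := by
    change LinearMap.toMatrix' _ * LinearMap.toMatrix' _ = 1
    rw [← LinearMap.toMatrix'_comp, ← LinearMap.toMatrix'_id]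
    congr 1
    have : (b.equivFun.toLinearMap ∘ₗ π) ∘ₗ V.subtype ∘ₗ b.equivFun.symm.toLinearMap =
      b.equivFun.toLinearMap ∘ₗ (π ∘ₗ V.subtype) ∘ₗ b.equivFun.symm.toLinearMap := rfl
    rw [this, hπ]
    ext; simp
  have hXJ : X * J = z • J := by
    refine Matrix.ext_of_mulVec_single fun j => ?_
    rw [← Matrix.mulVec_mulVec, (hV _).1 (hJV _), Matrix.smul_mulVec]
  have hρJ : ∀ g, J * (Q * (R.ρ g * J)) = R.ρ g * J := fun g => by
    refine Matrix.ext_of_mulVec_single fun j => ?_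
    rw [← Matrix.mulVec_mulVec, ← Matrix.mulVec_mulVec, ← Matrix.mulVec_mulVec]
    refine hJQ _ ?_
    rw [hV, Matrix.mulVec_mulVec, ← hc, ← Matrix.mulVec_mulVec, (hV _).1 (hJV _),
      Matrix.mulVec_smul]
  let χ : G →* ℂ :=
    { toFun := fun g => (Q * (R.ρ g * J)).det
      map_one' := by simp [hQJ]
      map_mul' := fun g h => by
        rw [← Matrix.det_mul, map_mul]
        congr 1
        rw [Matrix.mul_assoc, Matrix.mul_assoc Q, Matrix.mul_assoc (R.ρ g) J, hρJ] }
  have hρ : Continuous R.ρ := R.ρ.continuous_toFun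
  have hχ : Continuous χ := by
    change Continuous fun g => (Q * (R.ρ g * J)).det
    exact Continuous.matrix_det (by fun_prop)
  have hd : 0 < Module.finrank ℂ V :=
    Module.finrank_pos_iff.2 (Submodule.nontrivial_iff_ne_bot.2 hVne)
  have key : ∀ t : ℝ, Complex.exp ((t : ℂ) * (Module.finrank ℂ V * z)) = 1 := fun t => by
    obtain ⟨g, hg⟩ := hX t
    have h1 : (t • X) * J = ((t : ℂ) * z) • J := by
      rw [Matrix.smul_mul, hXJ, ← Complex.coe_smul, smul_smul]
    have h2 := hom_trivial χ hχ g
    change (Q * (R.ρ g * J)).det = 1 at h2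
    rw [hg, exp_mul_of_mul_eq h1, Matrix.mul_smul, hQJ, Matrix.det_smul, Matrix.det_one,
      mul_one, Fintype.card_fin, ← Complex.exp_nat_mul] at h2
    rw [← h2]; ring_nf
  have h1 : HasDerivAt (fun t : ℝ => Complex.exp ((t : ℂ) * (Module.finrank ℂ V * z)))
      (Complex.exp (((0 : ℝ) : ℂ) * (Module.finrank ℂ V * z)) * (1 * (Module.finrank ℂ V * z))) 0 :=
    HasDerivAt.cexp (((hasDerivAt_id (0 : ℝ)).ofReal_comp).mul_const _)
  rw [funext key] at h1
  have h2 := h1.unique (hasDerivAt_const (0 : ℝ) (1 : ℂ))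
  simp only [Complex.ofReal_zero, zero_mul, Complex.exp_zero, one_mul, mul_eq_zero,
    Nat.cast_eq_zero] at h2
  rcases h2 with h2 | h2
  · exact hd.ne' h2
  · exact hz0 h2

end Center

end CompactGroupAE

namespace CompactGroupAE

open Filter NormedSpace

section Good

variable {A : Type*} [NormedRing A] [NormedAlgebra ℝ A] [FiniteDimensional ℝ A]
  {G : Type*} [Group G] [TopologicalSpace G] [IsTopologicalGroup G] [CompactSpace G]

/-- The Lie algebra of the image of a representation. -/
def lieTop (ρ : G →ₜ* A) : Submodule ℝ A := (img ρ ⊤ isClosed_univ).lie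

theorem mem_lieTop {ρ : G →ₜ* A} {X : A} : X ∈ lieTop ρ ↔ ∀ t : ℝ, ∃ g, ρ g = exp (t • X) :=
  ⟨fun h t => let ⟨g, _, hg⟩ := h t; ⟨g, hg⟩, fun h t => let ⟨g, hg⟩ := h t; ⟨g, trivial, hg⟩⟩

theorem adInv_lieTop (ρ : G →ₜ* A) : AdInv ρ (lieTop ρ) := adInv_lie inferInstance _

/-- Representations of semisimple type: invariant subspaces have invariant complements, and
the Lie algebra has trivial centre. -/
structure Good (ρ : G →ₜ* A) : Prop where
  compl : ∀ {S T : Submodule ℝ A}, AdInv ρ S → AdInv ρ T → S ≤ T →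
    ∃ S', AdInv ρ S' ∧ S' ≤ T ∧ Disjoint S S' ∧ S ⊔ S' = T
  center : ∀ {X : A}, X ∈ lieTop ρ → (∀ g, ρ g * X = X * ρ g) → X = 0

theorem commute_of_conj_eq {ρ : G →ₜ* A} {g : G} {X : A} (h : ρ g * X * ρ g⁻¹ = X) :
    ρ g * X = X * ρ g := by
  conv_rhs => rw [← h]
  rw [mul_assoc, mul_assoc, rho_inv_mul, mul_one]

theorem Good.eq_one_of_central {ρ : G →ₜ* A} (hρ : Good ρ) {N : Subgroup G}
    (hN : IsClosed (N : Set G)) (hc : IsPreconnected (N : Set G)) (hz : N ≤ Subgroup.center G) :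
    ∀ n ∈ N, ρ n = 1 := by
  refine eq_one_of_lie_eq_bot (hN := hN) hc ((Submodule.eq_bot_iff _).2 fun X hX => ?_)
  refine hρ.center (lie_mono le_top hX) fun g => commute_of_conj_eq (eq_of_exp_smul_eq fun t => ?_)
  obtain ⟨n, hn, hnX⟩ := hX t
  have hnX : ρ n = exp (t • X) := hnX
  have h1 : t • (ρ g * X * ρ g⁻¹) = ρ g * (t • X) * ρ g⁻¹ := by simp
  rw [h1, exp_conj_rho, ← hnX, ← map_mul, ← map_mul]
  have := Subgroup.mem_center_iff.1 (hz hn) g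
  rw [this, mul_assoc, mul_inv_cancel, mul_one]

theorem Good.eq_one_of_commutative {ρ : G →ₜ* A} (hρ : Good ρ) [ConnectedSpace G]
    (hz : ∀ g h, ρ g * ρ h = ρ h * ρ g) (g : G) : ρ g = 1 := by
  refine eq_one_of_lie_eq_bot (N := ⊤) (hN := isClosed_univ) isPreconnected_univ
    ((Submodule.eq_bot_iff _).2 fun X hX => ?_) g trivial
  refine hρ.center hX fun g => commute_of_conj_eq (eq_of_exp_smul_eq fun t => ?_)
  obtain ⟨n, hn, hnX⟩ := hX t
  have hnX : ρ n = exp (t • X) := hnX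
  have h1 : t • (ρ g * X * ρ g⁻¹) = ρ g * (t • X) * ρ g⁻¹ := by simp
  rw [h1, exp_conj_rho, ← hnX, hz, mul_assoc, rho_mul_inv, mul_one]

/-- A central element of the image of a connected group: commuting with the Lie algebra suffices. -/
theorem commute_of_fixer [ConnectedSpace G] {ρ : G →ₜ* A} {g : G}
    (h : g ∈ fixer ρ (lieTop ρ : Set A)) (x : G) : ρ g * ρ x = ρ x * ρ g := by
  have : (⊤ : Subgroup G) ≤ fixer ρ {ρ g} := by
    refine le_of_exp (ρ := ρ) (hN := isClosed_univ) isPreconnected_univ fun n _ X hX hn => ?_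
    intro Y hY
    rw [Set.mem_singleton_iff] at hY
    rw [hY, hn]
    exact (exp_commute (h X hX)).eq.symm
  exact (this (Subgroup.mem_top x) _ rfl).symm

/-- A nonzero minimal invariant subspace of the Lie algebra. -/
structure IsMinInv (ρ : G →ₜ* A) (𝔪 : Submodule ℝ A) : Prop where
  le : 𝔪 ≤ lieTop ρ
  inv : AdInv ρ 𝔪
  ne_bot : 𝔪 ≠ ⊥
  eq_of_le : ∀ S ≤ 𝔪, AdInv ρ S → S ≠ ⊥ → S = 𝔪

theorem exists_isMinInv {ρ : G →ₜ* A} (S : Submodule ℝ A) (hle : S ≤ lieTop ρ) (hS : AdInv ρ S)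
    (h0 : S ≠ ⊥) : ∃ 𝔪 ≤ S, IsMinInv ρ 𝔪 := by
  induction S using WellFoundedLT.induction with
  | ind S ih =>
    by_cases h : ∀ S' ≤ S, AdInv ρ S' → S' ≠ ⊥ → S' = S
    · exact ⟨S, le_rfl, hle, hS, h0, h⟩
    · push Not at h
      obtain ⟨S', h1, h2, h3, h4⟩ := h
      obtain ⟨𝔪, h5, h6⟩ := ih S' (lt_of_le_of_ne h1 h4) (h1.trans hle) h2 h3
      exact ⟨𝔪, h5.trans h1, h6⟩

theorem Good.exists_isMinInv_not_mem_fixer {ρ : G →ₜ* A} (hρ : Good ρ) {g : G}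
    (hg : g ∉ fixer ρ (lieTop ρ : Set A)) : ∃ 𝔪, IsMinInv ρ 𝔪 ∧ g ∉ fixer ρ (𝔪 : Set A) := by
  by_contra! hcon
  refine hg ?_
  have key : ∀ S : Submodule ℝ A, S ≤ lieTop ρ → AdInv ρ S → g ∈ fixer ρ (S : Set A) := by
    intro S
    induction S using WellFoundedLT.induction with
    | ind S ih =>
      intro hle hS
      by_cases h0 : S = ⊥
      · rw [h0]
        intro X hX
        rw [SetLike.mem_coe, Submodule.mem_bot] at hX
        simp [hX]
      · obtain ⟨𝔪, hmS, hm⟩ := exists_isMinInv S hle hS h0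
        obtain ⟨S', h1, h2, h3, h4⟩ := hρ.compl hm.inv hS hmS
        have hlt : S' < S := by
          refine lt_of_le_of_ne h2 fun h => hm.ne_bot ?_
          rw [h] at h3
          exact (disjoint_of_le_iff_left_eq_bot hmS).1 h3
        have h5 := ih S' hlt (h2.trans hle) h1
        have h6 := hcon 𝔪 hm
        intro X hX
        rw [← h4, SetLike.mem_coe, Submodule.mem_sup] at hX
        obtain ⟨y, hy, z, hz, rfl⟩ := hX
        rw [mul_add, add_mul, h6 y hy, h5 z hz]
  exact key _ le_rfl (adInv_lieTop ρ)

theorem IsMinInv.fixer_ne_top {ρ : G →ₜ* A} (hρ : Good ρ) {𝔪 : Submodule ℝ A}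
    (hm : IsMinInv ρ 𝔪) : fixer ρ (𝔪 : Set A) ≠ ⊤ := by
  intro h
  obtain ⟨X, hX, hX0⟩ := (Submodule.ne_bot_iff _).1 hm.ne_bot
  refine hX0 (hρ.center (hm.le hX) fun g => ?_)
  have : g ∈ fixer ρ (𝔪 : Set A) := by rw [h]; trivial
  exact this X hX

theorem fixer_normal {ρ : G →ₜ* A} {S : Submodule ℝ A} (hS : AdInv ρ S) :
    (fixer ρ (S : Set A)).Normal := by
  refine ⟨fun n hn g X hX => ?_⟩
  have h1 := hn _ (hS g⁻¹ X hX)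
  rw [inv_inv] at h1
  calc ρ (g * n * g⁻¹) * X
      = ρ g * (ρ n * (ρ g⁻¹ * X * ρ g)) * ρ g⁻¹ := by
        simp only [map_mul, mul_assoc, rho_mul_inv, mul_one]
    _ = (ρ g * ρ g⁻¹) * X * (ρ g * ρ n * ρ g⁻¹) := by rw [h1]; simp only [mul_assoc]
    _ = X * ρ (g * n * g⁻¹) := by rw [rho_mul_inv, one_mul, map_mul, map_mul]

theorem ker_le_fixer {ρ : G →ₜ* A} {S : Set A} {g : G} (hg : ρ g = 1) : g ∈ fixer ρ S := by
  intro X _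
  simp [hg]

/-- A closed normal subgroup containing the fixer of a minimal invariant subspace is
everything, or agrees with the fixer near the identity. -/
theorem IsMinInv.eq_top_or_eventually {ρ : G →ₜ* A} (hρ : Good ρ) [ConnectedSpace G]
    {𝔪 : Submodule ℝ A} (hm : IsMinInv ρ 𝔪) {N : Subgroup G} (hn : N.Normal)
    (hN : IsClosed (N : Set G)) (hle : fixer ρ (𝔪 : Set A) ≤ N) :
    N = ⊤ ∨ ∀ᶠ g in 𝓝 (1 : G), g ∈ N → g ∈ fixer ρ (𝔪 : Set A) := by
  have hinv : AdInv ρ (img ρ N hN).lie := adInv_lie hn hN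
  have hlie : (img ρ N hN).lie ≤ lieTop ρ := lie_mono le_top
  by_cases h0 : (img ρ N hN).lie ⊓ 𝔪 = ⊥
  · right
    filter_upwards [eventually_exp ρ N hN univ_mem] with g hg hgN
    obtain ⟨X, hX, -, hgX⟩ := hg hgN
    intro Y hY
    have := commute_of_disjoint (N := ⊤) (hN := isClosed_univ) hinv hm.inv
      (disjoint_iff.2 h0) hlie hm.le hX hY
    rw [hgX]
    exact (exp_commute this.symm).eq.symm
  · left
    have h1 := hm.eq_of_le _ inf_le_right (hinv.inf hm.inv) h0
    have h2 : 𝔪 ≤ (img ρ N hN).lie := inf_eq_right.1 h1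
    obtain ⟨𝔪', h3, h4, h5, h6⟩ := hρ.compl hm.inv (adInv_lieTop ρ) hm.le
    have h7 : 𝔪' ≤ (img ρ N hN).lie := by
      intro X hX t
      obtain ⟨g, hg⟩ := mem_lieTop.1 (h4 hX) t
      refine ⟨g, hle ?_, hg⟩
      intro Y hY
      have := commute_of_disjoint (N := ⊤) (hN := isClosed_univ) hm.inv h3 h5 hm.le h4 hY hX
      rw [hg]
      exact (exp_commute (this.smul_right t)).eq.symm
    have h8 : lieTop ρ ≤ (img ρ N hN).lie := by
      rw [← h6]
      exact sup_le h2 h7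
    refine top_le_iff.1 (le_of_exp (ρ := ρ) (hN := isClosed_univ) isPreconnected_univ ?_)
    intro g _ X hX hgX
    obtain ⟨n, hnN, hnX⟩ := (img ρ N hN).exp_mem (h8 hX)
    have hnX : ρ n = exp X := hnX
    have h9 : ρ (g * n⁻¹) = 1 := by rw [map_mul, hgX, ← hnX, rho_mul_inv]
    have := N.mul_mem (hle (ker_le_fixer h9)) hnN
    simpa using this

/-- A closed normal connected subgroup and its centralizer generate, up to the kernel. -/
theorem Good.sup_fixer_eq_top {ρ : G →ₜ* A} (hρ : Good ρ) [ConnectedSpace G] {M : Subgroup G}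
    (hn : M.Normal) (hM : IsClosed (M : Set G)) (hc : IsPreconnected (M : Set G)) :
    M ⊔ fixer ρ (ρ '' M) = ⊤ := by
  have hinv : AdInv ρ (img ρ M hM).lie := adInv_lie hn hM
  have hlie : (img ρ M hM).lie ≤ lieTop ρ := lie_mono le_top
  obtain ⟨S, h1, h2, h3, h4⟩ := hρ.compl hinv (adInv_lieTop ρ) hlie
  refine top_le_iff.1 (le_of_exp (ρ := ρ) (hN := isClosed_univ) isPreconnected_univ ?_)
  intro g _ X hX hgX
  have hX : X ∈ lieTop ρ := hX
  rw [← h4, Submodule.mem_sup] at hX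
  obtain ⟨Y, hY, Z, hZ, rfl⟩ := hX
  have hcomm : ∀ Y ∈ (img ρ M hM).lie, Commute Y Z := fun Y hY =>
    commute_of_disjoint (N := ⊤) (hN := isClosed_univ) hinv h1 h3 hlie h2 hY hZ
  rw [exp_add_comm (hcomm Y hY)] at hgX
  obtain ⟨m, hm, hmY⟩ := (img ρ M hM).exp_mem hY
  have hmY : ρ m = exp Y := hmY
  have h5 : M ≤ fixer ρ {Z} := by
    refine le_of_exp (ρ := ρ) (hN := hM) hc fun n _ X hX hnX => ?_
    intro W hW
    rw [Set.mem_singleton_iff] at hW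
    rw [hnX, hW]
    exact (exp_commute (hcomm X hX).symm).eq.symm
  have h6 : m⁻¹ * g ∈ fixer ρ (ρ '' M) := by
    have h7 : ρ (m⁻¹ * g) = exp Z := by
      rw [map_mul, hgX, ← hmY, ← mul_assoc, rho_inv_mul, one_mul]
    rintro _ ⟨n, hn, rfl⟩
    rw [h7]
    exact (exp_commute (h5 hn Z rfl)).eq.symm
  have := Subgroup.mul_mem_sup hm h6
  simpa using this

end Good

section Global

open scoped Matrix.Norms.Operator

variable {G : Type u} [Group G] [TopologicalSpace G] [IsTopologicalGroup G] [CompactSpace G]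

theorem URep.good [SimplyConnectedSpace G] [LocallyPathConnectedSpace G] (R : URep G) :
    Good R.ρ where
  compl hS hT hST := R.exists_inv_compl hS hT hST
  center hX hc := R.eq_zero_of_commute (mem_lieTop.1 hX) hc

variable [T2Space G]

theorem eq_one_of_forall_urep {g : G} (h : ∀ R : URep G, R.ρ g = 1) : g = 1 := by
  by_contra hg
  obtain ⟨R, hR⟩ := exists_urep_ne_one hg
  exact hR (h R)

variable [SimplyConnectedSpace G] [LocallyPathConnectedSpace G]

theorem eq_bot_of_central {N : Subgroup G} (hN : IsClosed (N : Set G))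
    (hc : IsPreconnected (N : Set G)) (hz : N ≤ Subgroup.center G) : N = ⊥ :=
  (Subgroup.eq_bot_iff_forall _).2 fun n hn =>
    eq_one_of_forall_urep fun R => R.good.eq_one_of_central hN hc hz n hn

/-- A compact simply connected group has no proper closed normal subgroup with abelian quotient. -/
theorem eq_top_of_commutator_mem {N : Subgroup G} (hn : N.Normal) (hN : IsClosed (N : Set G))
    (hc : ∀ a b : G, a * b * a⁻¹ * b⁻¹ ∈ N) : N = ⊤ := by
  rw [Subgroup.eq_top_iff']
  intro g
  rw [← QuotientGroup.eq_one_iff]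
  refine eq_one_of_forall_urep fun R => ?_
  let R' : URep G :=
    { ι := R.ι
      ρ := R.ρ.comp ⟨QuotientGroup.mk' N, QuotientGroup.continuous_mk⟩
      unitary := fun g => R.unitary _ }
  refine R'.good.eq_one_of_commutative (fun a b => ?_) g
  change R.ρ (a : G ⧸ N) * R.ρ (b : G ⧸ N) = R.ρ (b : G ⧸ N) * R.ρ (a : G ⧸ N)
  rw [← map_mul, ← map_mul]
  congr 1
  rw [← QuotientGroup.mk_mul, ← QuotientGroup.mk_mul, QuotientGroup.eq]
  have := hc b⁻¹ a⁻¹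
  simpa [mul_assoc] using this

end Global

end CompactGroupAE

namespace CompactGroupAE

open Filter NormedSpace

section LocEuc

/-- `X` is locally Euclidean at `x`. -/
def LocEuc {X : Type*} [TopologicalSpace X] (x : X) : Prop :=
  ∃ (n : ℕ) (e : OpenPartialHomeomorph (EuclideanSpace ℝ (Fin n)) X), x ∈ e.target

theorem isTopManifold_of_locEuc {X : Type*} [TopologicalSpace X] (h : ∀ x : X, LocEuc x) :
    IsTopManifold X := fun x =>
  let ⟨n, e, hx⟩ := h x
  ⟨n, e.target, e.source, e.open_target, hx, e.open_source, ⟨e.symm.toHomeomorphSourceTarget⟩⟩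

theorem simplyConnected_of_homeo {X Y : Type*} [TopologicalSpace X] [TopologicalSpace Y]
    (e : X ≃ₜ Y) [SimplyConnectedSpace X] : SimplyConnectedSpace Y :=
  simplyConnected_of_retract ⟨e, e.continuous⟩ ⟨e.symm, e.symm.continuous⟩ e.apply_symm_apply

theorem LocEuc.exists_simplyConnected {X : Type*} [TopologicalSpace X] {x : X} (h : LocEuc x) :
    ∃ V : Set X, IsOpen V ∧ x ∈ V ∧ SimplyConnectedSpace V ∧ LocallyPathConnectedSpace V := by
  obtain ⟨n, e, hx⟩ := h
  obtain ⟨r, hr, hb⟩ := Metric.isOpen_iff.1 e.open_source _ (e.map_target hx)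
  have hV : IsOpen (e '' Metric.ball (e.symm x) r) := e.isOpen_image_of_subset_source Metric.isOpen_ball hb
  let f := e.homeomorphOfImageSubsetSource hb rfl
  have h1 : ContractibleSpace (Metric.ball (e.symm x) r) :=
    (convex_ball _ _).contractibleSpace ⟨_, Metric.mem_ball_self hr⟩
  have h2 : LocallyPathConnectedSpace (Metric.ball (e.symm x) r) :=
    Metric.isOpen_ball.locallyPathConnectedSpace
  exact ⟨_, hV, ⟨_, Metric.mem_ball_self hr, e.right_inv hx⟩, simplyConnected_of_homeo f,
    f.isQuotientMap.locallyPathConnectedSpace⟩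

theorem LocEuc.of_chart {E X : Type*} [NormedAddCommGroup E] [NormedSpace ℝ E]
    [FiniteDimensional ℝ E] [TopologicalSpace X] {x : X} (e : OpenPartialHomeomorph E X)
    (hx : x ∈ e.target) : LocEuc x :=
  ⟨_, (toEuclidean (E := E)).symm.toHomeomorph.toOpenPartialHomeomorph.trans e, by simpa using hx⟩

/-- Local Euclideanness lifts along open maps that are locally injective. -/
theorem LocEuc.lift {X Y : Type*} [TopologicalSpace X] [TopologicalSpace Y] {f : Y → X}
    (hf : Continuous f) (ho : IsOpenMap f) {U : Set Y} (hU : IsOpen U) (hi : Set.InjOn f U)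
    {y : Y} (hy : y ∈ U) (h : LocEuc (f y)) : LocEuc y := by
  obtain ⟨n, e, hx⟩ := h
  have : Nonempty U := ⟨⟨y, hy⟩⟩
  have h1 : IsOpenEmbedding (fun u : U => f u) :=
    .of_continuous_injective_isOpenMap (by fun_prop) (fun a b hab => Subtype.ext (hi a.2 b.2 hab))
      (ho.comp hU.isOpenMap_subtype_val)
  let q := h1.toOpenPartialHomeomorph
  let v := hU.isOpenEmbedding_subtypeVal.toOpenPartialHomeomorph
  refine ⟨n, (e.trans q.symm).trans v, ?_⟩
  have hv : v.symm y = ⟨y, hy⟩ := v.left_inv (x := ⟨y, hy⟩) (by simp [v])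
  have hvt : y ∈ v.target := by simp [v, hy]
  simp only [OpenPartialHomeomorph.trans_target, Set.mem_inter_iff, Set.mem_preimage, hv,
    hvt, true_and, OpenPartialHomeomorph.symm_target, OpenPartialHomeomorph.symm_symm]
  exact ⟨by simp [q], hx⟩

theorem LocEuc.of_one {Q : Type*} [Group Q] [TopologicalSpace Q] [IsTopologicalGroup Q]
    (h : LocEuc (1 : Q)) (q : Q) : LocEuc q := by
  refine LocEuc.lift (f := fun x => q⁻¹ * x) (by fun_prop) (isOpenMap_mul_left _) isOpen_univ
    (fun a _ b _ hab => mul_left_cancel hab) trivial ?_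
  simpa using h

theorem CptGrp.locEuc {A : Type*} [NormedRing A] [NormedAlgebra ℝ A] [FiniteDimensional ℝ A]
    (Γ : CptGrp A) (k : Γ.K) : LocEuc k := by
  obtain ⟨Q, h0, hQ⟩ := Γ.exists_exp_chart k
  refine LocEuc.of_chart Q ?_
  have := Q.map_source h0
  rw [hQ] at this
  convert this
  ext
  simp [CptGrp.expAt]

end LocEuc

section IdComp

variable {E : Type*} [Group E] [TopologicalSpace E] [IsTopologicalGroup E]

/-- The identity component of a subgroup. -/
def idComp (H : Subgroup E) : Subgroup E := (Subgroup.connectedComponentOfOne H).map H.subtype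

theorem coe_idComp (H : Subgroup E) : (idComp H : Set E) = connectedComponentIn (H : Set E) 1 := by
  rw [connectedComponentIn_eq_image H.one_mem]
  rfl

theorem idComp_le (H : Subgroup E) : idComp H ≤ H := by
  rintro _ ⟨x, -, rfl⟩
  exact x.2

theorem isPreconnected_idComp (H : Subgroup E) : IsPreconnected (idComp H : Set E) := by
  rw [coe_idComp]
  exact isPreconnected_connectedComponentIn

theorem isClosed_idComp {H : Subgroup E} (hH : IsClosed (H : Set E)) :
    IsClosed (idComp H : Set E) :=
  hH.isClosedEmbedding_subtypeVal.isClosedMap _ isClosed_connectedComponent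

theorem idComp_normal {H : Subgroup E} (hn : H.Normal) : (idComp H).Normal := by
  refine ⟨fun n hx g => ?_⟩
  have h1 : (fun x => g * x * g⁻¹) '' (idComp H : Set E) ⊆ idComp H := by
    rw [coe_idComp H]
    refine IsPreconnected.subset_connectedComponentIn ?_ ?_ ?_
    · exact isPreconnected_connectedComponentIn.image _ (by fun_prop)
    · exact ⟨1, by rw [← coe_idComp]; exact (idComp H).one_mem, by simp⟩
    · rintro _ ⟨x, hx, rfl⟩
      exact hn.conj_mem _ (connectedComponentIn_subset _ _ hx) _
  exact h1 ⟨n, hx, rfl⟩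

theorem totallyDisconnectedSpace_of_one (h : connectedComponent (1 : E) = {1}) :
    TotallyDisconnectedSpace E := by
  rw [totallyDisconnectedSpace_iff_connectedComponent_singleton]
  intro x
  refine Set.Subset.antisymm (fun y hy => ?_) (by simpa using mem_connectedComponent)
  have h1 : (fun z => x⁻¹ * z) '' connectedComponent x ⊆ connectedComponent 1 :=
    (isPreconnected_connectedComponent.image _ (by fun_prop)).subset_connectedComponent
      ⟨x, mem_connectedComponent, by simp⟩
  have h2 := h1 ⟨y, hy, rfl⟩
  rw [h, Set.mem_singleton_iff, inv_mul_eq_one] at h2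
  exact h2.symm

theorem central_of_totallyDisconnected [ConnectedSpace E] {N : Subgroup E} (hn : N.Normal)
    (ht : IsTotallyDisconnected (N : Set E)) : N ≤ Subgroup.center E := by
  intro n hN
  rw [Subgroup.mem_center_iff]
  intro g
  have h1 : IsPreconnected ((fun g => g * n * g⁻¹) '' (Set.univ : Set E)) :=
    isPreconnected_univ.image _ (by fun_prop)
  have h2 := ht _ (by rintro _ ⟨g, -, rfl⟩; exact hn.conj_mem _ hN _) h1 ⟨g, trivial, rfl⟩
    ⟨1, trivial, rfl⟩
  simpa [mul_inv_eq_iff_eq_mul] using h2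

/-- The quotient by the identity component of a closed normal subgroup has totally
disconnected kernel over the quotient by that subgroup. -/
theorem isTotallyDisconnected_ker [CompactSpace E] [T2Space E] {H : Subgroup E}
    (hH : IsClosed (H : Set E)) {M : Subgroup E} (hM : M = idComp H) (hn : M.Normal)
    {Q : Type*} [Group Q] (p : E ⧸ M →* Q) (hp : ∀ e : E, p e = 1 ↔ e ∈ H) :
    IsTotallyDisconnected (p.ker : Set (E ⧸ M)) := by
  rw [← totallyDisconnectedSpace_subtype_iff]
  refine totallyDisconnectedSpace_of_one (E := p.ker) ?_
  have hMc : IsClosed (M : Set E) := by rw [hM]; exact isClosed_idComp hH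
  have : CompactSpace H := isCompact_iff_compactSpace.1 hH.isCompact
  let f : H → p.ker := fun h => ⟨(h : E), (hp h).2 h.2⟩
  have hfc : Continuous f :=
    (QuotientGroup.continuous_mk.comp continuous_subtype_val).subtype_mk _
  have hfs : Function.Surjective f := by
    rintro ⟨x, hx⟩
    induction x using QuotientGroup.induction_on with
    | H e => exact ⟨⟨e, (hp e).1 hx⟩, rfl⟩
  have hq : IsQuotientMap f := IsQuotientMap.of_surjective_continuous hfs hfc
  have hfib : ∀ y, IsConnected (f ⁻¹' {y}) := by
    intro y
    obtain ⟨h, rfl⟩ := hfs y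
    have h1 : f ⁻¹' {f h} = (fun x => h * x) '' connectedComponent (1 : H) := by
      ext x
      have h2 : f x = f h ↔ ((h⁻¹ * x : H) : E) ∈ M := by
        rw [eq_comm, Subtype.ext_iff]
        exact QuotientGroup.eq
      have h3 : ((h⁻¹ * x : H) : E) ∈ M ↔ h⁻¹ * x ∈ connectedComponent (1 : H) := by
        rw [hM]
        constructor
        · rintro ⟨z, hz, hzx⟩
          rwa [← Subtype.ext hzx]
        · intro h; exact ⟨_, h, rfl⟩
      rw [Set.mem_preimage, Set.mem_singleton_iff, h2, h3]
      constructor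
      · intro h4; exact ⟨_, h4, by simp⟩
      · rintro ⟨z, hz, rfl⟩; simpa using hz
    rw [h1]
    exact isConnected_connectedComponent.image _ (by fun_prop)
  have h1 := hq.isCoinducing.image_connectedComponent hfib 1
  have h2 : f 1 = 1 := rfl
  rw [h2] at h1
  rw [← h1]
  refine Set.Subset.antisymm ?_ ?_
  · rintro _ ⟨z, hz, rfl⟩
    refine Subtype.ext ((QuotientGroup.eq_one_iff _).2 ?_)
    rw [hM]
    exact ⟨z, hz, rfl⟩
  · rintro _ rfl
    exact ⟨1, mem_connectedComponent, rfl⟩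

theorem isTotallyDisconnected_of_idComp {H : Subgroup E} (h : idComp H = ⊥) :
    IsTotallyDisconnected (H : Set E) := by
  rw [← totallyDisconnectedSpace_subtype_iff]
  refine totallyDisconnectedSpace_of_one (E := H) (Set.Subset.antisymm (fun x hx => ?_) ?_)
  · have h1 : (x : E) ∈ idComp H := ⟨x, hx, rfl⟩
    rw [h, Subgroup.mem_bot] at h1
    exact Subtype.ext h1
  · rintro _ rfl
    exact mem_connectedComponent

theorem isTotallyDisconnected_of_central [CompactSpace E] [T2Space E] [SimplyConnectedSpace E]
    [LocallyPathConnectedSpace E] {H : Subgroup E} (hH : IsClosed (H : Set E))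
    (hz : H ≤ Subgroup.center E) : IsTotallyDisconnected (H : Set E) :=
  isTotallyDisconnected_of_idComp
    (eq_bot_of_central (isClosed_idComp hH) (isPreconnected_idComp H) ((idComp_le H).trans hz))

end IdComp

end CompactGroupAE

namespace CompactGroupAE

open Filter NormedSpace

section Chart

variable {A : Type*} [NormedRing A] [NormedAlgebra ℝ A] [FiniteDimensional ℝ A]
  {G : Type*} [Group G] [TopologicalSpace G] [IsTopologicalGroup G] [CompactSpace G]

/-- The adjoint representation on an invariant subspace. -/
noncomputable def adRep (ρ : G →ₜ* A) {S : Submodule ℝ A} (hS : AdInv ρ S) : G →ₜ* (S →L[ℝ] S) where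
  toFun g := LinearMap.toContinuousLinearMap
    (((LinearMap.mulLeft ℝ (ρ g)) ∘ₗ (LinearMap.mulRight ℝ (ρ g⁻¹))).restrict (p := S) (q := S)
      (fun X hX => by
        have := hS g X hX
        simpa [mul_assoc] using this))
  map_one' := by ext X; simp [LinearMap.restrict_apply]
  map_mul' g h := by ext X; simp [LinearMap.restrict_apply, mul_assoc]
  continuous_toFun := by
    rw [continuous_clm_apply]
    intro X
    have hc : Continuous ρ := ρ.continuous_toFun
    refine Continuous.subtype_mk (f := fun g => ρ g * ((X : A) * ρ g⁻¹)) (by fun_prop) _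

theorem adRep_apply (ρ : G →ₜ* A) {S : Submodule ℝ A} (hS : AdInv ρ S) (g : G) (X : S) :
    (adRep ρ hS g X : A) = ρ g * (X * ρ g⁻¹) := rfl

theorem adRep_eq_one_iff {ρ : G →ₜ* A} {S : Submodule ℝ A} {hS : AdInv ρ S} {g : G} :
    adRep ρ hS g = 1 ↔ g ∈ fixer ρ (S : Set A) := by
  constructor
  · intro h X hX
    have h1 := adRep_apply ρ hS g ⟨X, hX⟩
    rw [h] at h1
    exact commute_of_conj_eq ((mul_assoc _ _ _).trans h1.symm)
  · intro h
    ext X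
    rw [adRep_apply, ← mul_assoc, h X X.2, mul_assoc, rho_mul_inv, mul_one]
    rfl

theorem locEuc_quotient {B : Type*} [NormedRing B] [NormedAlgebra ℝ B] [FiniteDimensional ℝ B]
    (σ : G →ₜ* B) {H : Subgroup G} [H.Normal] (hH : ∀ g, σ g = 1 ↔ g ∈ H) (q : G ⧸ H) :
    LocEuc q := by
  let Γ := img σ ⊤ isClosed_univ
  let s : G →* Γ.K := σ.toMonoidHom.codRestrict Γ.K (fun g => ⟨g, trivial, rfl⟩)
  have hs : ∀ g, (s g : B) = σ g := fun g => rfl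
  let φ : G ⧸ H →* Γ.K := QuotientGroup.lift H s (fun g hg => Subtype.ext ((hH g).2 hg))
  have hφc : Continuous φ := by
    rw [(QuotientGroup.isQuotientMap_mk (N := H)).continuous_iff]
    exact σ.continuous_toFun.subtype_mk _
  have hφi : Function.Injective φ := by
    intro a b
    induction a using QuotientGroup.induction_on with
    | H a =>
      induction b using QuotientGroup.induction_on with
      | H b =>
        intro hab
        have h1 : σ a = σ b := congrArg Subtype.val hab
        rw [QuotientGroup.eq, ← hH, map_mul, ← h1, rho_inv_mul]
  have hφs : Function.Surjective φ := by
    rintro ⟨_, g, -, rfl⟩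
    exact ⟨g, rfl⟩
  let e := Continuous.homeoOfEquivCompactToT2 (f := Equiv.ofBijective φ ⟨hφi, hφs⟩) hφc
  exact LocEuc.lift e.continuous e.isOpenMap isOpen_univ e.injective.injOn trivial (Γ.locEuc (e q))

end Chart

section Quotient

open scoped Matrix.Norms.Operator

variable {G : Type u} [Group G] [TopologicalSpace G] [IsTopologicalGroup G] [CompactSpace G]
  [T2Space G] [SimplyConnectedSpace G] [LocallyPathConnectedSpace G]

theorem idComp_open {H M : Subgroup G} [H.Normal] [hn : M.Normal] (hH : IsClosed (H : Set G))
    (hM : M = idComp H) (hloc : LocEuc (1 : G ⧸ H)) :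
    (∀ᶠ g in 𝓝 (1 : G), g ∈ H → g ∈ M) ∧ LocEuc (1 : G ⧸ M) := by
  have hMc : IsClosed (M : Set G) := by rw [hM]; exact isClosed_idComp hH
  have hle : M ≤ H := by rw [hM]; exact idComp_le H
  let p : G ⧸ M →* G ⧸ H := QuotientGroup.map M H (MonoidHom.id G) hle
  have hp : ∀ g : G, p g = (g : G ⧸ H) := fun g => rfl
  have hpc : Continuous p := by
    rw [(QuotientGroup.isQuotientMap_mk (N := M)).continuous_iff]
    exact QuotientGroup.continuous_mk
  have hps : Function.Surjective p := fun x => by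
    induction x using QuotientGroup.induction_on with
    | H g => exact ⟨g, rfl⟩
  have hpo : IsOpenMap p := by
    intro S hS
    have h1 : p '' S = (QuotientGroup.mk : G → G ⧸ H) '' ((QuotientGroup.mk : G → G ⧸ M) ⁻¹' S) := by
      ext x
      constructor
      · rintro ⟨y, hy, rfl⟩
        induction y using QuotientGroup.induction_on with
        | H g => exact ⟨g, hy, rfl⟩
      · rintro ⟨g, hg, rfl⟩
        exact ⟨g, hg, rfl⟩
    rw [h1]
    exact QuotientGroup.isOpenMap_coe _ (hS.preimage QuotientGroup.continuous_mk)
  have hconn : ConnectedSpace (G ⧸ M) :=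
    Function.Surjective.connectedSpace QuotientGroup.mk_surjective QuotientGroup.continuous_mk
  have hLPC : LocallyPathConnectedSpace (G ⧸ M) :=
    (QuotientGroup.isQuotientMap_mk (N := M)).locallyPathConnectedSpace
  have htd := isTotallyDisconnected_ker hH hM hn p
    (fun e => by rw [hp, QuotientGroup.eq_one_iff])
  have hcent := central_of_totallyDisconnected (MonoidHom.normal_ker p) htd
  obtain ⟨V, hV, h1V, hVs, hVl⟩ := hloc.exists_simplyConnected
  let W := connectedComponentIn (p ⁻¹' V) 1
  have hWo : IsOpen W := (hV.preimage hpc).connectedComponentIn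
  have h1 : (1 : G ⧸ M) ∈ p ⁻¹' V := by simpa using h1V
  have h1W : (1 : G ⧸ M) ∈ W := mem_connectedComponentIn h1
  have key : ∀ w ∈ W, p w = 1 → w = 1 := fun w hw hpw =>
    eq_one_of_mem_ker hpc hps hcent htd h1V isPreconnected_connectedComponentIn h1W
      (fun u hu => connectedComponentIn_subset (p ⁻¹' V) 1 hu) hw hpw
  constructor
  · have h2 : (QuotientGroup.mk : G → G ⧸ M) ⁻¹' W ∈ 𝓝 (1 : G) :=
      (hWo.preimage QuotientGroup.continuous_mk).mem_nhds h1W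
    filter_upwards [h2] with g hg hgH
    rw [← QuotientGroup.eq_one_iff]
    exact key _ hg (by rw [hp, QuotientGroup.eq_one_iff]; exact hgH)
  · have h3 : ∀ᶠ z : (G ⧸ M) × (G ⧸ M) in 𝓝 (1, 1), z.1⁻¹ * z.2 ∈ W := by
      have hc : Continuous fun z : (G ⧸ M) × (G ⧸ M) => z.1⁻¹ * z.2 := by fun_prop
      exact hc.continuousAt.eventually_mem (hWo.mem_nhds (by simpa using h1W))
    rw [nhds_prod_eq] at h3
    obtain ⟨S, hS, hSW⟩ := (eventually_prod_self_iff (r := fun a b => a⁻¹ * b ∈ W)).1 h3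
    obtain ⟨O, hOS, hO, h1O⟩ := mem_nhds_iff.1 hS
    refine LocEuc.lift hpc hpo hO (fun a ha b hb hab => ?_) h1O (by simpa using hloc)
    have h4 := key _ (hSW a (hOS ha) b (hOS hb)) (by rw [map_mul, map_inv, hab, inv_mul_cancel])
    exact inv_mul_eq_one.1 h4

theorem exists_mul_centralizer {M : Subgroup G} (hn : M.Normal) (hM : IsClosed (M : Set G))
    (hc : IsPreconnected (M : Set G)) (g : G) :
    ∃ c ∈ Subgroup.centralizer (M : Set G), g * c⁻¹ ∈ M := by
  have h1 := exists_mem_of_forall_urep (C := {c : G | g * c⁻¹ ∈ M})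
    (hM.preimage (by fun_prop)) (fun R => {c | ∀ n ∈ M, R.ρ (c * n) = R.ρ (n * c)})
    (fun R => by
      have hρ : Continuous R.ρ := R.ρ.continuous_toFun
      have : {c | ∀ n ∈ M, R.ρ (c * n) = R.ρ (n * c)} =
        ⋂ n ∈ M, {c | R.ρ (c * n) = R.ρ (n * c)} := by ext; simp
      rw [this]
      exact isClosed_biInter fun n _ => isClosed_eq (by fun_prop) (by fun_prop))
    (fun R R' c hc => ⟨fun n hn => ((URep.sum_eq_iff R R' _ _).1 (hc n hn)).1,
      fun n hn => ((URep.sum_eq_iff R R' _ _).1 (hc n hn)).2⟩)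
    (fun R => by
      have h2 := R.good.sup_fixer_eq_top hn hM hc
      have h3 := h2.ge (Subgroup.mem_top g)
      obtain ⟨m, hm, c, hc', rfl⟩ := Subgroup.mem_sup_of_normal_left.1 h3
      refine ⟨c, by simpa using hm, fun n hn => ?_⟩
      rw [map_mul, map_mul]
      exact hc' _ ⟨n, hn, rfl⟩)
  obtain ⟨c, hcg, hcP⟩ := h1
  refine ⟨c, ?_, hcg⟩
  rw [Subgroup.mem_centralizer_iff]
  intro n hn
  rw [← inv_mul_eq_one]
  refine eq_one_of_forall_urep fun R => ?_
  have := Set.mem_iInter.1 hcP R n hn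
  rw [map_mul, this, ← map_mul, inv_mul_cancel, map_one]

end Quotient

end CompactGroupAE

namespace CompactGroupAE

open Filter NormedSpace

section SimpleQuotient

theorem isClosed_sup {G : Type*} [Group G] [TopologicalSpace G] [IsTopologicalGroup G]
    [CompactSpace G] [T2Space G] {N H : Subgroup G} [hn : N.Normal] (hN : IsClosed (N : Set G))
    (hH : IsClosed (H : Set G)) : IsClosed ((N ⊔ H : Subgroup G) : Set G) := by
  rw [Subgroup.normal_mul]
  exact (hN.isCompact.mul hH.isCompact).isClosed

variable {G : Type u} [Group G] [TopologicalSpace G] [IsTopologicalGroup G] [CompactSpace G]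
  [T2Space G] [SimplyConnectedSpace G] [LocallyPathConnectedSpace G]

theorem simplyConnected_quotient {M : Subgroup G} [hn : M.Normal] (hM : IsClosed (M : Set G))
    (hc : IsPreconnected (M : Set G)) : SimplyConnectedSpace (G ⧸ M) := by
  let C := Subgroup.centralizer (M : Set G)
  have hCc : IsClosed (C : Set G) := by
    have : (C : Set G) = ⋂ m ∈ M, {c | m * c = c * m} := by
      ext c
      simp [C, Subgroup.mem_centralizer_iff]
    rw [this]
    exact isClosed_biInter fun n _ => isClosed_eq (by fun_prop) (by fun_prop)
  have hMC : ∀ m ∈ M, ∀ c ∈ C, m * c = c * m := fun m hm c hc =>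
    Subgroup.mem_centralizer_iff.1 hc m hm
  have hcen : M ⊓ C ≤ Subgroup.center G := by
    rintro z ⟨hz1, hz2⟩
    rw [Subgroup.mem_center_iff]
    intro g
    obtain ⟨c, hc, hgc⟩ := exists_mul_centralizer hn hM hc g
    have h1 : z * c = c * z := hMC z hz1 c hc
    have h2 : (g * c⁻¹) * z = z * (g * c⁻¹) := hMC _ hgc z hz2
    calc g * z = (g * c⁻¹) * (c * z) := by group
      _ = (g * c⁻¹) * z * c := by rw [← h1]; group
      _ = z * g := by rw [h2]; group
  have htd := isTotallyDisconnected_of_central (hM.inter hCc : IsClosed ((M ⊓ C : Subgroup G) : Set G))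
    hcen
  let C₀ := idComp C
  have hC₀ : IsClosed (C₀ : Set G) := isClosed_idComp hCc
  have hC₀C : C₀ ≤ C := idComp_le C
  have : CompactSpace M := isCompact_iff_compactSpace.1 hM.isCompact
  have : CompactSpace C₀ := isCompact_iff_compactSpace.1 hC₀.isCompact
  have : CompactSpace C := isCompact_iff_compactSpace.1 hCc.isCompact
  have : PreconnectedSpace M := isPreconnected_iff_preconnectedSpace.1 hc
  have : PreconnectedSpace C₀ := isPreconnected_iff_preconnectedSpace.1 (isPreconnected_idComp C)
  have : ConnectedSpace (G ⧸ M) :=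
    Function.Surjective.connectedSpace QuotientGroup.mk_surjective QuotientGroup.continuous_mk
  have hsurj : ∀ g : G, ∃ c ∈ C₀, g * c⁻¹ ∈ M := by
    intro g
    obtain ⟨e, he, hq⟩ := surjOn_connectedComponent (E := C) (Q := G ⧸ M)
      (p := (QuotientGroup.mk' M).comp C.subtype)
      (QuotientGroup.continuous_mk.comp continuous_subtype_val) (fun q => by
        induction q using QuotientGroup.induction_on with
        | H g =>
          obtain ⟨c, hc, hgc⟩ := exists_mul_centralizer hn hM hc g
          refine ⟨⟨c, hc⟩, ?_⟩
          change (c : G ⧸ M) = g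
          rw [eq_comm, ← div_eq_one, div_eq_mul_inv]
          exact (QuotientGroup.eq_one_iff (g * c⁻¹)).2 hgc) (g : G ⧸ M)
    refine ⟨e, ⟨e, he, rfl⟩, ?_⟩
    change ((e : G) : G ⧸ M) = g at hq
    rw [← QuotientGroup.eq_one_iff, QuotientGroup.mk_mul, ← hq, QuotientGroup.mk_inv, mul_inv_cancel]
  let p : M × C₀ →* G :=
    { toFun := fun x => x.1 * x.2
      map_one' := by simp
      map_mul' := fun x y => by
        have := hMC y.1 y.1.2 x.2 (hC₀C x.2.2)
        simp only [Prod.fst_mul, Prod.snd_mul, Subgroup.coe_mul]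
        calc (x.1 : G) * y.1 * (x.2 * y.2) = x.1 * (y.1 * x.2) * y.2 := by group
          _ = _ := by rw [this]; group }
  have hp : ∀ x, p x = x.1 * x.2 := fun _ => rfl
  have hker : ∀ x, p x = 1 → (x.1 : G) ∈ C ∧ (x.2 : G) ∈ M := by
    intro x hx
    rw [hp] at hx
    constructor
    · rw [eq_inv_of_mul_eq_one_left hx]; exact inv_mem (hC₀C x.2.2)
    · rw [eq_inv_of_mul_eq_one_right hx]; exact inv_mem x.1.2
  have hSC : SimplyConnectedSpace (Set.univ : Set G) :=
    simplyConnected_of_homeo (Homeomorph.Set.univ G).symm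
  have hLP : LocallyPathConnectedSpace (Set.univ : Set G) := isOpen_univ.locallyPathConnectedSpace
  have hinj : ∀ x, p x = 1 → x = 1 := by
    intro x hx
    refine eq_one_of_mem_ker (E := M × C₀) (p := p)
      (by change Continuous fun x : M × C₀ => (x.1 : G) * x.2; fun_prop)
      (fun g => ?_) (fun z hz => ?_) ?_ (V := Set.univ) trivial (U := Set.univ) isPreconnected_univ
      trivial (fun _ _ => trivial) trivial hx
    · obtain ⟨c, hc, hgc⟩ := hsurj g
      exact ⟨(⟨_, hgc⟩, ⟨c, hc⟩), by rw [hp]; simp⟩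
    · have hz' := hker z hz
      rw [Subgroup.mem_center_iff]
      intro g
      refine Prod.ext (Subtype.ext ?_) (Subtype.ext ?_)
      · exact hMC _ g.1.2 _ hz'.1
      · exact (hMC _ hz'.2 _ (hC₀C g.2.2)).symm
    · intro t ht htc
      have h1 : IsPreconnected ((fun x : M × C₀ => (x.1 : G)) '' t) :=
        htc.image _ (by fun_prop)
      have h2 := htd _ (by
        rintro _ ⟨x, hx, rfl⟩
        exact ⟨x.1.2, (hker x (ht hx)).1⟩) h1
      intro x hx y hy
      have h3 : (x.1 : G) = y.1 := h2 ⟨x, hx, rfl⟩ ⟨y, hy, rfl⟩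
      have h4 : p x = 1 := ht hx
      have h5 : p y = 1 := ht hy
      rw [hp] at h4 h5
      refine Prod.ext (Subtype.ext h3) (Subtype.ext ?_)
      rw [h3] at h4
      exact mul_left_cancel (h4.trans h5.symm)
  let f : C₀ → G ⧸ M := fun c => (c : G)
  have hf : Continuous f := QuotientGroup.continuous_mk.comp continuous_subtype_val
  have hfb : Function.Bijective f := by
    constructor
    · intro a b hab
      have h1 : (a : G)⁻¹ * b ∈ M := QuotientGroup.eq.1 hab
      have h2 := hinj (⟨_, h1⟩, b⁻¹ * a) (by rw [hp]; simp)
      have h3 : b⁻¹ * a = 1 := congrArg Prod.snd h2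
      exact (inv_mul_eq_one.1 h3).symm
    · intro q
      induction q using QuotientGroup.induction_on with
      | H g =>
        obtain ⟨c, hc, hgc⟩ := hsurj g
        refine ⟨⟨c, hc⟩, ?_⟩
        change (c : G ⧸ M) = g
        rw [eq_comm, ← div_eq_one, div_eq_mul_inv]
        exact (QuotientGroup.eq_one_iff (g * c⁻¹)).2 hgc
  let e := Continuous.homeoOfEquivCompactToT2 (f := Equiv.ofBijective f hfb) hf
  exact simplyConnected_of_retract (X := G) ⟨QuotientGroup.mk, QuotientGroup.continuous_mk⟩
    ⟨fun q => (e.symm q : G), continuous_subtype_val.comp e.symm.continuous⟩ e.apply_symm_apply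

/-- The quotient by a closed normal subgroup, as a package. -/
abbrev quotPkg (M : Subgroup G) [hn : M.Normal] [hM : IsClosed (M : Set G)] :
    CompactGroupPkg.{u} := ⟨G ⧸ M⟩

theorem exists_ne_of_quotient {M : Subgroup G} [hn : M.Normal] (hM : IsClosed (M : Set G))
    (ht : M ≠ ⊤) : ∃ a b : G ⧸ M, a * b ≠ b * a := by
  by_contra! hcon
  refine ht (eq_top_of_commutator_mem hn hM fun a b => ?_)
  rw [← QuotientGroup.eq_one_iff]
  simp only [QuotientGroup.mk_mul, QuotientGroup.mk_inv]
  rw [hcon (a : G ⧸ M) b]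
  group

variable {A : Type*} [NormedRing A] [NormedAlgebra ℝ A] [FiniteDimensional ℝ A]

theorem simple_quotient_of_isMinInv {ρ : G →ₜ* A} (hρ : Good ρ) {𝔪 : Submodule ℝ A}
    (hm : IsMinInv ρ 𝔪) {M : Subgroup G} (hMdef : M = idComp (fixer ρ (𝔪 : Set A)))
    [hn : M.Normal] [hM : IsClosed (M : Set G)] : IsSimpleSCSCLieGroup (quotPkg M) := by
  have hHn : (fixer ρ (𝔪 : Set A)).Normal := fixer_normal hm.inv
  have hHc : IsClosed (fixer ρ (𝔪 : Set A) : Set G) := isClosed_fixer ρ _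
  have hMc : IsPreconnected (M : Set G) := by rw [hMdef]; exact isPreconnected_idComp _
  have hMH : M ≤ fixer ρ (𝔪 : Set A) := by rw [hMdef]; exact idComp_le _
  obtain ⟨hloc, hL⟩ := idComp_open hHc hMdef
    (locEuc_quotient (B := 𝔪 →L[ℝ] 𝔪) (adRep ρ hm.inv) (fun _ => adRep_eq_one_iff) 1)
  have hconn : ConnectedSpace (G ⧸ M) :=
    Function.Surjective.connectedSpace QuotientGroup.mk_surjective QuotientGroup.continuous_mk
  refine ⟨isTopManifold_of_locEuc fun q => LocEuc.of_one hL q, hconn,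
    simplyConnected_quotient hM hMc, exists_ne_of_quotient hM ?_, fun N hNn hNc hNt => ?_⟩
  · rintro rfl
    exact hm.fixer_ne_top hρ (top_le_iff.1 hMH)
  · change Subgroup (G ⧸ M) at N
    let N' := N.comap (QuotientGroup.mk' M)
    have hN'c : IsClosed (N' : Set G) := hNc.preimage QuotientGroup.continuous_mk
    have hN'n : N'.Normal := hNn.comap _
    have hN't : N' ≠ ⊤ := by
      intro h
      refine hNt ((Subgroup.eq_top_iff' _).2 fun x => ?_)
      induction x using QuotientGroup.induction_on with
      | H g =>
        have : g ∈ N' := by rw [h]; trivial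
        exact this
    have hMN' : M ≤ N' := fun m hm => by
      change (m : G ⧸ M) ∈ N
      rw [(QuotientGroup.eq_one_iff m).2 hm]
      exact one_mem _
    rcases hm.eq_top_or_eventually hρ (N := N' ⊔ fixer ρ (𝔪 : Set A)) inferInstance
      (isClosed_sup hN'c hHc) le_sup_right with h | h
    · exfalso
      refine hN't ((Subgroup.eq_top_iff' _).2 fun g => ?_)
      have : CompactSpace (fixer ρ (𝔪 : Set A)) := isCompact_iff_compactSpace.1 hHc.isCompact
      have : ConnectedSpace (G ⧸ N') :=
        Function.Surjective.connectedSpace QuotientGroup.mk_surjective QuotientGroup.continuous_mk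
      obtain ⟨e, he, hq⟩ := surjOn_connectedComponent (E := fixer ρ (𝔪 : Set A)) (Q := G ⧸ N')
        (p := (QuotientGroup.mk' N').comp (Subgroup.subtype _))
        (QuotientGroup.continuous_mk.comp continuous_subtype_val) (fun q => by
          induction q using QuotientGroup.induction_on with
          | H g =>
            obtain ⟨n, hn, c, hc, rfl⟩ := Subgroup.mem_sup_of_normal_left.1 (h.ge (Subgroup.mem_top g))
            refine ⟨⟨c, hc⟩, ?_⟩
            change (c : G ⧸ N') = (n * c : G)
            rw [QuotientGroup.mk_mul, (QuotientGroup.eq_one_iff n).2 hn, one_mul]) (g : G ⧸ N')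
      have h1 : (e : G) ∈ N' := hMN' (by rw [hMdef]; exact ⟨e, he, rfl⟩)
      rw [← QuotientGroup.eq_one_iff, ← hq]
      exact (QuotientGroup.eq_one_iff (e : G)).2 h1
    · have h1 : ∀ᶠ g in 𝓝 (1 : G), g ∈ N' → g ∈ M := by
        filter_upwards [h, hloc] with g hg hg' hgN using
          hg' (hg (Subgroup.mem_sup_left hgN))
      obtain ⟨O, hO, hOo, h1O⟩ := mem_nhds_iff.1 h1
      have hOi : IsOpen ((QuotientGroup.mk : G → G ⧸ M) '' O) := QuotientGroup.isOpenMap_coe _ hOo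
      have : CompactSpace N := isCompact_iff_compactSpace.1 hNc.isCompact
      have : DiscreteTopology N := by
        refine discreteTopology_of_isOpen_singleton_one ?_
        have : ({1} : Set N) = Subtype.val ⁻¹' ((QuotientGroup.mk : G → G ⧸ M) '' O) := by
          ext x
          constructor
          · rintro rfl
            exact ⟨1, h1O, rfl⟩
          · rintro ⟨g, hg, hgx⟩
            refine Subtype.ext ?_
            rw [← hgx]
            exact (QuotientGroup.eq_one_iff g).2 (hO hg (by
              change (g : G ⧸ M) ∈ N
              rw [hgx]; exact x.2))
        rw [this]
        exact hOi.preimage continuous_subtype_val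
      exact finite_of_compact_of_discrete

end SimpleQuotient

end CompactGroupAE

namespace CompactGroupAE

open Filter NormedSpace

section Decompose

theorem simplyConnected_pi {T : Type*} {X : T → Type*} [∀ t, TopologicalSpace (X t)]
    (h : ∀ t, SimplyConnectedSpace (X t)) : SimplyConnectedSpace (∀ t, X t) := by
  rw [simply_connected_iff_paths_homotopic']
  refine ⟨inferInstance, fun {x y} p q => ?_⟩
  have h1 : ∀ t, Path.Homotopic (p.map (continuous_apply t)) (q.map (continuous_apply t)) :=
    fun t => (simply_connected_iff_paths_homotopic'.1 (h t)).2 _ _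
  exact ⟨Path.Homotopic.piHomotopy (fun t => p.map (continuous_apply t))
    (fun t => q.map (continuous_apply t)) fun t => (h1 t).some⟩

/-- A closed connected normal subgroup whose quotient is a simple, connected and simply connected
compact Lie group. -/
structure IsSimpleKer {G : Type u} [Group G] [TopologicalSpace G] [IsTopologicalGroup G]
    [CompactSpace G] [T2Space G] (M : Subgroup G) : Prop where
  normal : M.Normal
  closed : IsClosed (M : Set G)
  conn : IsPreconnected (M : Set G)
  simple : IsSimpleSCSCLieGroup (quotPkg M)

variable {G : Type u} [Group G] [TopologicalSpace G] [IsTopologicalGroup G] [CompactSpace G]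
  [T2Space G]

theorem IsSimpleKer.le_or_sup {M N : Subgroup G} (hM : IsSimpleKer M) (hn : N.Normal)
    (hN : IsClosed (N : Set G)) (hc : IsPreconnected (N : Set G)) : N ≤ M ∨ N ⊔ M = ⊤ := by
  have := hM.normal
  have := hM.closed
  have h1 : (N.map (QuotientGroup.mk' M)).Normal := hn.map _ QuotientGroup.mk_surjective
  have h2 : IsClosed (N.map (QuotientGroup.mk' M) : Set (G ⧸ M)) :=
    (hN.isCompact.image QuotientGroup.continuous_mk).isClosed
  by_cases ht : N.map (QuotientGroup.mk' M) = ⊤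
  · right
    rw [Subgroup.eq_top_iff']
    intro g
    have h3 : (g : G ⧸ M) ∈ N.map (QuotientGroup.mk' M) := by rw [ht]; trivial
    obtain ⟨n, hn', hng⟩ := h3
    have h4 : n⁻¹ * g ∈ M := QuotientGroup.eq.1 hng
    have := mul_mem (Subgroup.mem_sup_left (T := M) hn') (Subgroup.mem_sup_right (S := N) h4)
    simpa using this
  · left
    have hfin : Finite (N.map (QuotientGroup.mk' M)) := hM.simple.2.2.2.2 _ h1 h2 ht
    have h3 : IsPreconnected (N.map (QuotientGroup.mk' M) : Set (G ⧸ M)) :=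
      hc.image _ QuotientGroup.continuous_mk.continuousOn
    have : PreconnectedSpace (N.map (QuotientGroup.mk' M)) :=
      isPreconnected_iff_preconnectedSpace.1 h3
    have h4 : Subsingleton (N.map (QuotientGroup.mk' M)) := PreconnectedSpace.trivial_of_discrete
    intro n hn'
    rw [← QuotientGroup.eq_one_iff]
    have h5 : (n : G ⧸ M) ∈ N.map (QuotientGroup.mk' M) := ⟨n, hn', rfl⟩
    exact congrArg Subtype.val (Subsingleton.elim (⟨_, h5⟩ : N.map (QuotientGroup.mk' M)) 1)

theorem IsSimpleKer.sup_eq_top {M N : Subgroup G} (hM : IsSimpleKer M) (hN : IsSimpleKer N)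
    (hne : M ≠ N) : M ⊔ N = ⊤ := by
  rcases hN.le_or_sup hM.normal hM.closed hM.conn with h | h
  · rcases hM.le_or_sup hN.normal hN.closed hN.conn with h' | h'
    · exact absurd (le_antisymm h h') hne
    · rwa [sup_comm]
  · exact h

variable [SimplyConnectedSpace G] [LocallyPathConnectedSpace G]

theorem inf_sup_eq_top {N₁ N₂ M : Subgroup G} (h₁ : N₁.Normal) (h₂ : N₂.Normal) (hn : M.Normal)
    (hc₁ : IsClosed (N₁ : Set G)) (hc₂ : IsClosed (N₂ : Set G)) (hM : IsClosed (M : Set G))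
    (hs₁ : N₁ ⊔ M = ⊤) (hs₂ : N₂ ⊔ M = ⊤) : (N₁ ⊓ N₂) ⊔ M = ⊤ := by
  have hcl : IsClosed ((N₁ ⊓ N₂ : Subgroup G) : Set G) := hc₁.inter hc₂
  refine eq_top_of_commutator_mem inferInstance (isClosed_sup hcl hM) fun a b => ?_
  obtain ⟨n, hn1, m, hm, rfl⟩ := Subgroup.mem_sup_of_normal_left.1 (hs₁.ge (Subgroup.mem_top a))
  obtain ⟨n', hn2, m', hm', rfl⟩ := Subgroup.mem_sup_of_normal_left.1 (hs₂.ge (Subgroup.mem_top b))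
  have hq : ∀ x ∈ M, (x : G ⧸ (N₁ ⊓ N₂ ⊔ M)) = 1 := fun x hx =>
    (QuotientGroup.eq_one_iff x).2 (Subgroup.mem_sup_right hx)
  rw [← QuotientGroup.eq_one_iff]
  have h3 : n * n' * n⁻¹ * n'⁻¹ ∈ N₁ ⊓ N₂ := by
    constructor
    · have := mul_mem hn1 (h₁.conj_mem _ (inv_mem hn1) n')
      simpa [mul_assoc] using this
    · exact N₂.mul_mem (h₂.conj_mem _ hn2 n) (N₂.inv_mem hn2)
  have h4 := (QuotientGroup.eq_one_iff (N := N₁ ⊓ N₂ ⊔ M) _).2 (Subgroup.mem_sup_left h3)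
  simp only [QuotientGroup.mk_mul, QuotientGroup.mk_inv] at h4 ⊢
  rw [hq m hm, hq m' hm', mul_one, mul_one, h4]

theorem finsetInf_sup_eq_top {T : Type*} {M : T → Subgroup G} (hM : ∀ t, IsSimpleKer (M t))
    (hi : Function.Injective M) (F : Finset T) {t : T} (ht : t ∉ F) :
    ((F.inf M).Normal ∧ IsClosed ((F.inf M : Subgroup G) : Set G)) ∧ F.inf M ⊔ M t = ⊤ := by
  classical
  induction F using Finset.induction_on with
  | empty => simp
  | insert s F hs ih =>
    rw [Finset.mem_insert, not_or] at ht
    obtain ⟨⟨h1, h2⟩, h3⟩ := ih ht.2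
    have hsn := (hM s).normal
    rw [Finset.inf_insert]
    exact ⟨⟨inferInstance, (hM s).closed.inter h2⟩,
      inf_sup_eq_top hsn h1 (hM t).normal (hM s).closed h2 (hM t).closed
        ((hM s).sup_eq_top (hM t) fun h => ht.1 (hi h).symm) h3⟩

theorem exists_forall_mem {T : Type*} {M : T → Subgroup G} (hM : ∀ t, IsSimpleKer (M t))
    (hi : Function.Injective M) (x : T → G) : ∃ g, ∀ t, (x t)⁻¹ * g ∈ M t := by
  classical
  have hfin : ∀ F : Finset T, ∃ g, ∀ t ∈ F, (x t)⁻¹ * g ∈ M t := by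
    intro F
    induction F using Finset.induction_on with
    | empty => exact ⟨1, by simp⟩
    | insert t F ht ih =>
      obtain ⟨g, hg⟩ := ih
      obtain ⟨⟨h1, -⟩, h2⟩ := finsetInf_sup_eq_top hM hi F ht
      obtain ⟨n, hn, m, hm, hnm⟩ :=
        Subgroup.mem_sup_of_normal_left.1 (h2.ge (Subgroup.mem_top (g⁻¹ * x t)))
      refine ⟨g * n, fun s hs => ?_⟩
      rcases Finset.mem_insert.1 hs with rfl | hs
      · have : (x s)⁻¹ * (g * n) = m⁻¹ := by
          rw [← mul_assoc, show (x s)⁻¹ * g = (n * m)⁻¹ by rw [hnm]; group]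
          group
        rw [this]
        exact inv_mem hm
      · rw [← mul_assoc]
        exact mul_mem (hg s hs) (Finset.inf_le (f := M) hs hn)
  obtain ⟨g, -, hg⟩ := isCompact_univ.inter_iInter_nonempty (fun t => {g | (x t)⁻¹ * g ∈ M t})
    (fun t => (hM t).closed.preimage (by fun_prop)) (fun F => by
      obtain ⟨g, hg⟩ := hfin F
      exact ⟨g, trivial, by simpa using hg⟩)
  exact ⟨g, fun t => Set.mem_iInter.1 hg t⟩

open scoped Matrix.Norms.Operator in
theorem exists_isSimpleKer {g : G} (hg : g ∉ Subgroup.center G) : ∃ M, IsSimpleKer M ∧ g ∉ M := by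
  rw [Subgroup.mem_center_iff] at hg
  push Not at hg
  obtain ⟨x, hx⟩ := hg
  have h1 : ∃ R : URep G, R.ρ g * R.ρ x ≠ R.ρ x * R.ρ g := by
    by_contra! hcon
    refine hx ?_
    rw [← inv_mul_eq_one]
    refine eq_one_of_forall_urep fun R => ?_
    rw [map_mul, map_mul R.ρ g x, hcon R, ← map_mul, ← map_mul, inv_mul_cancel, map_one]
  obtain ⟨R, hR⟩ := h1
  have h2 := fun h => hR (commute_of_fixer (ρ := R.ρ) (g := g) h x)
  obtain ⟨𝔪, hm, hgm⟩ := R.good.exists_isMinInv_not_mem_fixer h2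
  have hcl := isClosed_idComp (isClosed_fixer R.ρ (𝔪 : Set (Matrix R.ι R.ι ℂ)))
  have hn := idComp_normal (fixer_normal hm.inv)
  exact ⟨_, ⟨hn, hcl, isPreconnected_idComp _, simple_quotient_of_isMinInv R.good hm rfl⟩,
    fun h => hgm (idComp_le _ h)⟩

/-- A simply connected, locally path connected compact group is a product of simple, connected and
simply connected compact Lie groups. -/
theorem exists_iso_pi : ∃ (T : Type u) (L : T → CompactGroupPkg.{u}),
    (∀ t, IsSimpleSCSCLieGroup (L t)) ∧ ∃ e : G ≃* (∀ t, (L t).carrier), IsTopGroupIso e := by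
  let T := {M : Subgroup G // IsSimpleKer M}
  have hT : ∀ t : T, t.1.Normal := fun t => t.2.normal
  have hT' : ∀ t : T, IsClosed (t.1 : Set G) := fun t => t.2.closed
  let L : T → CompactGroupPkg.{u} := fun t => quotPkg t.1
  have hL : ∀ t, IsSimpleSCSCLieGroup (L t) := fun t => t.2.simple
  refine ⟨T, L, hL, ?_⟩
  let p : G →* ∀ t, (L t).carrier := MonoidHom.mk' (fun g t => ((g : G ⧸ t.1) : (L t).carrier))
    (fun a b => rfl)
  have hpc : Continuous p := continuous_pi fun t => QuotientGroup.continuous_mk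
  have hps : Function.Surjective p := by
    intro y
    have h1 : ∀ t : T, ∃ x : G, ((x : G ⧸ t.1) : (L t).carrier) = y t := fun t =>
      QuotientGroup.mk_surjective (s := t.1) (y t)
    choose x hx using h1
    obtain ⟨g, hg⟩ := exists_forall_mem (M := fun t : T => t.1) (fun t => t.2)
      Subtype.val_injective x
    refine ⟨g, funext fun t => ?_⟩
    rw [← hx t]
    exact (QuotientGroup.eq.2 (hg t)).symm
  have hker : p.ker ≤ Subgroup.center G := by
    intro g hg
    by_contra hgc
    obtain ⟨M, hM, hgM⟩ := exists_isSimpleKer hgc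
    have := hM.normal
    exact hgM ((QuotientGroup.eq_one_iff g).1 (congrFun (MonoidHom.mem_ker.1 hg) (⟨M, hM⟩ : T)))
  have hkc : IsClosed (p.ker : Set G) := by
    have : (p.ker : Set G) = p ⁻¹' {1} := by ext; simp [MonoidHom.mem_ker]
    rw [this]; exact isClosed_singleton.preimage hpc
  have hSC0 : SimplyConnectedSpace (∀ t, (L t).carrier) := simplyConnected_pi fun t => (hL t).2.2.1
  have hLP0 : LocallyPathConnectedSpace (∀ t, (L t).carrier) :=
    (IsQuotientMap.of_surjective_continuous hps hpc).locallyPathConnectedSpace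
  have hSC : SimplyConnectedSpace (Set.univ : Set (∀ t, (L t).carrier)) :=
    simplyConnected_of_homeo (Homeomorph.Set.univ _).symm
  have hLP : LocallyPathConnectedSpace (Set.univ : Set (∀ t, (L t).carrier)) :=
    isOpen_univ.locallyPathConnectedSpace
  have hinj : Function.Injective p := (injective_iff_map_eq_one p).2 fun g hg =>
    eq_one_of_mem_ker hpc hps hker (isTotallyDisconnected_of_central hkc hker) (V := Set.univ)
      trivial isPreconnected_univ trivial (fun _ _ => trivial) (Set.mem_univ g) hg
  let e := Continuous.homeoOfEquivCompactToT2 (f := Equiv.ofBijective p ⟨hinj, hps⟩) hpc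
  exact ⟨MulEquiv.ofBijective p ⟨hinj, hps⟩, hpc, e.symm.continuous⟩

end Decompose

end CompactGroupAE

namespace CompactGroupAE

open Filter NormedSpace Module

namespace CptGrp

variable {A : Type*} [NormedRing A] [NormedAlgebra ℝ A] [FiniteDimensional ℝ A] (Γ : CptGrp A)

theorem exists_norm_le : ∃ M > 0, ∀ k ∈ Γ.K, ‖k‖ ≤ M := by
  obtain ⟨M, hM, h⟩ := Γ.compact.isBounded.exists_pos_norm_le
  exact ⟨M, hM, h⟩

theorem exp_conj {k k' : A} (h1 : k * k' = 1) (h2 : k' * k = 1) (X : A) :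
    exp (k * X * k') = k * exp X * k' := by
  have := FiniteDimensional.complete ℝ A
  let : NormedAlgebra ℚ A := .restrictScalars ℚ ℝ A
  exact exp_units_conj (⟨k, k', h1, h2⟩ : Aˣ) X

theorem conj_mem_lie {k k' : A} (hk : k ∈ Γ.K) (hk' : k' ∈ Γ.K) (h1 : k * k' = 1)
    (h2 : k' * k = 1) {X : A} (hX : X ∈ Γ.lie) : k * X * k' ∈ Γ.lie := by
  intro t
  rw [show t • (k * X * k') = k * (t • X) * k' by simp, exp_conj h1 h2]
  exact Γ.K.mul_mem (Γ.K.mul_mem hk (hX t)) hk'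

theorem exp_neg_mem {X : A} (hX : X ∈ Γ.lie) : exp (-X) ∈ Γ.K := Γ.exp_mem (Γ.lie.neg_mem hX)

/-- The centraliser of an element in the Lie algebra. -/
def cen (g : A) : Submodule ℝ A where
  carrier := {X | X ∈ Γ.lie ∧ g * X = X * g}
  add_mem' hX hY := ⟨Γ.lie.add_mem hX.1 hY.1, by rw [mul_add, add_mul, hX.2, hY.2]⟩
  zero_mem' := ⟨Γ.lie.zero_mem, by simp⟩
  smul_mem' c X hX := ⟨Γ.lie.smul_mem c hX.1, by simp [hX.2]⟩

/-- The displacement of conjugation by a group element on the Lie algebra. -/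
noncomputable def disp {g g' : A} (hg : g ∈ Γ.K) (hg' : g' ∈ Γ.K) (h1 : g * g' = 1)
    (h2 : g' * g = 1) :
    Γ.lie →ₗ[ℝ] Γ.lie :=
  (((LinearMap.mulRight ℝ g) ∘ₗ (LinearMap.mulLeft ℝ g')).restrict (p := Γ.lie) (q := Γ.lie)
    (fun X hX => by simpa using Γ.conj_mem_lie hg' hg h2 h1 hX)) - LinearMap.id

section Disp

variable {Γ} {g g' : A} {hg : g ∈ Γ.K} {hg' : g' ∈ Γ.K} {h1 : g * g' = 1} {h2 : g' * g = 1}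

theorem disp_apply (X : Γ.lie) : (Γ.disp hg hg' h1 h2 X : A) = g' * X * g - X := rfl

theorem mem_ker_disp {X : Γ.lie} : X ∈ LinearMap.ker (Γ.disp hg hg' h1 h2) ↔ g * X = X * g := by
  rw [LinearMap.mem_ker, Subtype.ext_iff, disp_apply, ZeroMemClass.coe_zero, sub_eq_zero]
  constructor
  · intro h
    calc g * X = g * (g' * X * g) := by rw [h]
      _ = (g * g') * X * g := by noncomm_ring
      _ = _ := by rw [h1, one_mul]
  · intro h
    rw [mul_assoc, ← h, ← mul_assoc, h2, one_mul]

theorem pow_conj_disp {v w : Γ.lie} (hv : Γ.disp hg hg' h1 h2 v = 0)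
    (hw : Γ.disp hg hg' h1 h2 w = v) (n : ℕ) : g' ^ n * (w : A) * g ^ n = w + n • (v : A) := by
  have hv' : g' * (v : A) * g = v := by
    have := congrArg (Subtype.val) hv
    rw [disp_apply] at this
    exact sub_eq_zero.1 this
  have hw' : g' * (w : A) * g = w + v := by
    have := congrArg (Subtype.val) hw
    rw [disp_apply] at this
    rw [← this]; abel
  induction n with
  | zero => simp
  | succ n ih =>
    rw [pow_succ' g', pow_succ g]
    calc g' * g' ^ n * (w : A) * (g ^ n * g) = g' * (g' ^ n * (w : A) * g ^ n) * g := by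
          noncomm_ring
      _ = g' * (w : A) * g + n • (g' * (v : A) * g) := by rw [ih]; noncomm_ring
      _ = _ := by rw [hv', hw', succ_nsmul]; abel

theorem disjoint_disp : Disjoint (LinearMap.range (Γ.disp hg hg' h1 h2))
    (LinearMap.ker (Γ.disp hg hg' h1 h2)) := by
  rw [Submodule.disjoint_def]
  rintro v ⟨w, hw⟩ hv
  obtain ⟨M, hM, hMb⟩ := Γ.exists_norm_le
  by_contra hne
  have hpos : 0 < ‖(v : A)‖ := norm_pos_iff.2 fun h => hne (Subtype.ext h)
  obtain ⟨n, hn⟩ := exists_nat_gt ((M * ‖(w : A)‖ * M + ‖(w : A)‖) / ‖(v : A)‖)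
  rw [div_lt_iff₀ hpos] at hn
  have h3 := pow_conj_disp (LinearMap.mem_ker.1 hv) hw n
  have h4 : ‖(n : ℝ) • (v : A)‖ = n * ‖(v : A)‖ := by
    rw [norm_smul, Real.norm_natCast]
  have h5 : (n : ℝ) • (v : A) = g' ^ n * (w : A) * g ^ n - w := by
    rw [h3, Nat.cast_smul_eq_nsmul]; abel
  have h6 : ‖g' ^ n * (w : A) * g ^ n - w‖ ≤ M * ‖(w : A)‖ * M + ‖(w : A)‖ := by
    refine (norm_sub_le _ _).trans ?_
    gcongr
    refine (norm_mul_le _ _).trans ?_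
    gcongr
    · refine (norm_mul_le _ _).trans ?_
      gcongr
      exact hMb _ (Γ.K.pow_mem hg' n)
    · exact hMb _ (Γ.K.pow_mem hg n)
  rw [← h5, h4] at h6
  linarith

theorem isCompl_disp : IsCompl (LinearMap.range (Γ.disp hg hg' h1 h2))
    (LinearMap.ker (Γ.disp hg hg' h1 h2)) :=
  (Submodule.isCompl_iff_disjoint _ _ (LinearMap.finrank_range_add_finrank_ker _).ge).2
    disjoint_disp

end Disp

theorem finrank_cen {g g' : A} (hg : g ∈ Γ.K) (hg' : g' ∈ Γ.K) (h1 : g * g' = 1)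
    (h2 : g' * g = 1) :
    finrank ℝ (LinearMap.ker (Γ.disp hg hg' h1 h2)) = finrank ℝ (Γ.cen g) := by
  have : (LinearMap.ker (Γ.disp hg hg' h1 h2)).map Γ.lie.subtype = Γ.cen g := by
    ext X
    constructor
    · rintro ⟨Y, hY, rfl⟩
      exact ⟨Y.2, mem_ker_disp.1 hY⟩
    · rintro ⟨hX, hX'⟩
      exact ⟨⟨X, hX⟩, mem_ker_disp.2 hX', rfl⟩
  rw [← this]
  exact (LinearEquiv.finrank_eq (Submodule.equivMapOfInjective _ Subtype.val_injective _))

section Deriv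

variable {E : Type*} [NormedAddCommGroup E] [NormedSpace ℝ E]

/-- The derivative at the origin of `e ↦ exp (β e) * (g * exp (γ e)) * exp (-β e)`. -/
noncomputable def mulDeriv (g : A) (β γ : E →L[ℝ] A) : E →L[ℝ] A :=
  (ContinuousLinearMap.mul ℝ A).flip g ∘L β - ContinuousLinearMap.mul ℝ A g ∘L β +
    ContinuousLinearMap.mul ℝ A g ∘L γ

theorem mulDeriv_apply (g : A) (β γ : E →L[ℝ] A) (e : E) :
    mulDeriv g β γ e = β e * g - g * β e + g * γ e := rfl

theorem strictDeriv_conj_exp (g : A) (β γ : E →L[ℝ] A) :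
    HasStrictFDerivAt (fun e => exp (β e) * (g * exp (γ e)) * exp (-β e)) (mulDeriv g β γ) 0 := by
  have hexp : ∀ F : E →L[ℝ] A, HasStrictFDerivAt (fun e => exp (F e)) F 0 := fun F => by
    have h3 : HasStrictFDerivAt (exp : A → A) (1 : A →L[ℝ] A) (F 0) := by
      rw [map_zero]; exact strictDeriv_exp_zero
    exact h3.comp (0 : E) F.hasStrictFDerivAt
  have := ((hexp β).mul' ((hexp γ).const_mul g)).mul' (hexp (-β))
  refine this.congr_fderiv ?_
  ext e
  rw [mulDeriv_apply]
  simp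
  noncomm_ring

theorem exists_conj_chart [FiniteDimensional ℝ E] (g : Γ.K) {g' : A} (h1 : (g : A) * g' = 1)
    (β γ : E →L[ℝ] A) (hβl : ∀ e, β e ∈ Γ.lie) (hγl : ∀ e, γ e ∈ Γ.lie) (l : E ≃ₗ[ℝ] Γ.lie)
    (hl : ∀ e, (l e : A) = g' * β e * g - β e + γ e) : ∃ φ : E → Γ.K,
      (∀ e, (φ e : A) = exp (β e) * (g * exp (γ e)) * exp (-β e)) ∧
      ∃ Q : OpenPartialHomeomorph E Γ.K, 0 ∈ Q.source ∧ ∀ e, Q e = φ e := by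
  let φ : E → Γ.K := fun e =>
    ⟨exp (β e) * (g * exp (γ e)) * exp (-β e), Γ.K.mul_mem (Γ.K.mul_mem (Γ.exp_mem (hβl e))
      (Γ.K.mul_mem g.2 (Γ.exp_mem (hγl e)))) (Γ.exp_neg_mem (hβl e))⟩
  refine ⟨φ, fun e => rfl, Γ.exists_chart φ 0 l (mulDeriv (g : A) β γ) (fun e => ?_)
    (strictDeriv_conj_exp (g : A) β γ)⟩
  have h3 : (g : A) * (g' * β e * g - β e + γ e) = β e * g - g * β e + g * γ e := by
    calc _ = (g * g') * β e * g - g * β e + g * γ e := by noncomm_ring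
      _ = _ := by rw [h1, one_mul]
  have h5 : ((φ 0 : Γ.K) : A) = g := by simp [φ]
  rw [hl, h5, h3, mulDeriv_apply]

end Deriv

theorem exists_slice (g : Γ.K) {ε : ℝ} (hε : 0 < ε) : ∃ (𝔭 : Submodule ℝ A) (U : Set Γ.K)
    (b c : Γ.K → A), 𝔭 ≤ Γ.lie ∧ finrank ℝ 𝔭 + finrank ℝ (Γ.cen g) = finrank ℝ Γ.lie ∧
    IsOpen U ∧ g ∈ U ∧ ContinuousOn b U ∧ ContinuousOn c U ∧
    ∀ x ∈ U, b x ∈ 𝔭 ∧ c x ∈ Γ.cen g ∧ ‖c x‖ < ε ∧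
      (x : A) = exp (b x) * (g * exp (c x)) * exp (-b x) := by
  obtain ⟨g', hg', h1, h2⟩ := Γ.exists_inv g g.2
  let D := Γ.disp g.2 hg' h1 h2
  have hD : ∀ X : Γ.lie, (D X : A) = g' * X * g - X := fun X => rfl
  obtain ⟨P, hP⟩ := Submodule.exists_isCompl (LinearMap.ker D)
  have hfr : finrank ℝ P + finrank ℝ (LinearMap.ker D) = finrank ℝ Γ.lie := by
    rw [add_comm]; exact Submodule.finrank_add_eq_of_isCompl hP
  let l₀ : (P × LinearMap.ker D) →ₗ[ℝ] Γ.lie :=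
    LinearMap.coprod (D ∘ₗ P.subtype) (LinearMap.ker D).subtype
  have hl₀ : Function.Injective l₀ := by
    rw [← LinearMap.ker_eq_bot, LinearMap.ker_eq_bot']
    rintro ⟨B, C⟩ hBC
    have hBC' : D B + (C : Γ.lie) = 0 := hBC
    have h3 : D B ∈ LinearMap.ker D := by
      rw [eq_neg_of_add_eq_zero_left hBC']
      exact neg_mem C.2
    have h4 : D B = 0 := Submodule.disjoint_def.1 disjoint_disp _ (LinearMap.mem_range_self D _) h3
    have h5 : (B : Γ.lie) = 0 := Submodule.disjoint_def.1 hP.disjoint _ (LinearMap.mem_ker.2 h4) B.2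
    rw [h4, zero_add] at hBC'
    exact Prod.ext (Subtype.ext h5) (Subtype.ext hBC')
  let l : (P × LinearMap.ker D) ≃ₗ[ℝ] Γ.lie :=
    LinearMap.linearEquivOfInjective l₀ hl₀ (by rw [finrank_prod, hfr])
  have hl : ∀ e, l e = D e.1 + e.2 := fun e => rfl
  let β : (P × LinearMap.ker D) →L[ℝ] A :=
    (Γ.lie.subtypeL.comp P.subtypeL).comp (ContinuousLinearMap.fst ℝ _ _)
  let γ : (P × LinearMap.ker D) →L[ℝ] A :=
    (Γ.lie.subtypeL.comp (LinearMap.ker D).subtypeL).comp (ContinuousLinearMap.snd ℝ _ _)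
  have hβ : ∀ e, β e = ((e.1 : Γ.lie) : A) := fun e => rfl
  have hγ : ∀ e, γ e = ((e.2 : Γ.lie) : A) := fun e => rfl
  have hβl : ∀ e, β e ∈ Γ.lie := fun e => (e.1 : Γ.lie).2
  have hγl : ∀ e, γ e ∈ Γ.lie := fun e => (e.2 : Γ.lie).2
  obtain ⟨φ, hφ, Q, hQ0, hQ⟩ := Γ.exists_conj_chart (E := P × LinearMap.ker D) g h1 β γ hβl hγl l (fun e => by
    simp only [hl, Submodule.coe_add, hD, hβ, hγ])
  have hφ0 : φ 0 = g := by ext; rw [hφ]; simp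
  have hsymm : Q.symm g = 0 := by rw [← hφ0, ← hQ, Q.left_inv hQ0]
  have hgt : g ∈ Q.target := by rw [← hφ0, ← hQ]; exact Q.map_source hQ0
  refine ⟨P.map Γ.lie.subtype, Q.target ∩ Q.symm ⁻¹' {e | ‖γ e‖ < ε}, fun x => β (Q.symm x),
    fun x => γ (Q.symm x), ?_, ?_, ?_, ⟨hgt, ?_⟩, ?_, ?_, ?_⟩
  · rintro _ ⟨Y, -, rfl⟩; exact Y.2
  · rw [← Γ.finrank_cen g.2 hg' h1 h2, ← hfr]
    congr 1
    exact (LinearEquiv.finrank_eq (Submodule.equivMapOfInjective _ Subtype.val_injective _)).symm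
  · exact Q.symm.isOpen_inter_preimage (isOpen_lt (by fun_prop) continuous_const)
  · simp [hsymm, hε]
  · exact β.continuous.comp_continuousOn (Q.continuousOn_symm.mono Set.inter_subset_left)
  · exact γ.continuous.comp_continuousOn (Q.continuousOn_symm.mono Set.inter_subset_left)
  · rintro x ⟨hx, hxε⟩
    refine ⟨⟨_, (Q.symm x).1.2, rfl⟩, ⟨hγl _, mem_ker_disp.1 (Q.symm x).2.2⟩, hxε, ?_⟩
    have := congrArg Subtype.val (hQ (Q.symm x))
    rw [Q.right_inv hx, hφ] at this
    exact this

end CptGrp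

end CompactGroupAE

namespace CompactGroupAE

open Filter NormedSpace Module

namespace CptGrp

variable {A : Type*} [NormedRing A] [NormedAlgebra ℝ A] [FiniteDimensional ℝ A] (Γ : CptGrp A)

theorem hasDerivAt_conj (X Y : A) :
    HasDerivAt (fun t : ℝ => exp (t • X) * Y * exp (-(t • X))) (X * Y - Y * X) 0 := by
  have h1 := hasDerivAt_exp_smul X 0
  have h2 := hasDerivAt_exp_smul (-X) 0
  have h3 := (h1.mul_const Y).mul h2
  simp only [zero_smul, exp_zero, one_mul, mul_one, smul_neg, neg_zero] at h3
  exact h3.congr_deriv (by rw [mul_neg, sub_eq_add_neg])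

theorem exists_norm_le_of_disjoint {E : Type*} [NormedAddCommGroup E] [NormedSpace ℝ E]
    [FiniteDimensional ℝ E] (D : E →ₗ[ℝ] E)
    (h : Disjoint (LinearMap.range D) (LinearMap.ker D)) :
    ∃ κ : ℝ, 0 < κ ∧ ∀ v ∈ LinearMap.range D, ‖v‖ ≤ κ * ‖D v‖ := by
  have hinj : LinearMap.ker (D ∘ₗ (LinearMap.range D).subtype) = ⊥ := by
    rw [LinearMap.ker_eq_bot']
    intro v hv
    exact Subtype.ext (Submodule.disjoint_def.1 h _ v.2 hv)
  obtain ⟨κ, hκ, hanti⟩ := LinearMap.exists_antilipschitzWith _ hinj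
  refine ⟨κ, hκ, fun v hv => ?_⟩
  have := hanti.le_mul_dist ⟨v, hv⟩ 0
  simpa using this

theorem bracket_mem_lie {X Y : A} (hX : X ∈ Γ.lie) (hY : Y ∈ Γ.lie) : X * Y - Y * X ∈ Γ.lie := by
  have hcl : IsClosed (Γ.lie : Set A) := Submodule.closed_of_finiteDimensional _
  have h1 := (hasDerivAt_conj X Y).tendsto_slope
  refine hcl.mem_of_tendsto h1 (Eventually.of_forall fun t => ?_)
  rw [slope_def_module]
  refine Γ.lie.smul_mem _ (Γ.lie.sub_mem ?_ ?_)
  · exact Γ.conj_mem_lie (hX t) (by rw [← smul_neg]; exact Γ.lie.neg_mem hX t)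
      (exp_mul_exp_neg _) (exp_neg_mul_exp _) hY
  · simpa using hY

theorem exists_commute_of_exp_commute : ∃ ε > 0, ∀ C ∈ Γ.lie, ‖C‖ < ε → ∀ Y ∈ Γ.lie,
    exp C * Y = Y * exp C → C * Y = Y * C := by
  obtain ⟨L, -, -, -, hL⟩ := exists_log (A := A)
  obtain ⟨η, hη, hLη⟩ := Metric.eventually_nhds_iff.1 hL
  obtain ⟨M, hM, hMb⟩ := Γ.exists_norm_le
  refine ⟨min η (η / (M * M)), lt_min hη (by positivity), fun C _ hCε Y hY hCY => ?_⟩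
  have key : ∀ s : ℝ, exp (s • Y) * C * exp (-(s • Y)) = C := by
    intro s
    have e1 : exp (s • Y) ∈ Γ.K := hY s
    have e2 : exp (-(s • Y)) ∈ Γ.K := by rw [← smul_neg]; exact Γ.lie.neg_mem hY s
    have hc : Commute (exp C) (exp (s • Y)) :=
      exp_commute (Commute.smul_right (show Commute (exp C) Y from hCY) s)
    have h1 : exp (exp (s • Y) * C * exp (-(s • Y))) = exp C := by
      rw [exp_conj (exp_mul_exp_neg _) (exp_neg_mul_exp _), ← hc.eq, mul_assoc, exp_mul_exp_neg,
        mul_one]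
    have h2 : ‖exp (s • Y) * C * exp (-(s • Y))‖ < η := by
      calc _ ≤ ‖exp (s • Y)‖ * ‖C‖ * ‖exp (-(s • Y))‖ :=
            (norm_mul_le _ _).trans (by gcongr; exact norm_mul_le _ _)
        _ ≤ M * ‖C‖ * M := by gcongr <;> exact hMb _ ‹_›
        _ = ‖C‖ * (M * M) := by ring
        _ < η := by
          rw [← lt_div_iff₀ (by positivity)]
          exact hCε.trans_le (min_le_right _ _)
    rw [← hLη (y := exp (s • Y) * C * exp (-(s • Y))) (by simpa using h2), h1,
      hLη (by simpa using hCε.trans_le (min_le_left _ _))]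
  have h1 := hasDerivAt_conj Y C
  rw [funext key] at h1
  exact (sub_eq_zero.1 (h1.unique (hasDerivAt_const _ _))).symm

theorem exists_cen_mul_exp {g : A} (hg : g ∈ Γ.K) : ∃ ε > 0, ∀ C ∈ Γ.cen g, ‖C‖ < ε → ∀ Y : A,
    Y ∈ Γ.cen (g * exp C) ↔ Y ∈ Γ.cen g ∧ C * Y = Y * C := by
  obtain ⟨g', hg', h1, h2⟩ := Γ.exists_inv g hg
  obtain ⟨ε₁, hε₁, hcomm⟩ := Γ.exists_commute_of_exp_commute
  obtain ⟨M, hM, hMb⟩ := Γ.exists_norm_le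
  let D := Γ.disp hg hg' h1 h2
  obtain ⟨κ, hκ', hanti⟩ := exists_norm_le_of_disjoint D disjoint_disp
  have hexp : Tendsto (fun C : A => ‖exp C - 1‖) (𝓝 0) (𝓝 0) := by
    have : Continuous fun C : A => ‖exp C - 1‖ := (continuous_exp.sub continuous_const).norm
    simpa using this.tendsto 0
  obtain ⟨ε₂, hε₂, hsmall⟩ := Metric.eventually_nhds_iff.1
    (hexp.eventually (gt_mem_nhds (show 0 < 1 / (κ * (2 * M)) by positivity)))
  refine ⟨min ε₁ ε₂, lt_min hε₁ hε₂, fun C hC hCε Y => ?_⟩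
  have hCe : g * exp C = exp C * g := exp_commute hC.2
  constructor
  swap
  · rintro ⟨hY, hCY⟩
    refine ⟨hY.1, ?_⟩
    have : Y * exp C = exp C * Y := exp_commute hCY.symm
    rw [mul_assoc, ← this, ← mul_assoc, hY.2, mul_assoc]
  rintro ⟨hY, hYg⟩
  let E := Γ.disp (Γ.exp_neg_mem hC.1) (Γ.exp_mem hC.1) (exp_neg_mul_exp C) (exp_mul_exp_neg C)
  have hE : ∀ X : Γ.lie, (E X : A) = exp C * X * exp (-C) - X := fun X => rfl
  have hD : ∀ X : Γ.lie, (D X : A) = g' * X * g - X := fun X => rfl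
  have c1 : g' * exp C = exp C * g' := by
    calc g' * exp C = g' * exp C * (g * g') := by rw [h1, mul_one]
      _ = g' * (exp C * g) * g' := by noncomm_ring
      _ = (g' * g) * exp C * g' := by rw [← hCe]; noncomm_ring
      _ = _ := by rw [h2, one_mul]
  have c2 : exp (-C) * g = g * exp (-C) :=
    (exp_commute (X := g) (Y := -C) (Commute.neg_right hC.2)).eq.symm
  have hDE : ∀ X, D (E X) = E (D X) := by
    intro X
    apply Subtype.ext
    rw [hD, hE, hE, hD]
    have : g' * (exp C * X * exp (-C)) * g = exp C * (g' * X * g) * exp (-C) := by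
      calc _ = (g' * exp C) * X * (exp (-C) * g) := by noncomm_ring
        _ = _ := by rw [c1, c2]; noncomm_ring
    rw [mul_sub, sub_mul, this]
    noncomm_ring
  have hYDE : D ⟨Y, hY⟩ = E ⟨Y, hY⟩ := by
    apply Subtype.ext
    rw [hD, hE]
    congr 1
    change g' * Y * g = exp C * Y * exp (-C)
    calc g' * Y * g = g' * (Y * (g * exp C)) * exp (-C) := by
          rw [← mul_assoc Y, ← mul_assoc g', mul_assoc _ (exp C), exp_mul_exp_neg]; noncomm_ring
      _ = (g' * g) * exp C * Y * exp (-C) := by rw [← hYg]; noncomm_ring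
      _ = _ := by rw [h2, one_mul]
  obtain ⟨Yr, ⟨W, hW⟩, Yk, hYk, hsum⟩ := Submodule.mem_sup.1
    (show (⟨Y, hY⟩ : Γ.lie) ∈ LinearMap.range D ⊔ LinearMap.ker D by
      rw [isCompl_disp.sup_eq_top]; trivial)
  rw [LinearMap.mem_ker] at hYk
  have h3 : D Yr - E Yr = 0 := by
    refine Submodule.disjoint_def.1 (disjoint_disp (hg := hg) (hg' := hg') (h1 := h1) (h2 := h2))
      _ ⟨Yr - E W, ?_⟩ ?_
    · change D _ = _
      rw [map_sub, hDE, hW]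
    · have : D Yr - E Yr = E Yk := by
        rw [← hsum, map_add, map_add, hYk, add_zero] at hYDE
        rw [hYDE]; abel
      rw [this]
      change D _ = 0
      rw [hDE, hYk, map_zero]
  have h4 : ‖Yr‖ ≤ κ * ‖D Yr‖ := hanti Yr ⟨W, hW⟩
  have h5 : ‖E Yr‖ ≤ ‖exp C - 1‖ * (2 * M) * ‖Yr‖ := by
    have : (E Yr : A) = ((exp C - 1) * Yr - Yr * (exp C - 1)) * exp (-C) := by
      rw [hE]
      calc _ = exp C * Yr * exp (-C) - Yr * (exp C * exp (-C)) := by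
            rw [exp_mul_exp_neg, mul_one]
        _ = _ := by noncomm_ring
    change ‖(E Yr : A)‖ ≤ ‖exp C - 1‖ * (2 * M) * ‖(Yr : A)‖
    rw [this]
    have hb := hMb _ (Γ.exp_neg_mem hC.1)
    calc _ ≤ ‖(exp C - 1) * (Yr : A) - Yr * (exp C - 1)‖ * ‖exp (-C)‖ := norm_mul_le _ _
      _ ≤ (‖exp C - 1‖ * ‖(Yr : A)‖ + ‖(Yr : A)‖ * ‖exp C - 1‖) * M := by
        gcongr
        exact (norm_sub_le _ _).trans (add_le_add (norm_mul_le _ _) (norm_mul_le _ _))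
      _ = _ := by ring
  have h6 : Yr = 0 := by
    by_contra hne
    have hpos : 0 < ‖Yr‖ := norm_pos_iff.2 hne
    rw [sub_eq_zero.1 h3] at h4
    have h7 : ‖exp C - 1‖ < 1 / (κ * (2 * M)) :=
      hsmall (by simpa using hCε.trans_le (min_le_right _ _))
    rw [lt_div_iff₀ (by positivity)] at h7
    have h8 : ‖Yr‖ ≤ κ * (‖exp C - 1‖ * (2 * M) * ‖Yr‖) := h4.trans (by gcongr)
    have h9 : κ * (‖exp C - 1‖ * (2 * M) * ‖Yr‖) = (‖exp C - 1‖ * (κ * (2 * M))) * ‖Yr‖ := by ring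
    rw [h9] at h8
    nlinarith
  rw [h6, zero_add] at hsum
  have hYg' : Y ∈ Γ.cen g := by
    refine ⟨hY, ?_⟩
    have := mem_ker_disp.1 (LinearMap.mem_ker.2 hYk)
    rwa [hsum] at this
  refine ⟨hYg', hcomm C hC.1 (hCε.trans_le (min_le_left _ _)) Y hY ?_⟩
  have h10 := hYDE
  rw [← hsum, hYk] at h10
  have h11 := congrArg Subtype.val h10
  rw [hE, hsum] at h11
  have h12 : exp C * Y * exp (-C) = Y := (sub_eq_zero.1 h11.symm)
  calc exp C * Y = exp C * Y * exp (-C) * exp C := by rw [mul_assoc _ _ (exp C), exp_neg_mul_exp, mul_one]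
    _ = _ := by rw [h12]

/-- The centre of the centraliser of an element in the Lie algebra. -/
def zen (g : A) : Submodule ℝ A where
  carrier := {X | X ∈ Γ.cen g ∧ ∀ Y ∈ Γ.cen g, X * Y = Y * X}
  add_mem' hX hY := ⟨(Γ.cen g).add_mem hX.1 hY.1, fun Z hZ => by
    rw [mul_add, add_mul, hX.2 Z hZ, hY.2 Z hZ]⟩
  zero_mem' := ⟨(Γ.cen g).zero_mem, by simp⟩
  smul_mem' c X hX := ⟨(Γ.cen g).smul_mem c hX.1, fun Y hY => by simp [hX.2 Y hY]⟩

/-- An element is abelian if its centraliser in the Lie algebra is commutative. -/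
def Abel (g : A) : Prop := ∀ X ∈ Γ.cen g, ∀ Y ∈ Γ.cen g, X * Y = Y * X

theorem mem_cen_conj {g k k' : A} (hk : k ∈ Γ.K) (hk' : k' ∈ Γ.K) (h1 : k * k' = 1)
    (h2 : k' * k = 1) {X : A} (hX : X ∈ Γ.cen g) : k * X * k' ∈ Γ.cen (k * g * k') := by
  refine ⟨Γ.conj_mem_lie hk hk' h1 h2 hX.1, ?_⟩
  calc k * g * k' * (k * X * k') = k * g * (k' * k) * X * k' := by noncomm_ring
    _ = k * (g * X) * k' := by rw [h2]; noncomm_ring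
    _ = k * X * (k' * k) * g * k' := by rw [hX.2, h2]; noncomm_ring
    _ = _ := by noncomm_ring

theorem cen_conj {g k k' : A} (hk : k ∈ Γ.K) (hk' : k' ∈ Γ.K) (h1 : k * k' = 1)
    (h2 : k' * k = 1) : Γ.cen (k * g * k') =
      (Γ.cen g).map (LinearMap.mulRight ℝ k' ∘ₗ LinearMap.mulLeft ℝ k) := by
  ext X
  constructor
  · intro hX
    refine ⟨k' * X * k, ?_, ?_⟩
    · have := Γ.mem_cen_conj hk' hk h2 h1 hX
      have h3 : k' * (k * g * k') * k = g := by
        calc _ = (k' * k) * g * (k' * k) := by noncomm_ring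
          _ = g := by rw [h2, one_mul, mul_one]
      rwa [h3] at this
    · change k * (k' * X * k) * k' = X
      calc _ = (k * k') * X * (k * k') := by noncomm_ring
        _ = X := by rw [h1, one_mul, mul_one]
  · rintro ⟨Y, hY, rfl⟩
    exact Γ.mem_cen_conj hk hk' h1 h2 hY

theorem finrank_cen_conj {g k k' : A} (hk : k ∈ Γ.K) (hk' : k' ∈ Γ.K) (h1 : k * k' = 1)
    (h2 : k' * k = 1) : finrank ℝ (Γ.cen (k * g * k')) = finrank ℝ (Γ.cen g) := by
  rw [Γ.cen_conj hk hk' h1 h2]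
  refine (LinearEquiv.finrank_eq (Submodule.equivMapOfInjective _ ?_ _)).symm
  intro X Y hXY
  have hXY' : k * X * k' = k * Y * k' := hXY
  calc X = (k' * k) * X * (k' * k) := by rw [h2, one_mul, mul_one]
    _ = k' * (k * X * k') * k := by noncomm_ring
    _ = (k' * k) * Y * (k' * k) := by rw [hXY']; noncomm_ring
    _ = Y := by rw [h2, one_mul, mul_one]

/-- Positivity of the trace form on the Lie algebra. -/
def TracePos (τ : A →ₗ[ℝ] ℝ) : Prop :=
  (∀ a b, τ (a * b) = τ (b * a)) ∧ ∀ X ∈ Γ.lie, τ (X * X) = 0 → X = 0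

theorem finrank_zen {τ : A →ₗ[ℝ] ℝ} (hτ : Γ.TracePos τ) {g : A} (hg : ¬Γ.Abel g) :
    finrank ℝ (Γ.zen g) + 3 ≤ finrank ℝ (Γ.cen g) := by
  unfold Abel at hg
  push Not at hg
  obtain ⟨X, hX, Y, hY, hXY⟩ := hg
  set Z := X * Y - Y * X with hZ
  have hZl : Z ∈ Γ.lie := Γ.bracket_mem_lie hX.1 hY.1
  have hZc : Z ∈ Γ.cen g := by
    refine ⟨hZl, ?_⟩
    rw [hZ, mul_sub, sub_mul, ← mul_assoc, hX.2, mul_assoc, hY.2, ← mul_assoc g, hY.2, mul_assoc Y,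
      hX.2]
    noncomm_ring
  have hZ0 : Z ≠ 0 := sub_ne_zero.2 hXY
  have hZZ : τ (Z * Z) ≠ 0 := fun h => hZ0 (hτ.2 Z hZl h)
  have hbr : ∀ U, τ (Z * (Z * U - U * Z)) = 0 := by
    intro U
    rw [mul_sub, map_sub, hτ.1 Z (U * Z), mul_assoc U Z Z, hτ.1 U (Z * Z), mul_assoc, sub_self]
  let F : (ℝ × ℝ × ℝ) × Γ.zen g →ₗ[ℝ] Γ.cen g :=
    { toFun := fun p => ⟨p.1.1 • X + p.1.2.1 • Y + p.1.2.2 • Z + p.2,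
        (Γ.cen g).add_mem ((Γ.cen g).add_mem ((Γ.cen g).add_mem ((Γ.cen g).smul_mem _ hX)
          ((Γ.cen g).smul_mem _ hY)) ((Γ.cen g).smul_mem _ hZc)) p.2.2.1⟩
      map_add' := fun p q => Subtype.ext (by simp [add_smul]; abel)
      map_smul' := fun c p => Subtype.ext (by simp [mul_smul]) }
  have hF : Function.Injective F := by
    rw [← LinearMap.ker_eq_bot, LinearMap.ker_eq_bot']
    rintro ⟨⟨a, b, c⟩, z⟩ h
    have h0 : a • X + b • Y + c • Z + (z : A) = 0 := congrArg Subtype.val h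
    have hb : b = 0 := by
      have h1 : X * (a • X + b • Y + c • Z + (z : A)) - (a • X + b • Y + c • Z + (z : A)) * X =
          b • (X * Y - Y * X) - c • (Z * X - X * Z) := by
        simp only [mul_add, add_mul, mul_smul_comm, smul_mul_assoc, z.2.2 X hX, smul_sub]
        abel
      rw [h0, mul_zero, zero_mul, sub_zero, ← hZ] at h1
      have h2 := congrArg (fun W => τ (Z * W)) h1
      simp only [mul_zero, map_zero, mul_sub Z (b • Z), mul_smul_comm, map_sub, map_smul, hbr,
        sub_zero, smul_eq_mul] at h2
      exact (mul_eq_zero.1 h2.symm).resolve_right hZZ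
    have ha : a = 0 := by
      have h1 : (a • X + b • Y + c • Z + (z : A)) * Y - Y * (a • X + b • Y + c • Z + (z : A)) =
          a • (X * Y - Y * X) + c • (Z * Y - Y * Z) := by
        simp only [mul_add, add_mul, mul_smul_comm, smul_mul_assoc, z.2.2 Y hY, smul_sub]
        abel
      rw [h0, mul_zero, zero_mul, sub_zero, ← hZ] at h1
      have h2 := congrArg (fun W => τ (Z * W)) h1
      simp only [mul_zero, map_zero, mul_add Z (a • Z), mul_smul_comm, map_add, map_smul, hbr,
        add_zero, smul_eq_mul] at h2
      exact (mul_eq_zero.1 h2.symm).resolve_right hZZ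
    have hc : c = 0 := by
      by_contra hc
      rw [ha, hb, zero_smul, zero_smul, zero_add, zero_add] at h0
      have hcZ : c • Z = -(z : A) := eq_neg_of_add_eq_zero_left h0
      have hZX : Z * X = X * Z := by
        have : c • (Z * X) = c • (X * Z) := by
          rw [← smul_mul_assoc, ← mul_smul_comm, hcZ, neg_mul, mul_neg, z.2.2 X hX]
        exact smul_right_injective A hc this
      apply hZZ
      nth_rewrite 2 [hZ]
      rw [mul_sub, map_sub, ← mul_assoc, hZX, ← mul_assoc, hτ.1 (Z * Y) X, mul_assoc, sub_self]
    rw [ha, hb, hc, zero_smul, zero_smul, zero_smul, zero_add, zero_add, zero_add] at h0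
    rw [ha, hb, hc, show z = 0 from Subtype.ext h0]
    rfl
  have := LinearMap.finrank_le_finrank_of_injective hF
  simp only [finrank_prod, finrank_self] at this
  omega

end CptGrp

end CompactGroupAE

namespace CompactGroupAE

open Filter NormedSpace Module

namespace CptGrp

variable {A : Type*} [NormedRing A] [NormedAlgebra ℝ A] [FiniteDimensional ℝ A] (Γ : CptGrp A)

theorem exists_fine_slice (g : Γ.K) : ∃ (𝔭 : Submodule ℝ A) (U : Set Γ.K)
    (b c : Γ.K → A), 𝔭 ≤ Γ.lie ∧ finrank ℝ 𝔭 + finrank ℝ (Γ.cen g) = finrank ℝ Γ.lie ∧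
    IsOpen U ∧ g ∈ U ∧ ContinuousOn b U ∧ ContinuousOn c U ∧
    ∀ x ∈ U, b x ∈ 𝔭 ∧ c x ∈ Γ.cen g ∧
      (x : A) = exp (b x) * (g * exp (c x)) * exp (-b x) ∧
      ∀ Y : A, Y ∈ Γ.cen (g * exp (c x)) ↔ Y ∈ Γ.cen g ∧ c x * Y = Y * c x := by
  obtain ⟨ε, hε, h⟩ := Γ.exists_cen_mul_exp g.2
  obtain ⟨𝔭, U, b, c, h1, h2, h3, h4, h5, h6, h7⟩ := Γ.exists_slice g hε
  refine ⟨𝔭, U, b, c, h1, h2, h3, h4, h5, h6, fun x hx => ?_⟩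
  obtain ⟨hb, hc, hcε, hx⟩ := h7 x hx
  exact ⟨hb, hc, hx, h _ hc hcε⟩

theorem eventually_mem_zen (g : Γ.K) : ∃ 𝔭 : Submodule ℝ A,
    finrank ℝ 𝔭 + finrank ℝ (Γ.cen g) = finrank ℝ Γ.lie ∧
    ∀ᶠ x : Γ.K in 𝓝 g, finrank ℝ (Γ.cen (x : A)) = finrank ℝ (Γ.cen (g : A)) →
      ∃ b ∈ 𝔭, ∃ c ∈ Γ.zen g, (x : A) = exp b * (g * exp c) * exp (-b) := by
  obtain ⟨𝔭, U, b, c, h1, h2, h3, h4, h5, h6, h7⟩ := Γ.exists_fine_slice g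
  refine ⟨𝔭, h2, ?_⟩
  filter_upwards [h3.mem_nhds h4] with x hx hfr
  obtain ⟨hb, hc, hx, hcen⟩ := h7 x hx
  refine ⟨_, hb, _, ⟨hc, fun Y hY => ?_⟩, hx⟩
  rw [hx, Γ.finrank_cen_conj (Γ.exp_mem (h1 hb)) (Γ.exp_neg_mem (h1 hb)) (exp_mul_exp_neg _)
    (exp_neg_mul_exp _)] at hfr
  have := Submodule.eq_of_le_of_finrank_eq (fun Y hY => ((hcen Y).1 hY).1) hfr
  rw [← this] at hY
  exact ((hcen Y).1 hY).2

theorem exists_countable_cover {g₀ : Γ.K → Submodule ℝ A}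
    (hg₀ : ∀ g : Γ.K, ∀ᶠ x : Γ.K in 𝓝 g, finrank ℝ (Γ.cen (x : A)) = finrank ℝ (Γ.cen (g : A)) →
      ∃ b ∈ g₀ g, ∃ c ∈ Γ.zen g, (x : A) = exp b * (g * exp c) * exp (-b)) :
    ∃ t : Set Γ.K, t.Countable ∧ (∀ g ∈ t, ¬Γ.Abel g) ∧ ∀ x : Γ.K, ¬Γ.Abel x → ∃ g ∈ t,
      ∃ b ∈ g₀ g, ∃ c ∈ Γ.zen g, (x : A) = exp b * (g * exp c) * exp (-b) := by
  have := FiniteDimensional.proper ℝ A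
  have key : ∀ j : ℕ, ∃ t ⊆ {x : Γ.K | ¬Γ.Abel x ∧ finrank ℝ (Γ.cen (x : A)) = j}, t.Countable ∧
      {x : Γ.K | ¬Γ.Abel x ∧ finrank ℝ (Γ.cen (x : A)) = j} ⊆ ⋃ g ∈ t,
        {x : Γ.K | ∃ b ∈ g₀ g, ∃ c ∈ Γ.zen g, (x : A) = exp b * (g * exp c) * exp (-b)} := by
    intro j
    refine TopologicalSpace.countable_cover_nhdsWithin fun g hg => ?_
    filter_upwards [mem_nhdsWithin_of_mem_nhds (hg₀ g), self_mem_nhdsWithin] with x hx hxj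
    exact hx (hxj.2.trans hg.2.symm)
  choose t ht htc hcov using key
  refine ⟨⋃ j, t j, Set.countable_iUnion htc, ?_, ?_⟩
  · intro g hg
    obtain ⟨j, hj⟩ := Set.mem_iUnion.1 hg
    exact (ht j hj).1
  · intro x hx
    obtain ⟨g, hg, h⟩ := Set.mem_iUnion₂.1 (hcov _ ⟨hx, rfl⟩)
    exact ⟨g, Set.mem_iUnion.2 ⟨_, hg⟩, h⟩

theorem dense_generic {τ : A →ₗ[ℝ] ℝ} (hτ : Γ.TracePos τ) {P : Submodule ℝ A}
    (hP : IsCompl Γ.lie P) {E κ : Type*} [NormedAddCommGroup E] [NormedSpace ℝ E]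
    [FiniteDimensional ℝ E] (hE : finrank ℝ E = 2) [Countable κ] (Q : κ → E → A)
    (hQ : ∀ i, ContDiff ℝ 1 (Q i)) :
    Dense {x : A | ∀ σ : Γ.K, ¬Γ.Abel σ → ∀ V ∈ P, ∀ i s, x ≠ σ * (1 + V) - Q i s} := by
  choose 𝔭 h𝔭 hev using Γ.eventually_mem_zen
  obtain ⟨t, htc, ht, hcov⟩ := Γ.exists_countable_cover hev
  let F : ∀ g : Γ.K, κ → (𝔭 g × Γ.zen g × P × E) → A := fun g i p =>
    exp (p.1 : A) * (g * exp (p.2.1 : A)) * exp (-(p.1 : A)) * (1 + (p.2.2.1 : A)) - Q i p.2.2.2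
  have hF : ∀ g i, ContDiff ℝ 1 (F g i) := by
    intro g i
    have c1 : ContDiff ℝ 1 fun p : 𝔭 g × Γ.zen g × P × E => (p.1 : A) :=
      (𝔭 g).subtypeL.contDiff.comp contDiff_fst
    have c2 : ContDiff ℝ 1 fun p : 𝔭 g × Γ.zen g × P × E => (p.2.1 : A) :=
      (Γ.zen g).subtypeL.contDiff.comp (contDiff_fst.comp contDiff_snd)
    have c3 : ContDiff ℝ 1 fun p : 𝔭 g × Γ.zen g × P × E => (p.2.2.1 : A) :=
      P.subtypeL.contDiff.comp (contDiff_fst.comp (contDiff_snd.comp contDiff_snd))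
    have c4 : ContDiff ℝ 1 fun p : 𝔭 g × Γ.zen g × P × E => Q i p.2.2.2 :=
      (hQ i).comp (contDiff_snd.comp (contDiff_snd.comp contDiff_snd))
    exact ((((contDiff_exp.comp c1).mul (contDiff_const.mul (contDiff_exp.comp c2))).mul
      (contDiff_exp.comp c1.neg)).mul (contDiff_const.add c3)).sub c4
  rcases t.eq_empty_or_nonempty with he | ⟨g₁, hg₁⟩
  · convert dense_univ (X := A)
    rw [Set.eq_univ_iff_forall]
    intro x σ hσ
    obtain ⟨g, hg, -⟩ := hcov σ hσ
    simp [he] at hg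
  have hdim : ∀ g ∈ t, finrank ℝ (𝔭 g × Γ.zen g × P × E) + 1 ≤ finrank ℝ A := by
    intro g hg
    have h1 := Γ.finrank_zen hτ (ht g hg)
    have h2 := h𝔭 g
    have h3 := Submodule.finrank_add_eq_of_isCompl hP
    simp only [finrank_prod]
    omega
  have hsub : (⋃ g ∈ t, ⋃ i, Set.range (F g i))ᶜ ⊆
      {x : A | ∀ σ : Γ.K, ¬Γ.Abel σ → ∀ V ∈ P, ∀ i s, x ≠ σ * (1 + V) - Q i s} := by
    intro x hx σ hσ V hV i s hxe
    apply hx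
    obtain ⟨g, hg, b, hb, c, hc, h⟩ := hcov σ hσ
    refine Set.mem_iUnion₂.2 ⟨g, hg, Set.mem_iUnion.2 ⟨i, (⟨b, hb⟩, ⟨c, hc⟩, ⟨V, hV⟩, s), ?_⟩⟩
    rw [hxe, h]
  refine Dense.mono hsub (dense_compl_of_dimH_lt_finrank ?_)
  have hpos := hdim g₁ hg₁
  have hle : dimH (⋃ g ∈ t, ⋃ i, Set.range (F g i)) ≤ (finrank ℝ A - 1 : ℕ) := by
    rw [dimH_bUnion htc]
    refine iSup₂_le fun g hg => ?_
    rw [dimH_iUnion]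
    refine iSup_le fun i => ((hF g i).dimH_range_le).trans ?_
    have := hdim g hg
    exact_mod_cast (by omega : finrank ℝ (𝔭 g × Γ.zen g × P × E) ≤ finrank ℝ A - 1)
  refine hle.trans_lt ?_
  exact_mod_cast (by omega : finrank ℝ A - 1 < finrank ℝ A)

end CptGrp

end CompactGroupAE

namespace CompactGroupAE

open Filter NormedSpace Module

namespace CptGrp

variable {A : Type*} [NormedRing A] [NormedAlgebra ℝ A] [FiniteDimensional ℝ A] (Γ : CptGrp A)

/-- The exponential map from the Lie algebra to the group. -/
noncomputable def expMap (X : Γ.lie) : Γ.K := ⟨exp (X : A), Γ.exp_mem X.2⟩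

theorem continuous_expMap : Continuous Γ.expMap :=
  (continuous_exp.comp continuous_subtype_val).subtype_mk _

theorem mem_cen_exp {X : A} (hX : X ∈ Γ.lie) : X ∈ Γ.cen (exp X) :=
  ⟨hX, (exp_commute (Commute.refl X)).eq.symm⟩

theorem discrete_fiber {g : Γ.K} (hg : Γ.Abel g) : DiscreteTopology (Γ.expMap ⁻¹' {g}) := by
  obtain ⟨L, -, -, -, hL⟩ := exists_log (A := A)
  obtain ⟨η, hη, hLη⟩ := Metric.eventually_nhds_iff.1 hL
  have hc : ∀ X : Γ.lie, Γ.expMap X = g → (X : A) ∈ Γ.cen g := by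
    rintro X rfl
    exact Γ.mem_cen_exp X.2
  refine DiscreteTopology.of_forall_le_dist hη ?_
  rintro ⟨X, hX⟩ ⟨Y, hY⟩ hne
  by_contra! hlt
  apply hne
  have hXg : exp (X : A) = g := congrArg Subtype.val hX
  have hYg : exp (Y : A) = g := congrArg Subtype.val hY
  have hXY : Commute (X : A) (-Y) := Commute.neg_right (hg X (hc X hX) Y (hc Y hY))
  have h1 : exp ((X : A) - Y) = 1 := by
    rw [sub_eq_add_neg, exp_add_comm hXY, hXg, ← hYg, exp_mul_exp_neg]
  have h2 : dist ((X : A) - Y) 0 < η := by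
    rw [dist_zero_right, ← dist_eq_norm]
    exact hlt
  have h3 := hLη h2
  have h4 := hLη (y := 0) (by simpa using hη)
  rw [h1] at h3
  rw [exp_zero, h3] at h4
  exact Subtype.ext (Subtype.ext (sub_eq_zero.1 h4))

theorem isCoveringMapOn_expMap : IsCoveringMapOn Γ.expMap {g : Γ.K | Γ.Abel g} := by
  intro g hg
  obtain ⟨𝔭, U, b, c, h1, -, hUo, hgU, hb, hc, h7⟩ := Γ.exists_fine_slice g
  refine ⟨Γ.discrete_fiber hg, U, hgU, hUo, hUo.preimage Γ.continuous_expMap, ?_⟩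
  have hbl : ∀ x ∈ U, b x ∈ Γ.lie := fun x hx => h1 (h7 x hx).1
  have hback : ∀ X : Γ.lie, Γ.expMap X ∈ U →
      exp (-b (Γ.expMap X)) * X * exp (b (Γ.expMap X)) ∈ Γ.cen g ∧
      c (Γ.expMap X) * (exp (-b (Γ.expMap X)) * X * exp (b (Γ.expMap X))) =
        (exp (-b (Γ.expMap X)) * X * exp (b (Γ.expMap X))) * c (Γ.expMap X) := by
    intro X hX
    obtain ⟨-, -, hx, hcen⟩ := h7 _ hX
    refine (hcen _).1 ?_
    have h3 := Γ.mem_cen_conj (Γ.exp_neg_mem (hbl _ hX)) (Γ.exp_mem (hbl _ hX))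
      (exp_neg_mul_exp _) (exp_mul_exp_neg _) (Γ.mem_cen_exp X.2)
    convert h3 using 2
    have h4 : exp (X : A) = Γ.expMap X := rfl
    rw [h4, hx]
    calc (g : A) * exp (c (Γ.expMap X)) = 1 * (g * exp (c (Γ.expMap X))) * 1 := by
          rw [one_mul, mul_one]
      _ = _ := by
        rw [← exp_neg_mul_exp (b (Γ.expMap X))]
        noncomm_ring
  have hfw : ∀ x ∈ U, ∀ Y : Γ.lie, Γ.expMap Y = g →
      exp (exp (b x) * (Y + c x) * exp (-b x)) = x := by
    rintro x hx Y hY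
    obtain ⟨-, hcx, hxe, -⟩ := h7 _ hx
    have hYc : (Y : A) ∈ Γ.cen g := by rw [← hY]; exact Γ.mem_cen_exp Y.2
    rw [exp_conj (exp_mul_exp_neg _) (exp_neg_mul_exp _), exp_add_comm (hg _ hYc _ hcx), hxe]
    rw [show exp (Y : A) = g from congrArg Subtype.val hY]
  have hmem : ∀ (X : Γ.lie) (x : Γ.K), x ∈ U → exp (X : A) = x → Γ.expMap X ∈ U := by
    intro X x hx h
    rwa [show Γ.expMap X = x from Subtype.ext h]
  let fw : Γ.expMap ⁻¹' U → U × (Γ.expMap ⁻¹' {g}) := fun X => (⟨Γ.expMap X, X.2⟩,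
    ⟨⟨exp (-b (Γ.expMap X)) * X * exp (b (Γ.expMap X)) - c (Γ.expMap X),
      Γ.lie.sub_mem (hback X X.2).1.1 (h7 _ X.2).2.1.1⟩, by
      apply Subtype.ext
      change exp (_ - _) = (g : A)
      have hcm : Commute (exp (-b (Γ.expMap X)) * X * exp (b (Γ.expMap X)))
        (-c (Γ.expMap X)) := Commute.neg_right (hback X X.2).2.symm
      rw [sub_eq_add_neg, exp_add_comm hcm, exp_conj (exp_neg_mul_exp _) (exp_mul_exp_neg _)]
      have h4 : exp (X : A) = Γ.expMap X := rfl
      rw [h4, (h7 _ X.2).2.2.1]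
      calc _ = (exp (-b (Γ.expMap X)) * exp (b (Γ.expMap X))) * g * (exp (c (Γ.expMap X)) *
            ((exp (-b (Γ.expMap X)) * exp (b (Γ.expMap X))) * exp (-c (Γ.expMap X)))) := by
            noncomm_ring
        _ = g := by rw [exp_neg_mul_exp, one_mul, one_mul, exp_mul_exp_neg, mul_one]⟩)
  let bw : U × (Γ.expMap ⁻¹' {g}) → Γ.expMap ⁻¹' U := fun p =>
    ⟨⟨exp (b p.1) * (p.2 + c p.1) * exp (-b p.1),
      Γ.conj_mem_lie (Γ.exp_mem (hbl _ p.1.2)) (Γ.exp_neg_mem (hbl _ p.1.2)) (exp_mul_exp_neg _)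
        (exp_neg_mul_exp _) (Γ.lie.add_mem p.2.1.2 (h7 _ p.1.2).2.1.1)⟩, hmem _ p.1 p.1.2 (hfw _ p.1.2 p.2 p.2.2)⟩
  have hbw : ∀ p, Γ.expMap (bw p) = p.1 := fun p => Subtype.ext (hfw _ p.1.2 p.2 p.2.2)
  have hbU : Continuous fun x : U => b x := hb.domRestrict
  have hcU : Continuous fun x : U => c x := hc.domRestrict
  have hexp := continuous_exp (A := A)
  have hval : Continuous fun X : Γ.expMap ⁻¹' U => (⟨Γ.expMap X, X.2⟩ : U) :=
    (Γ.continuous_expMap.comp continuous_subtype_val).subtype_mk _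
  have hbX : Continuous fun X : Γ.expMap ⁻¹' U => b (Γ.expMap X) := hbU.comp hval
  have hcX : Continuous fun X : Γ.expMap ⁻¹' U => c (Γ.expMap X) := hcU.comp hval
  have hbp : Continuous fun p : U × (Γ.expMap ⁻¹' {g}) => b p.1 := hbU.comp continuous_fst
  have hcp : Continuous fun p : U × (Γ.expMap ⁻¹' {g}) => c p.1 := hcU.comp continuous_fst
  refine ⟨{ toFun := fw, invFun := bw, left_inv := ?_, right_inv := ?_,
            continuous_toFun := ?_, continuous_invFun := ?_ }, fun X => rfl⟩
  · intro X
    apply Subtype.ext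
    apply Subtype.ext
    change exp (b (Γ.expMap X)) * (exp (-b (Γ.expMap X)) * (X : A) * exp (b (Γ.expMap X)) -
      c (Γ.expMap X) + c (Γ.expMap X)) * exp (-b (Γ.expMap X)) = X
    rw [sub_add_cancel]
    calc _ = (exp (b (Γ.expMap X)) * exp (-b (Γ.expMap X))) * X *
        (exp (b (Γ.expMap X)) * exp (-b (Γ.expMap X))) := by noncomm_ring
      _ = X := by rw [exp_mul_exp_neg, one_mul, mul_one]
  · intro p
    have h3 := hbw p
    refine Prod.ext (Subtype.ext h3) (Subtype.ext (Subtype.ext ?_))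
    change exp (-b (Γ.expMap (bw p))) * (exp (b p.1) * (p.2 + c p.1) * exp (-b p.1)) *
      exp (b (Γ.expMap (bw p))) - c (Γ.expMap (bw p)) = (p.2 : A)
    rw [h3]
    calc _ = (exp (-b p.1) * exp (b p.1)) * (p.2 + c p.1) * (exp (-b p.1) * exp (b p.1)) -
        c p.1 := by noncomm_ring
      _ = _ := by rw [exp_neg_mul_exp, one_mul, mul_one, add_sub_cancel_right]
  · refine hval.prodMk (Continuous.subtype_mk (Continuous.subtype_mk ?_ _) _)
    exact (((hexp.comp hbX.neg).mul (continuous_subtype_val.comp continuous_subtype_val)).mul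
      (hexp.comp hbX)).sub hcX
  · refine Continuous.subtype_mk (Continuous.subtype_mk ?_ _) _
    exact ((hexp.comp hbp).mul (((continuous_subtype_val.comp continuous_subtype_val).comp
      continuous_snd).add hcp)).mul (hexp.comp hbp.neg)

end CptGrp

end CompactGroupAE

namespace CompactGroupAE

open Filter NormedSpace Module

theorem exists_continuousMap_eqOn {X E : Type*} [TopologicalSpace X] [NormalSpace X]
    [NormedAddCommGroup E] [NormedSpace ℝ E] [FiniteDimensional ℝ E] {B : Set X} (hB : IsClosed B)
    {f : X → E} (hf : ContinuousOn f B) : ∃ g : C(X, E), ∀ x ∈ B, g x = f x := by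
  obtain ⟨g, hg⟩ := ContinuousMap.exists_restrict_eq hB ⟨B.domRestrict f, hf.domRestrict⟩
  exact ⟨g, fun x hx => congrArg (fun h : C(B, E) => h ⟨x, hx⟩) hg⟩

namespace CptGrp

variable {A : Type*} [NormedRing A] [NormedAlgebra ℝ A] [FiniteDimensional ℝ A] (Γ : CptGrp A)

instance : CompactSpace Γ.K := isCompact_iff_compactSpace.1 Γ.compact

theorem exists_continuous_inv :
    ∃ j : Γ.K → Γ.K, Continuous j ∧ ∀ k, k * j k = 1 ∧ j k * k = 1 := by
  have : CompleteSpace A := FiniteDimensional.complete ℝ A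
  have h : ∀ k : Γ.K, ∃ k' : Γ.K, k * k' = 1 ∧ k' * k = 1 := by
    intro k
    obtain ⟨k', hk', h1, h2⟩ := Γ.exists_inv k k.2
    exact ⟨⟨k', hk'⟩, Subtype.ext h1, Subtype.ext h2⟩
  choose j h1 h2 using h
  refine ⟨j, ?_, fun k => ⟨h1 k, h2 k⟩⟩
  rw [Topology.IsInducing.subtypeVal.continuous_iff, continuous_iff_continuousAt]
  intro k
  have hr : ∀ k : Γ.K, (j k : A) = Ring.inverse (k : A) := fun k =>
    (Ring.inverse_unit
      (⟨k, j k, congrArg Subtype.val (h1 k), congrArg Subtype.val (h2 k)⟩ : Aˣ)).symm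
  refine ContinuousAt.congr ?_ (Eventually.of_forall fun k => (hr k).symm)
  exact ContinuousAt.comp (f := fun k : Γ.K => (k : A)) (g := Ring.inverse)
    (NormedRing.inverse_continuousAt
      (⟨k, j k, congrArg Subtype.val (h1 k), congrArg Subtype.val (h2 k)⟩ : Aˣ))
    continuous_subtype_val.continuousAt

/-- The logarithm of the quotient of two nearby points. -/
theorem exists_log_div : ∃ η > 0, ∃ G : Γ.K × Γ.K → Γ.lie,
    ContinuousOn G {p | dist p.1 p.2 < η} ∧
    ∀ p : Γ.K × Γ.K, dist p.1 p.2 < η → p.2 = p.1 * Γ.expMap (G p) := by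
  obtain ⟨j, hj, hj1⟩ := Γ.exists_continuous_inv
  obtain ⟨Q, h0, hQ⟩ := Γ.exists_exp_chart 1
  have hQe : ∀ X, Q X = Γ.expMap X := fun X => by rw [hQ X]; exact one_mul _
  have h1 : (1 : Γ.K) ∈ Q.target := by
    have := Q.map_source h0
    rw [hQe] at this
    convert this
    exact Subtype.ext (by simp [expMap])
  obtain ⟨ε, hε, hεQ⟩ := Metric.isOpen_iff.1 Q.open_target 1 h1
  have hcont : Continuous fun p : Γ.K × Γ.K => j p.1 * p.2 := by fun_prop
  obtain ⟨η, hη, hu⟩ := Metric.uniformContinuous_iff.1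
    (CompactSpace.uniformContinuous_of_continuous hcont) ε hε
  have hmem : ∀ p : Γ.K × Γ.K, dist p.1 p.2 < η → j p.1 * p.2 ∈ Q.target := by
    rintro ⟨k, l⟩ hkl
    apply hεQ
    have := hu (a := (k, l)) (b := (k, k)) (by simpa [Prod.dist_eq, dist_comm, hη] using hkl)
    simpa [(hj1 k).2] using this
  refine ⟨η, hη, fun p => Q.symm (j p.1 * p.2), ?_, fun p hp => ?_⟩
  · exact Q.continuousOn_symm.comp hcont.continuousOn hmem
  · rw [← hQe, Q.right_inv (hmem p hp), ← mul_assoc, (hj1 _).1, one_mul]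

/-- The tubular retraction, uniformly close to the identity near the group. -/
theorem exists_retraction {P : Submodule ℝ A} (hP : IsCompl Γ.lie P) {η : ℝ} (hη : 0 < η) :
    ∃ δ > 0, ∃ r : A → Γ.K, ContinuousOn r (Metric.thickening δ (Γ.K : Set A)) ∧
      (∀ y ∈ Metric.thickening δ (Γ.K : Set A), ∃ V ∈ P, y = r y * (1 + V)) ∧
      ∀ (k : Γ.K) (y : A), dist (k : A) y < δ → dist k (r y) < η := by
  classical
  obtain ⟨δ, hδ, r, hr, hrV, hrK⟩ := Γ.exists_tube hP
  have hca : ∀ k ∈ (Γ.K : Set A), ContinuousAt r k := fun k hk =>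
    hr.continuousAt (Metric.isOpen_thickening.mem_nhds (Metric.self_subset_thickening hδ _ hk))
  obtain ⟨δ', hδ', hu⟩ := Metric.mem_uniformity_dist.1
    (Γ.compact.uniformContinuousAt_of_continuousAt r hca (Metric.dist_mem_uniformity hη))
  let r' : A → Γ.K := fun y => if h : r y ∈ Γ.K then ⟨r y, h⟩ else 1
  have hr' : ∀ y ∈ Metric.thickening δ (Γ.K : Set A), (r' y : A) = r y := fun y hy => by
    simp only [r']
    rw [dif_pos (hrV y hy).1]
  have hmin : Metric.thickening (min δ δ') (Γ.K : Set A) ⊆ Metric.thickening δ (Γ.K : Set A) :=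
    Metric.thickening_mono (min_le_left _ _) _
  refine ⟨min δ δ', lt_min hδ hδ', r', ?_, fun y hy => ?_, fun k y hky => ?_⟩
  · rw [Topology.IsInducing.subtypeVal.continuousOn_iff]
    exact (hr.mono hmin).congr fun y hy => hr' y (hmin hy)
  · rw [hr' y (hmin hy)]
    exact (hrV y (hmin hy)).2
  · have h1 : y ∈ Metric.thickening δ (Γ.K : Set A) := Metric.mem_thickening_iff.2
      ⟨k, k.2, by rw [dist_comm]; exact hky.trans_le (min_le_left _ _)⟩
    have h2 := hu (hky.trans_le (min_le_right _ _)) k.2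
    rw [Subtype.dist_eq, hr' y h1]
    simpa [hrK k k.2] using h2

/-- Every lift of a starting value through the exponential map extends over `B`, for maps with
values in the set where it is a covering. -/
def Lifts {V : Type*} [TopologicalSpace V] (B : Set V) : Prop :=
  ∀ f : V → Γ.K, ContinuousOn f B → (∀ w ∈ B, Γ.Abel (f w)) → ∀ w₀ ∈ B, ∀ X₀ : Γ.lie,
    Γ.expMap X₀ = f w₀ → ∃ F : V → Γ.lie, ContinuousOn F B ∧ F w₀ = X₀ ∧
      ∀ w ∈ B, Γ.expMap (F w) = f w

/-- Maps into the group extend from compact sets of dimension two on which maps lift through the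
exponential map. -/
theorem exists_extension_of_lifts {τ : A →ₗ[ℝ] ℝ} (hτ : Γ.TracePos τ)
    {E κ V : Type*} [NormedAddCommGroup E] [NormedSpace ℝ E] [FiniteDimensional ℝ E]
    (hE : finrank ℝ E = 2) [Countable κ] [NormedAddCommGroup V] [NormedSpace ℝ V]
    [FiniteDimensional ℝ V] (Q : κ → E → V) (hQ : ∀ i, ContDiff ℝ 1 (Q i)) {B : Set V}
    (hB : IsCompact B) (hBQ : B ⊆ ⋃ i, Set.range (Q i)) (hne : B.Nonempty) (hlift : Γ.Lifts B)
    {f : V → Γ.K} (hf : ContinuousOn f B) :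
    ∃ h : V → Γ.K, Continuous h ∧ ∀ w ∈ B, h w = f w := by
  obtain ⟨w₀, hw₀⟩ := hne
  obtain ⟨P, hP⟩ := Γ.exists_isCompl
  obtain ⟨j, hj, hj1⟩ := Γ.exists_continuous_inv
  obtain ⟨η, hη, G, hG, hGe⟩ := Γ.exists_log_div
  obtain ⟨δ, hδ, r, hr, hrV, hrd⟩ := Γ.exists_retraction hP hη
  have hf₁ : ContinuousOn (fun w => j (f w₀) * f w) B := continuousOn_const.mul hf
  obtain ⟨g, hg⟩ := exists_continuousMap_eqOn hB.isClosed
    (f := fun w => ((j (f w₀) * f w : Γ.K) : A)) (continuous_subtype_val.comp_continuousOn hf₁)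
  obtain ⟨p, hp, hpg, -⟩ := g.continuous.exists_contDiff_approx 1
    (continuous_const (y := δ / 2)) (fun _ => by positivity)
  obtain ⟨x, hx, hxδ⟩ := (Γ.dense_generic hτ hP hE (fun i s => p (Q i s))
    (fun i => hp.comp (hQ i))).exists_dist_lt 0 (half_pos hδ)
  have hnear : ∀ w ∈ B, dist ((j (f w₀) * f w : Γ.K) : A) (p w + x) < δ := by
    intro w hw
    rw [← hg w hw]
    have h1 := hpg w
    rw [dist_comm] at h1
    have h2 : dist (p w) (p w + x) < δ / 2 := by
      rw [dist_self_add_right]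
      rwa [dist_comm, dist_zero_right] at hxδ
    calc _ ≤ _ := dist_triangle _ (p w) _
      _ < δ := by linarith
  have hth : ∀ w ∈ B, p w + x ∈ Metric.thickening δ (Γ.K : Set A) := fun w hw =>
    Metric.mem_thickening_iff.2 ⟨_, (j (f w₀) * f w).2, by rw [dist_comm]; exact hnear w hw⟩
  have hr₁ : ContinuousOn (fun w => r (p w + x)) B :=
    hr.comp (hp.continuous.add continuous_const).continuousOn hth
  have habel : ∀ w ∈ B, Γ.Abel (r (p w + x)) := by
    intro w hw
    by_contra hna
    obtain ⟨V, hV, hVe⟩ := hrV _ (hth w hw)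
    obtain ⟨i, s, rfl⟩ := Set.mem_iUnion.1 (hBQ hw)
    exact hx _ hna V hV i s (eq_sub_of_add_eq' hVe)
  have hdist : ∀ w ∈ B, dist (r (p w + x)) (j (f w₀) * f w) < η := fun w hw => by
    rw [dist_comm]
    exact hrd _ _ (hnear w hw)
  have hstart : r (p w₀ + x) = Γ.expMap (G (1, r (p w₀ + x))) := by
    have := hdist w₀ hw₀
    rw [(hj1 _).2, dist_comm] at this
    have h2 := hGe (1, r (p w₀ + x)) this
    rwa [one_mul] at h2
  obtain ⟨F, hF, -, hFe⟩ := hlift _ hr₁ habel w₀ hw₀ _ hstart.symm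
  obtain ⟨F', hF'⟩ := exists_continuousMap_eqOn hB.isClosed hF
  obtain ⟨G', hG'⟩ := exists_continuousMap_eqOn hB.isClosed
    (f := fun w => G (r (p w + x), j (f w₀) * f w)) (hG.comp (hr₁.prodMk hf₁) hdist)
  refine ⟨fun w => f w₀ * Γ.expMap (F' w) * Γ.expMap (G' w), ?_, fun w hw => ?_⟩
  · exact (continuous_const.mul (Γ.continuous_expMap.comp F'.continuous)).mul
      (Γ.continuous_expMap.comp G'.continuous)
  · beta_reduce
    rw [hF' w hw, hG' w hw, hFe w hw, mul_assoc, ← hGe (_, _) (hdist w hw), ← mul_assoc, (hj1 _).1,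
      one_mul]

end CptGrp

end CompactGroupAE

namespace CompactGroupAE

open Filter NormedSpace Module

section Face

variable {ι : Type*} [Fintype ι] [DecidableEq ι]

/-- The closed face of the standard simplex spanned by `s`. -/
def face (s : Finset ι) : Set (ι → ℝ) := {w | w ∈ stdSimplex ℝ ι ∧ ∀ i ∉ s, w i = 0}

/-- The boundary of a face. -/
def faceBdry (s : Finset ι) : Set (ι → ℝ) := ⋃ i ∈ s, face (s.erase i)

theorem convex_face (s : Finset ι) : Convex ℝ (face s) := by
  intro x hx y hy a b ha hb hab
  refine ⟨convex_stdSimplex ℝ ι hx.1 hy.1 ha hb hab, fun i hi => ?_⟩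
  simp [hx.2 i hi, hy.2 i hi]

theorem isCompact_face (s : Finset ι) : IsCompact (face s) := by
  refine (isCompact_stdSimplex ℝ ι).of_isClosed_subset ?_ fun w hw => hw.1
  have : face s = stdSimplex ℝ ι ∩ ⋂ i ∈ (s : Set ι)ᶜ, {w : ι → ℝ | w i = 0} := by
    ext w
    simp [face]
  rw [this]
  exact (isClosed_stdSimplex ℝ ι).inter (isClosed_biInter fun i _ =>
    isClosed_eq (continuous_apply i) continuous_const)

theorem face_mono {s t : Finset ι} (h : s ⊆ t) : face s ⊆ face t :=
  fun _ hw => ⟨hw.1, fun i hi => hw.2 i fun his => hi (h his)⟩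

theorem face_inter (s t : Finset ι) : face s ∩ face t = face (s ∩ t) := by
  ext w
  constructor
  · rintro ⟨h1, h2⟩
    refine ⟨h1.1, fun i hi => ?_⟩
    by_cases his : i ∈ s
    · exact h2.2 i fun hit => hi (Finset.mem_inter.2 ⟨his, hit⟩)
    · exact h1.2 i his
  · exact fun h => ⟨face_mono Finset.inter_subset_left h, face_mono Finset.inter_subset_right h⟩

theorem single_mem_face {s : Finset ι} {a : ι} (ha : a ∈ s) : Pi.single a 1 ∈ face s := by
  refine ⟨single_mem_stdSimplex ℝ a, fun i hi => ?_⟩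
  rw [Pi.single_apply, if_neg]
  rintro rfl
  exact hi ha

theorem face_empty : face (∅ : Finset ι) = ∅ := by
  refine Set.eq_empty_of_forall_notMem fun w hw => ?_
  have h := hw.1.2
  rw [Finset.sum_eq_zero fun i _ => hw.2 i (Finset.notMem_empty i)] at h
  exact zero_ne_one h

theorem sum_face {s : Finset ι} {w : ι → ℝ} (hw : w ∈ face s) : ∑ i ∈ s, w i = 1 := by
  rw [← hw.1.2]
  exact Finset.sum_subset (Finset.subset_univ s) fun i _ hi => hw.2 i hi

theorem faceBdry_subset (s : Finset ι) : faceBdry s ⊆ face s :=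
  Set.iUnion₂_subset fun _ _ => face_mono (Finset.erase_subset _ s)

theorem isCompact_faceBdry (s : Finset ι) : IsCompact (faceBdry s) :=
  s.isCompact_biUnion fun _ _ => isCompact_face _

theorem face_inter_subset_faceBdry {s t : Finset ι} (h : ¬s ⊆ t) :
    face s ∩ face t ⊆ faceBdry s := by
  obtain ⟨i, his, hit⟩ := Finset.not_subset.1 h
  rw [face_inter]
  refine Set.Subset.trans (face_mono fun j hj => ?_) 
    (Set.subset_iUnion₂ (s := fun i (_ : i ∈ s) => face (s.erase i)) i his)
  refine Finset.mem_erase.2 ⟨?_, (Finset.mem_inter.1 hj).1⟩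
  rintro rfl
  exact hit (Finset.mem_inter.1 hj).2

/-- Affine parametrisations of the planes spanned by triples of vertices. -/
def triParam (p : ι × ι × ι) (x : ℝ × ℝ) : ι → ℝ :=
  Pi.single p.1 (1 - x.1 - x.2) + Pi.single p.2.1 x.1 + Pi.single p.2.2 x.2

theorem contDiff_triParam (p : ι × ι × ι) : ContDiff ℝ 1 (triParam p) := by
  rw [contDiff_pi]
  intro i
  simp only [triParam, Pi.add_apply, Pi.single_apply]
  split_ifs <;> fun_prop

theorem triParam_eq {a b c : ι} (hab : a ≠ b) (hac : a ≠ c) (hbc : b ≠ c) {w : ι → ℝ}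
    (hw : w ∈ face {a, b, c}) : triParam (a, b, c) (w b, w c) = w ∧ w a + (w b + w c) = 1 := by
  have hs := sum_face hw
  rw [Finset.sum_insert (by simp [hab, hac]), Finset.sum_insert (by simp [hbc]),
    Finset.sum_singleton] at hs
  refine ⟨?_, hs⟩
  funext i
  simp only [triParam, Pi.add_apply, Pi.single_apply]
  by_cases hia : i = a
  · subst hia
    simp only [if_true, if_neg hab, if_neg hac]
    linarith
  by_cases hib : i = b
  · subst hib
    simp [hbc, hia]
  by_cases hic : i = c
  · subst hic
    simp [hia, hib]
  · simp [hia, hib, hic, hw.2 i (by simp [hia, hib, hic])]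

theorem face_subset_triParam {t : Finset ι} (ht : t.card = 3) :
    face t ⊆ ⋃ p, Set.range (triParam p) := by
  obtain ⟨a, b, c, hab, hac, hbc, rfl⟩ := Finset.card_eq_three.1 ht
  exact fun w hw => Set.mem_iUnion.2 ⟨(a, b, c), (w b, w c), (triParam_eq hab hac hbc hw).1⟩

theorem isPreconnected_face (s : Finset ι) : IsPreconnected (face s) :=
  (convex_face s).isPreconnected

end Face

namespace CptGrp

variable {A : Type*} [NormedRing A] [NormedAlgebra ℝ A] [FiniteDimensional ℝ A] (Γ : CptGrp A)

theorem lifts_convex {V : Type*} [NormedAddCommGroup V] [NormedSpace ℝ V] {S : Set V}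
    (hS : Convex ℝ S) : Γ.Lifts S := by
  classical
  intro f hf hab w₀ hw₀ X₀ hX₀
  have : LocallyPathConnectedSpace S := hS.locallyPathConnectedSpace
  have : ContractibleSpace S := hS.contractibleSpace ⟨w₀, hw₀⟩
  obtain ⟨F, ⟨hF0, hF⟩, -⟩ := Γ.isCoveringMapOn_expMap.existsUnique_continuousMap_lifts
    ⟨S.domRestrict f, hf.domRestrict⟩ (a₀ := ⟨w₀, hw₀⟩) (e₀ := X₀) hX₀ fun a => hab a a.2
  have h1 : ∀ w (hw : w ∈ S), (if h : w ∈ S then F ⟨w, h⟩ else X₀) = F ⟨w, hw⟩ := fun w hw =>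
    dif_pos hw
  refine ⟨fun w => if h : w ∈ S then F ⟨w, h⟩ else X₀, ?_, (h1 w₀ hw₀).trans hF0, fun w hw => ?_⟩
  · rw [continuousOn_iff_continuous_domRestrict]
    exact F.continuous.congr fun x => (h1 x x.2).symm
  · beta_reduce
    rw [h1 w hw]
    exact congrFun hF ⟨w, hw⟩

theorem eqOn_of_expMap_eq {V : Type*} [TopologicalSpace V] {S : Set V} (hS : IsPreconnected S)
    {F F' : V → Γ.lie} (hF : ContinuousOn F S) (hF' : ContinuousOn F' S)
    (hab : ∀ w ∈ S, Γ.Abel (Γ.expMap (F w))) (he : ∀ w ∈ S, Γ.expMap (F w) = Γ.expMap (F' w))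
    {w₀ : V} (hw₀ : w₀ ∈ S) (h0 : F w₀ = F' w₀) : ∀ w ∈ S, F w = F' w := by
  have : PreconnectedSpace S := isPreconnected_iff_preconnectedSpace.1 hS
  have hcov := Γ.isCoveringMapOn_expMap.isCoveringMap_restrictPreimage
  let g : S → Γ.expMap ⁻¹' {g : Γ.K | Γ.Abel g} := fun w => ⟨F w, hab w w.2⟩
  let g' : S → Γ.expMap ⁻¹' {g : Γ.K | Γ.Abel g} := fun w =>
    ⟨F' w, by rw [Set.mem_preimage, ← he w w.2]; exact hab w w.2⟩
  have h := hcov.eq_of_comp_eq (g₁ := g) (g₂ := g') (hF.domRestrict.subtype_mk _)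
    (hF'.domRestrict.subtype_mk _) (funext fun w => Subtype.ext (he w w.2)) ⟨w₀, hw₀⟩
    (Subtype.ext h0)
  exact fun w hw => congrArg Subtype.val (congrFun h ⟨w, hw⟩)

theorem lifts_union {V : Type*} [TopologicalSpace V] {S T : Set V} (hSc : IsClosed S)
    (hTc : IsClosed T) (hS : Γ.Lifts S) (hT : Γ.Lifts T) (hne : (S ∩ T).Nonempty)
    (hc : IsPreconnected (S ∩ T)) : Γ.Lifts (S ∪ T) := by
  classical
  have key : ∀ S T : Set V, IsClosed S → IsClosed T → Γ.Lifts S → Γ.Lifts T → (S ∩ T).Nonempty →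
      IsPreconnected (S ∩ T) → ∀ f : V → Γ.K, ContinuousOn f (S ∪ T) →
      (∀ w ∈ S ∪ T, Γ.Abel (f w)) → ∀ w₀ ∈ S, ∀ X₀ : Γ.lie, Γ.expMap X₀ = f w₀ →
      ∃ F : V → Γ.lie, ContinuousOn F (S ∪ T) ∧ F w₀ = X₀ ∧
      ∀ w ∈ S ∪ T, Γ.expMap (F w) = f w := by
    intro S T hSc hTc hS hT hne hc f hf hab w₀ hw₀ X₀ hX₀
    obtain ⟨w₁, hw₁S, hw₁T⟩ := hne
    obtain ⟨F, hF, hF0, hFe⟩ := hS f (hf.mono Set.subset_union_left)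
      (fun w hw => hab w (Or.inl hw)) w₀ hw₀ X₀ hX₀
    obtain ⟨F', hF', hF'1, hF'e⟩ := hT f (hf.mono Set.subset_union_right)
      (fun w hw => hab w (Or.inr hw)) w₁ hw₁T (F w₁) (hFe w₁ hw₁S)
    have heq := Γ.eqOn_of_expMap_eq hc (hF.mono Set.inter_subset_left)
      (hF'.mono Set.inter_subset_right) (fun w hw => by rw [hFe w hw.1]; exact hab w (Or.inl hw.1))
      (fun w hw => (hFe w hw.1).trans (hF'e w hw.2).symm) ⟨hw₁S, hw₁T⟩ hF'1.symm
    have h1 : Set.EqOn (S.piecewise F F') F S := Set.piecewise_eqOn S F F'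
    have h2 : Set.EqOn (S.piecewise F F') F' T := by
      intro w hw
      by_cases hwS : w ∈ S
      · rw [Set.piecewise_eq_of_mem _ _ _ hwS, heq w ⟨hwS, hw⟩]
      · rw [Set.piecewise_eq_of_notMem _ _ _ hwS]
    refine ⟨S.piecewise F F', (hF.congr h1).union_of_isClosed (hF'.congr h2) hSc hTc,
      (h1 hw₀).trans hF0, ?_⟩
    rintro w (hw | hw)
    · rw [h1 hw, hFe w hw]
    · rw [h2 hw, hF'e w hw]
  intro f hf hab w₀ hw₀ X₀ hX₀
  rcases hw₀ with hw₀ | hw₀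
  · exact key S T hSc hTc hS hT hne hc f hf hab w₀ hw₀ X₀ hX₀
  · rw [Set.union_comm] at hf hab ⊢
    rw [Set.inter_comm] at hne hc
    exact key T S hTc hSc hT hS hne hc f hf hab w₀ hw₀ X₀ hX₀

variable {ι : Type*} [Fintype ι] [DecidableEq ι]

theorem lifts_faceBdry {s : Finset ι} (hs : s.card = 4) : Γ.Lifts (faceBdry s) := by
  obtain ⟨a, t, hat, rfl, ht⟩ := Finset.card_eq_succ.1 hs
  obtain ⟨b, c, d, hbc, hbd, hcd, rfl⟩ := Finset.card_eq_three.1 ht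
  set s : Finset ι := insert a {b, c, d} with hsdef
  have hab : a ≠ b := by rintro rfl; simp at hat
  have hac : a ≠ c := by rintro rfl; simp at hat
  have had : a ≠ d := by rintro rfl; simp at hat
  have hB : faceBdry s = face (s.erase a) ∪ face (s.erase b) ∪ face (s.erase c) ∪
      face (s.erase d) := by
    simp [faceBdry, hsdef, Set.union_assoc]
  have hcl : ∀ t : Finset ι, IsClosed (face t) := fun t => (isCompact_face t).isClosed
  have hi : ∀ x y : ι, face (s.erase x) ∩ face (s.erase y) = face ((s.erase x).erase y) := by
    intro x y
    rw [face_inter]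
    congr 1
    ext z
    simp only [Finset.mem_inter, Finset.mem_erase]
    tauto
  have hm : ∀ x y z : ι, z ∈ s → z ≠ x → z ≠ y → Pi.single z 1 ∈ face ((s.erase x).erase y) :=
    fun x y z hz hzx hzy => single_mem_face (by simp [hz, hzx, hzy])
  have ha : a ∈ s := by simp [hsdef]
  have hb : b ∈ s := by simp [hsdef]
  have hc : c ∈ s := by simp [hsdef]
  have hd : d ∈ s := by simp [hsdef]
  have hL : ∀ t : Finset ι, Γ.Lifts (face t) := fun t => Γ.lifts_convex (convex_face t)
  rw [hB]
  refine Γ.lifts_union (((hcl _).union (hcl _)).union (hcl _)) (hcl _) (Γ.lifts_union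
    ((hcl _).union (hcl _)) (hcl _) (Γ.lifts_union (hcl _) (hcl _) (hL _) (hL _) ?_ ?_) (hL _)
    ?_ ?_) (hL _) ?_ ?_
  · exact ⟨_, (hi a b).symm ▸ hm a b c hc hac.symm hbc.symm⟩
  · rw [hi]
    exact isPreconnected_face _
  · rw [Set.union_inter_distrib_right, hi, hi]
    exact ⟨_, Or.inl (hm a c b hb hab.symm hbc)⟩
  · rw [Set.union_inter_distrib_right, hi, hi]
    exact (isPreconnected_face _).union _ (hm a c d hd had.symm hcd.symm)
      (hm b c d hd hbd.symm hcd.symm) (isPreconnected_face _)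
  · rw [Set.union_inter_distrib_right, Set.union_inter_distrib_right, hi, hi, hi]
    exact ⟨_, Or.inl (Or.inl (hm a d b hb hab.symm hbd))⟩
  · rw [Set.union_inter_distrib_right, Set.union_inter_distrib_right, hi, hi, hi]
    exact ((isPreconnected_face _).union _ (hm a d c hc hac.symm hcd)
      (hm b d c hc hbc.symm hcd) (isPreconnected_face _)).union _
      (Or.inr (hm b d a ha hab had)) (hm c d a ha hac had) (isPreconnected_face _)

theorem exists_extension_tetrahedron {τ : A →ₗ[ℝ] ℝ} (hτ : Γ.TracePos τ) {s : Finset ι}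
    (hs : s.card = 4) {f : (ι → ℝ) → Γ.K} (hf : ContinuousOn f (faceBdry s)) :
    ∃ h : (ι → ℝ) → Γ.K, ContinuousOn h (face s) ∧ ∀ w ∈ faceBdry s, h w = f w := by
  have hcard : ∀ i ∈ s, (s.erase i).card = 3 := fun i hi => by
    rw [Finset.card_erase_of_mem hi, hs]
  obtain ⟨i, hi⟩ : s.Nonempty := Finset.card_pos.1 (by omega)
  obtain ⟨j, hj⟩ : (s.erase i).Nonempty := Finset.card_pos.1 (by rw [hcard i hi]; omega)
  obtain ⟨h, hh, he⟩ := Γ.exists_extension_of_lifts hτ (E := ℝ × ℝ) (by simp) triParam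
    contDiff_triParam (isCompact_faceBdry s)
    (Set.iUnion₂_subset fun i hi => face_subset_triParam (hcard i hi))
    ⟨_, Set.mem_biUnion hi (single_mem_face hj)⟩ (Γ.lifts_faceBdry hs) hf
  exact ⟨h, hh.continuousOn, he⟩

end CptGrp

end CompactGroupAE

namespace CompactGroupAE

open Filter Module

section Extension

variable {ι : Type*} [Fintype ι] [DecidableEq ι] {X : Type*} [TopologicalSpace X]

theorem mem_faceBdry {s : Finset ι} {w : ι → ℝ} :
    w ∈ faceBdry s ↔ w ∈ face s ∧ ∃ i ∈ s, w i = 0 := by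
  constructor
  · intro h
    obtain ⟨i, hi, hw⟩ := Set.mem_iUnion₂.1 h
    exact ⟨faceBdry_subset s h, i, hi, hw.2 i (Finset.notMem_erase i s)⟩
  · rintro ⟨hw, i, hi, h0⟩
    refine Set.mem_biUnion hi ⟨hw.1, fun j hj => ?_⟩
    by_cases hji : j = i
    · rw [hji, h0]
    · exact hw.2 j fun hjs => hj (Finset.mem_erase.2 ⟨hji, hjs⟩)

theorem triParam_mem_face {a b c : ι} {x y : ℝ} (hx : 0 ≤ x) (hy : 0 ≤ y) (hxy : x + y ≤ 1) :
    triParam (a, b, c) (x, y) ∈ face {a, b, c} := by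
  refine ⟨⟨fun i => ?_, ?_⟩, fun i hi => ?_⟩
  · simp only [triParam, Pi.add_apply, Pi.single_apply]
    have : 0 ≤ 1 - x - y := by linarith
    split_ifs <;> linarith
  · simp [triParam, Finset.sum_add_distrib]
    ring
  · simp only [Finset.mem_insert, Finset.mem_singleton, not_or] at hi
    simp [triParam, hi.1, hi.2.1, hi.2.2]

open unitInterval in
theorem exists_extension_triangle [SimplyConnectedSpace X] {s : Finset ι} (hs : s.card = 3)
    {f : (ι → ℝ) → X} (hf : ContinuousOn f (faceBdry s)) :
    ∃ h : (ι → ℝ) → X, ContinuousOn h (face s) ∧ ∀ w ∈ faceBdry s, h w = f w := by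
  classical
  obtain ⟨a, b, c, hab, hac, hbc, rfl⟩ := Finset.card_eq_three.1 hs
  let m : I → ℝ := fun t => min (2 * t) (2 - 2 * t)
  have hmc : Continuous m := by fun_prop
  have hm0 : ∀ t, 0 ≤ m t := fun t => le_min (by linarith [t.2.1]) (by linarith [t.2.2])
  have hm1 : ∀ t, m t ≤ 2 * t := fun t => min_le_left _ _
  have hm2 : ∀ t, m t ≤ 2 - 2 * t := fun t => min_le_right _ _
  let T : I → ℝ → ι → ℝ := fun t u => triParam (a, b, c) (t - u / 2, u)
  have hTc : Continuous fun p : I × ℝ => T p.1 p.2 :=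
    (contDiff_triParam (a, b, c)).continuous.comp (by fun_prop)
  have hTf : ∀ t u, 0 ≤ u → u ≤ m t → T t u ∈ face {a, b, c} := fun t u h0 h1 =>
    triParam_mem_face (by linarith [hm1 t]) h0 (by linarith [hm2 t])
  have hTa : ∀ t u, T t u a = 1 - t - u / 2 := fun t u => by
    simp [T, triParam, hab, hac]
    ring
  have hTb : ∀ t u, T t u b = t - u / 2 := fun t u => by
    simp [T, triParam, hab.symm, hbc]
  have hTcc : ∀ t u, T t u c = u := fun t u => by
    simp [T, triParam, hac.symm, hbc.symm]
  have hB1 : ∀ t, T t 0 ∈ faceBdry {a, b, c} := fun t =>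
    mem_faceBdry.2 ⟨hTf t 0 le_rfl (hm0 t), c, by simp, hTcc t 0⟩
  have hB0 : ∀ t, T t (m t) ∈ faceBdry {a, b, c} := by
    intro t
    refine mem_faceBdry.2 ⟨hTf t _ (hm0 t) le_rfl, ?_⟩
    rcases min_choice (2 * (t : ℝ)) (2 - 2 * t) with h | h
    · exact ⟨b, by simp, by rw [hTb, show m t = 2 * t from h]; ring⟩
    · exact ⟨a, by simp, by rw [hTa, show m t = 2 - 2 * t from h]; ring⟩
  have hmz : m 0 = 0 := by simp [m]
  have hmo : m 1 = 0 := by simp [m]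
  let γ₀ : Path (f (T 0 0)) (f (T 1 0)) :=
    { toFun := fun t => f (T t (m t))
      continuous_toFun := hf.comp_continuous (hTc.comp (continuous_id.prodMk hmc)) hB0
      source' := by rw [hmz]
      target' := by rw [hmo] }
  let γ₁ : Path (f (T 0 0)) (f (T 1 0)) :=
    { toFun := fun t => f (T t 0)
      continuous_toFun := hf.comp_continuous (hTc.comp (continuous_id.prodMk continuous_const)) hB1
      source' := rfl
      target' := rfl }
  obtain ⟨H⟩ := SimplyConnectedSpace.paths_homotopic γ₀ γ₁
  let q : C(I × I, face {a, b, c}) :=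
    { toFun := fun p => ⟨T p.2 ((1 - p.1) * m p.2), hTf _ _
        (mul_nonneg (by linarith [p.1.2.2]) (hm0 _))
        (mul_le_of_le_one_left (hm0 _) (by linarith [p.1.2.1]))⟩
      continuous_toFun := (hTc.comp (by fun_prop : Continuous fun p : I × I =>
        (p.2, (1 - (p.1 : ℝ)) * m p.2))).subtype_mk _ }
  have hqt : ∀ t u w, T t u = w → (t : ℝ) = w b + w c / 2 ∧ u = w c := by
    rintro t u w rfl
    rw [hTb, hTcc]
    exact ⟨by ring, rfl⟩
  have hw : ∀ w ∈ face {a, b, c}, ∃ t : I, ∃ u, T t u = w ∧ 0 ≤ u ∧ u ≤ m t := by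
    intro w hw
    obtain ⟨h1, h2⟩ := triParam_eq hab hac hbc hw
    have ha := hw.1.1 a
    have hb := hw.1.1 b
    have hc := hw.1.1 c
    refine ⟨⟨w b + w c / 2, by positivity, by linarith⟩, w c, ?_, hc,
      le_min (by dsimp only; linarith) (by dsimp only; linarith)⟩
    calc triParam (a, b, c) (w b + w c / 2 - w c / 2, w c) = triParam (a, b, c) (w b, w c) := by
          rw [add_sub_cancel_right]
      _ = w := h1
  have hsurj : Function.Surjective q := by
    rintro ⟨w, hwf⟩
    obtain ⟨t, u, rfl, h0, h1⟩ := hw w hwf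
    by_cases hz : u = 0
    · subst hz
      exact ⟨(1, t), Subtype.ext (by simp [q])⟩
    · have hmp : 0 < m t := (lt_of_le_of_ne h0 (Ne.symm hz)).trans_le h1
      refine ⟨(⟨1 - u / m t, ?_, ?_⟩, t), Subtype.ext ?_⟩
      · rw [sub_nonneg, div_le_one hmp]
        exact h1
      · linarith [div_nonneg h0 hmp.le]
      · simp only [q, ContinuousMap.coe_mk]
        congr 1
        field_simp
        ring
  have hquot : IsQuotientMap q := IsQuotientMap.of_surjective_continuous hsurj q.continuous
  have hcompat : ∀ p p' : I × I, q p = q p' → H p = H p' := by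
    rintro ⟨x, t⟩ ⟨x', t'⟩ he
    have he' : T t ((1 - x) * m t) = T t' ((1 - x') * m t') := congrArg Subtype.val he
    obtain ⟨h1, h2⟩ := hqt _ _ _ he'
    obtain ⟨h3, h4⟩ := hqt t' _ _ rfl
    obtain rfl : t = t' := Subtype.ext (h1.trans h3.symm)
    by_cases ht : m t = 0
    · have : t = 0 ∨ t = 1 := by
        rcases min_choice (2 * (t : ℝ)) (2 - 2 * t) with h | h
        · exact Or.inl (Subtype.ext (by
            have : m t = 2 * t := h
            simp only [Set.Icc.coe_zero]
            linarith))
        · exact Or.inr (Subtype.ext (by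
            have : m t = 2 - 2 * t := h
            simp only [Set.Icc.coe_one]
            linarith))
      rcases this with rfl | rfl
      · rw [H.source, H.source]
      · rw [H.target, H.target]
    · have h5 : (1 - (x : ℝ)) = 1 - x' := mul_right_cancel₀ ht (h2.trans h4.symm)
      obtain rfl : x = x' := Subtype.ext (by linarith)
      rfl
  let h' : C(face {a, b, c}, X) := hquot.lift H.toContinuousMap hcompat
  have hh' : ∀ p, h' (q p) = H p := fun p => congrArg (fun k : C(I × I, X) => k p)
    (hquot.lift_comp H.toContinuousMap hcompat)
  have hdef : ∀ w (hw : w ∈ face {a, b, c}),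
      (if h : w ∈ face {a, b, c} then h' ⟨w, h⟩ else f w) = h' ⟨w, hw⟩ := fun w hw => dif_pos hw
  refine ⟨fun w => if h : w ∈ face {a, b, c} then h' ⟨w, h⟩ else f w, ?_, fun w hwB => ?_⟩
  · rw [continuousOn_iff_continuous_domRestrict]
    exact h'.continuous.congr fun x => (hdef x x.2).symm
  · obtain ⟨hwf, i, hi, hi0⟩ := mem_faceBdry.1 hwB
    beta_reduce
    rw [hdef w hwf]
    obtain ⟨t, u, rfl, h0, h1⟩ := hw w hwf
    have hcase : u = 0 ∨ u = m t := by
      simp only [Finset.mem_insert, Finset.mem_singleton] at hi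
      rcases hi with rfl | rfl | rfl
      · rw [hTa] at hi0
        exact Or.inr (le_antisymm h1 (by linarith [hm2 t]))
      · rw [hTb] at hi0
        exact Or.inr (le_antisymm h1 (by linarith [hm1 t]))
      · rw [hTcc] at hi0
        exact Or.inl hi0
    rcases hcase with rfl | rfl
    · have : (⟨T t 0, hwf⟩ : face {a, b, c}) = q (1, t) := Subtype.ext (by simp [q])
      rw [this, hh']
      exact H.apply_one t
    · have : (⟨T t (m t), hwf⟩ : face {a, b, c}) = q (0, t) := Subtype.ext (by simp [q])
      rw [this, hh']
      exact H.apply_zero t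

theorem exists_extension_edge [PathConnectedSpace X] {s : Finset ι} (hs : s.card = 2)
    {f : (ι → ℝ) → X} : ∃ h : (ι → ℝ) → X, ContinuousOn h (face s) ∧
      ∀ w ∈ faceBdry s, h w = f w := by
  obtain ⟨a, b, hab, rfl⟩ := Finset.card_eq_two.1 hs
  let γ := PathConnectedSpace.somePath (f (Pi.single a 1)) (f (Pi.single b 1))
  refine ⟨fun w => γ.extend (w b), (γ.continuous_extend.comp (continuous_apply b)).continuousOn, ?_⟩
  have hf1 : ∀ x : ι, ∀ w ∈ face {x}, w = Pi.single x 1 := by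
    intro x w hw
    have h := sum_face hw
    rw [Finset.sum_singleton] at h
    funext i
    by_cases hi : i = x
    · subst hi
      simp [h]
    · simp [hi, hw.2 i (by simpa using hi)]
  intro w hw
  have he : ({a, b} : Finset ι).erase b = {a} := by
    rw [Finset.pair_comm, Finset.erase_insert (by simpa using hab.symm)]
  have hw' : w ∈ face {b} ∨ w ∈ face {a} := by
    simpa [faceBdry, hab, he] using hw
  rcases hw' with h | h
  · rw [hf1 _ w h]
    simp
  · rw [hf1 _ w h]
    simp [hab.symm]

/-- Maps on boundaries of simplices with at most `n` vertices extend. -/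
def SimplexExt (X : Type*) [TopologicalSpace X] (ι : Type*) [Fintype ι] [DecidableEq ι] (n : ℕ) :
    Prop :=
  ∀ s : Finset ι, s.card ≤ n → ∀ f : (ι → ℝ) → X, ContinuousOn f (faceBdry s) →
    ∃ h : (ι → ℝ) → X, ContinuousOn h (face s) ∧ ∀ w ∈ faceBdry s, h w = f w

theorem simplexExt_of_tetrahedron [SimplyConnectedSpace X]
    (h4 : ∀ s : Finset ι, s.card = 4 → ∀ f : (ι → ℝ) → X, ContinuousOn f (faceBdry s) →
      ∃ h : (ι → ℝ) → X, ContinuousOn h (face s) ∧ ∀ w ∈ faceBdry s, h w = f w) :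
    SimplexExt X ι 4 := by
  intro s hs f hf
  obtain h | h | h | h | h : s.card = 0 ∨ s.card = 1 ∨ s.card = 2 ∨ s.card = 3 ∨ s.card = 4 := by
    omega
  · rw [Finset.card_eq_zero.1 h, face_empty]
    exact ⟨f, continuousOn_empty f, fun _ _ => rfl⟩
  · obtain ⟨a, rfl⟩ := Finset.card_eq_one.1 h
    refine ⟨fun _ => f 0, continuousOn_const, fun w hw => ?_⟩
    simp [faceBdry, face_empty] at hw
  · exact exists_extension_edge h
  · exact exists_extension_triangle h hf
  · exact h4 s h f hf

end Extension

end CompactGroupAE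

namespace CompactGroupAE

section Skeleton

variable {ι : Type*} [Fintype ι] [DecidableEq ι] {X : Type*} [TopologicalSpace X]

/-- The union of the faces spanned by the members of `𝒞`. -/
def realization (𝒞 : Finset (Finset ι)) : Set (ι → ℝ) := ⋃ s ∈ 𝒞, face s

theorem realization_insert (s : Finset ι) (𝒞 : Finset (Finset ι)) :
    realization (insert s 𝒞) = face s ∪ realization 𝒞 := Finset.set_biUnion_insert _ _ _

theorem isClosed_realization (𝒞 : Finset (Finset ι)) : IsClosed (realization 𝒞) :=
  (𝒞.isCompact_biUnion fun _ _ => isCompact_face _).isClosed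

theorem SimplexExt.exists_insert {n : ℕ} (hX : SimplexExt X ι n) {𝒞 : Finset (Finset ι)}
    {s : Finset ι} (hs : s.card ≤ n) (hns : ∀ t ∈ 𝒞, ¬s ⊆ t) (hb : ∀ i ∈ s, s.erase i ∈ 𝒞)
    {f : (ι → ℝ) → X} (hf : ContinuousOn f (realization 𝒞)) : ∃ h : (ι → ℝ) → X,
      ContinuousOn h (realization (insert s 𝒞)) ∧ ∀ w ∈ realization 𝒞, h w = f w := by
  classical
  have hsub : faceBdry s ⊆ realization 𝒞 := Set.iUnion₂_subset fun i hi =>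
    Set.subset_iUnion₂ (s := fun t (_ : t ∈ 𝒞) => face t) _ (hb i hi)
  obtain ⟨h, hh, he⟩ := hX s hs f (hf.mono hsub)
  have h1 : Set.EqOn ((realization 𝒞).piecewise f h) f (realization 𝒞) :=
    Set.piecewise_eqOn _ _ _
  have h2 : Set.EqOn ((realization 𝒞).piecewise f h) h (face s) := by
    intro w hw
    by_cases hwc : w ∈ realization 𝒞
    · rw [Set.piecewise_eq_of_mem _ _ _ hwc]
      obtain ⟨t, ht, hwt⟩ := Set.mem_iUnion₂.1 hwc
      exact (he w (face_inter_subset_faceBdry (hns t ht) ⟨hw, hwt⟩)).symm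
    · rw [Set.piecewise_eq_of_notMem _ _ _ hwc]
  refine ⟨(realization 𝒞).piecewise f h, ?_, h1⟩
  rw [realization_insert]
  exact (hh.congr h2).union_of_isClosed (hf.congr h1) (isCompact_face s).isClosed
    (isClosed_realization 𝒞)

theorem SimplexExt.exists_extension {n : ℕ} (hX : SimplexExt X ι n) {𝒞 𝒟 : Finset (Finset ι)}
    (hCD : 𝒞 ⊆ 𝒟) (hC : ∀ s ∈ 𝒞, ∀ t ⊆ s, t ∈ 𝒞) (hD : ∀ s ∈ 𝒟, ∀ t ⊆ s, t ∈ 𝒟)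
    (hn : ∀ s ∈ 𝒟, s.card ≤ n) {f : (ι → ℝ) → X} (hf : ContinuousOn f (realization 𝒞)) :
    ∃ h : (ι → ℝ) → X,
      ContinuousOn h (realization 𝒟) ∧ ∀ w ∈ realization 𝒞, h w = f w := by
  induction hk : (𝒟 \ 𝒞).card generalizing 𝒞 f with
  | zero =>
    have : 𝒟 = 𝒞 := Finset.Subset.antisymm
      (Finset.sdiff_eq_empty_iff_subset.1 (Finset.card_eq_zero.1 hk)) hCD
    subst this
    exact ⟨f, hf, fun _ _ => rfl⟩
  | succ k ih =>
    obtain ⟨s, hs, hmin⟩ := (𝒟 \ 𝒞).exists_minimal (Finset.card_pos.1 (by omega))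
    obtain ⟨hsD, hsC⟩ := Finset.mem_sdiff.1 hs
    have hproper : ∀ t ⊆ s, t ≠ s → t ∈ 𝒞 := by
      intro t hts hne
      by_contra htC
      exact hne (Finset.Subset.antisymm hts (hmin (Finset.mem_sdiff.2 ⟨hD s hsD t hts, htC⟩) hts))
    obtain ⟨h, hh, he⟩ := hX.exists_insert (hn s hsD) (fun t ht hst => hsC (hC t ht s hst))
      (fun i hi => hproper _ (Finset.erase_subset i s) fun h =>
        Finset.notMem_erase i s (by rwa [h]))
      hf
    obtain ⟨g, hg, hge⟩ := ih (𝒞 := insert s 𝒞) (f := h) (Finset.insert_subset hsD hCD)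
      (by
        intro t ht u hu
        rcases Finset.mem_insert.1 ht with rfl | ht
        · by_cases hut : u = t
          · exact Finset.mem_insert.2 (Or.inl hut)
          · exact Finset.mem_insert_of_mem (hproper u hu hut)
        · exact Finset.mem_insert_of_mem (hC t ht u hu)) hh
      (by rw [Finset.sdiff_insert, Finset.card_erase_of_mem hs, hk]; rfl)
    refine ⟨g, hg, fun w hw => ?_⟩
    rw [hge w, he w hw]
    rw [realization_insert]
    exact Or.inr hw

end Skeleton

end CompactGroupAE

namespace CompactGroupAE

open Filter Module

/-- A map to the nerve of a fine open cover of small order, with approximate values of `F`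
attached to the vertices. -/
theorem exists_nerve_map {Z : Type u} [TopologicalSpace Z] [CompactSpace Z] [T2Space Z] {n : ℕ}
    (hZ : CovDimLE Z n) {A : Type*} [PseudoMetricSpace A] (F : C(Z, A)) {δ : ℝ} (hδ : 0 < δ) :
    ∃ (ι : Type u) (_ : Fintype ι) (_ : DecidableEq ι) (V : ι → Set Z) (c : ι → A)
      (Φ : Z → ι → ℝ), Continuous Φ ∧ (∀ z, Φ z ∈ stdSimplex ℝ ι) ∧
      (∀ z i, Φ z i ≠ 0 → z ∈ V i) ∧ (∀ i, ∀ z ∈ V i, dist (F z) (c i) < δ) ∧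
      ∀ (s : Finset ι) (z : Z), (∀ i ∈ s, z ∈ V i) → s.card ≤ n + 1 := by
  classical
  let B : A → Set Z := fun a => F ⁻¹' Metric.ball a δ
  have hB : ∀ a, IsOpen (B a) := fun a => Metric.isOpen_ball.preimage F.continuous
  obtain ⟨t, ht⟩ := isCompact_univ.elim_finite_subcover (fun z : Z => B (F z)) (fun z => hB _)
    fun z _ => Set.mem_iUnion.2 ⟨z, Metric.mem_ball_self hδ⟩
  obtain ⟨𝒱, hVo, hVc, hVU, hVn⟩ := hZ (t.image fun z => B (F z))
    (by
      intro U hU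
      obtain ⟨z, -, rfl⟩ := Finset.mem_image.1 hU
      exact hB _)
    (by
      refine Set.eq_univ_of_forall fun z => ?_
      obtain ⟨y, hy, hz⟩ := Set.mem_iUnion₂.1 (ht (Set.mem_univ z))
      exact ⟨_, Finset.mem_coe.2 (Finset.mem_image_of_mem _ hy), hz⟩)
  have hc : ∀ V : {V // V ∈ 𝒱}, ∃ a : A, ∀ z ∈ V.1, dist (F z) a < δ := by
    intro V
    obtain ⟨U, hU, hVU⟩ := hVU V.1 V.2
    obtain ⟨y, -, rfl⟩ := Finset.mem_image.1 hU
    exact ⟨F y, fun z hz => hVU hz⟩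
  choose c hc using hc
  obtain ⟨φ, hφ⟩ := PartitionOfUnity.exists_isSubordinate (s := Set.univ) isClosed_univ
    (fun V : {V // V ∈ 𝒱} => V.1) (fun V => hVo V.1 V.2) (by
      intro z _
      obtain ⟨V, hV, hz⟩ : z ∈ ⋃₀ (𝒱 : Set (Set Z)) := hVc ▸ Set.mem_univ z
      exact Set.mem_iUnion.2 ⟨⟨V, hV⟩, hz⟩)
  refine ⟨{V // V ∈ 𝒱}, inferInstance, inferInstance, fun V => V.1, c, fun z V => φ V z,
    continuous_pi fun V => (φ V).continuous, fun z => ⟨fun V => φ.nonneg V z, ?_⟩,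
    fun z V h => hφ V (subset_tsupport _ h), hc, fun s z hs => ?_⟩
  · rw [← finsum_eq_sum_of_fintype]
    exact φ.sum_eq_one (Set.mem_univ z)
  · have : Finite {V : Set Z // V ∈ 𝒱 ∧ z ∈ V} :=
      Set.Finite.to_subtype (𝒱.finite_toSet.subset fun V hV => hV.1)
    refine le_trans ?_ (hVn z)
    rw [← Nat.card_eq_finsetCard s]
    exact Nat.card_le_card_of_injective
      (fun V : {V // V ∈ s} => (⟨V.1.1, V.1.2, hs V.1 V.2⟩ : {V : Set Z // V ∈ 𝒱 ∧ z ∈ V}))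
      fun V W h => Subtype.ext (Subtype.ext (Subtype.mk.inj h))

namespace CptGrp

variable {A : Type*} [NormedRing A] [NormedAlgebra ℝ A] [FiniteDimensional ℝ A] (Γ : CptGrp A)

theorem exists_approx_extension {Z : Type u} [TopologicalSpace Z] [CompactSpace Z] [T2Space Z]
    {n : ℕ} (hZ : CovDimLE Z n)
    (hX : ∀ (ι : Type u) [Fintype ι] [DecidableEq ι], SimplexExt Γ.K ι (n + 1))
    {Z₀ : Set Z} (hZ₀ : IsClosed Z₀) {f : Z → Γ.K} (hf : ContinuousOn f Z₀) {η : ℝ}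
    (hη : 0 < η) : ∃ g : C(Z, Γ.K), ∀ z ∈ Z₀, dist (g z) (f z) < η := by
  classical
  obtain ⟨P, hP⟩ := Γ.exists_isCompl
  obtain ⟨δ, hδ, r, hr, -, hrη⟩ := Γ.exists_retraction hP hη
  obtain ⟨F, hF⟩ := exists_continuousMap_eqOn (E := A) hZ₀
    (continuous_subtype_val.comp_continuousOn hf)
  obtain ⟨ι, _, _, V, c, Φ, hΦ, hΦs, hΦV, hVc, hVn⟩ := exists_nerve_map hZ F hδ
  let 𝒞 : Finset (Finset ι) := Finset.univ.filter fun s => ∃ z ∈ Z₀, ∀ i ∈ s, z ∈ V i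
  let 𝒟 : Finset (Finset ι) := Finset.univ.filter fun s => ∃ z, ∀ i ∈ s, z ∈ V i
  have hm𝒞 : ∀ s, s ∈ 𝒞 ↔ ∃ z ∈ Z₀, ∀ i ∈ s, z ∈ V i := fun s => by simp [𝒞]
  have hm𝒟 : ∀ s, s ∈ 𝒟 ↔ ∃ z, ∀ i ∈ s, z ∈ V i := fun s => by simp [𝒟]
  let y : (ι → ℝ) → A := fun w => ∑ i, w i • c i
  have hy : Continuous y := by fun_prop
  have hyd : ∀ (s : Finset ι) (z : Z), (∀ i ∈ s, z ∈ V i) → ∀ w ∈ face s,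
      dist (F z) (y w) < δ := by
    intro s z hs w hw
    rw [dist_comm, ← Metric.mem_ball]
    have hsum : y w = ∑ i ∈ s, w i • c i :=
      (Finset.sum_subset (Finset.subset_univ s) fun i _ hi => by rw [hw.2 i hi, zero_smul]).symm
    rw [hsum]
    exact (convex_ball (F z) δ).sum_mem (fun i _ => hw.1.1 i) (sum_face hw)
      fun i hi => by rw [Metric.mem_ball, dist_comm]; exact hVc i z (hs i hi)
  have hcont : ContinuousOn (fun w => r (y w)) (realization 𝒞) := by
    refine hr.comp hy.continuousOn fun w hw => ?_
    obtain ⟨s, hs, hw⟩ := Set.mem_iUnion₂.1 hw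
    obtain ⟨z, hz, hs⟩ := (hm𝒞 s).1 hs
    refine Metric.mem_thickening_iff.2 ⟨F z, ?_, ?_⟩
    · rw [hF z hz]
      exact (f z).2
    · rw [dist_comm]
      exact hyd s z hs w hw
  obtain ⟨h, hh, he⟩ := (hX ι).exists_extension (𝒞 := 𝒞) (𝒟 := 𝒟)
    (fun s hs => by
      obtain ⟨z, -, hz⟩ := (hm𝒞 s).1 hs
      exact (hm𝒟 s).2 ⟨z, hz⟩)
    (fun s hs t hts => by
      obtain ⟨z, hz0, hz⟩ := (hm𝒞 s).1 hs
      exact (hm𝒞 t).2 ⟨z, hz0, fun i hi => hz i (hts hi)⟩)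
    (fun s hs t hts => by
      obtain ⟨z, hz⟩ := (hm𝒟 s).1 hs
      exact (hm𝒟 t).2 ⟨z, fun i hi => hz i (hts hi)⟩)
    (fun s hs => by
      obtain ⟨z, hz⟩ := (hm𝒟 s).1 hs
      exact hVn s z hz) hcont
  have hΦf : ∀ z, Φ z ∈ face (Finset.univ.filter fun i => Φ z i ≠ 0) := fun z =>
    ⟨hΦs z, fun i hi => by simpa using hi⟩
  have hΦV' : ∀ z, ∀ i ∈ Finset.univ.filter (fun i => Φ z i ≠ 0), z ∈ V i := fun z i hi =>
    hΦV z i (Finset.mem_filter.1 hi).2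
  have hΦD : ∀ z, Φ z ∈ realization 𝒟 := fun z =>
    Set.mem_iUnion₂.2 ⟨_, (hm𝒟 _).2 ⟨z, hΦV' z⟩, hΦf z⟩
  refine ⟨⟨fun z => h (Φ z), hh.comp_continuous hΦ hΦD⟩, fun z hz => ?_⟩
  have h1 : h (Φ z) = r (y (Φ z)) :=
    he _ (Set.mem_iUnion₂.2 ⟨_, (hm𝒞 _).2 ⟨z, hz, hΦV' z⟩, hΦf z⟩)
  change dist (h (Φ z)) (f z) < η
  rw [h1, dist_comm]
  refine hrη _ _ ?_
  have := hyd _ z (hΦV' z) _ (hΦf z)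
  rwa [hF z hz] at this

theorem exists_extension {Z : Type u} [TopologicalSpace Z] [CompactSpace Z] [T2Space Z]
    {n : ℕ} (hZ : CovDimLE Z n)
    (hX : ∀ (ι : Type u) [Fintype ι] [DecidableEq ι], SimplexExt Γ.K ι (n + 1))
    {Z₀ : Set Z} (hZ₀ : IsClosed Z₀) {f : Z → Γ.K} (hf : ContinuousOn f Z₀) :
    ∃ g : C(Z, Γ.K), ∀ z ∈ Z₀, g z = f z := by
  obtain ⟨η, hη, G, hG, hGe⟩ := Γ.exists_log_div
  obtain ⟨g, hg⟩ := Γ.exists_approx_extension hZ hX hZ₀ hf hη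
  obtain ⟨X, hX⟩ := exists_continuousMap_eqOn (E := Γ.lie) (f := fun z => G (g z, f z)) hZ₀
    (hG.comp (g.continuous.continuousOn.prodMk hf) fun z hz => hg z hz)
  refine ⟨⟨fun z => g z * Γ.expMap (X z),
    g.continuous.mul (Γ.continuous_expMap.comp X.continuous)⟩, fun z hz => ?_⟩
  change g z * Γ.expMap (X z) = f z
  rw [hX z hz]
  exact (hGe (g z, f z) (hg z hz)).symm

theorem exists_extension_of_tracePos [SimplyConnectedSpace Γ.K] {τ : A →ₗ[ℝ] ℝ}
    (hτ : Γ.TracePos τ) {Z : Type u} [TopologicalSpace Z] [CompactSpace Z] [T2Space Z]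
    (hZ : CovDimLE Z 3) {Z₀ : Set Z} (hZ₀ : IsClosed Z₀) {f : Z → Γ.K}
    (hf : ContinuousOn f Z₀) : ∃ g : C(Z, Γ.K), ∀ z ∈ Z₀, g z = f z :=
  Γ.exists_extension hZ (fun _ _ _ => simplexExt_of_tetrahedron fun _ hs _ hf =>
    Γ.exists_extension_tetrahedron hτ hs hf) hZ₀ hf

end CptGrp

end CompactGroupAE

namespace CompactGroupAE

open Filter NormedSpace
open scoped Matrix.Norms.Operator Matrix ComplexOrder

section Assembly

variable {G : Type u} [Group G] [TopologicalSpace G] [IsTopologicalGroup G] [CompactSpace G]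

theorem exists_injective_urep [T2Space G] (hG : Nontrivial G)
    (h : ∀ N : Subgroup G, N.Normal → IsClosed (N : Set G) → N ≠ ⊤ → Finite N) :
    ∃ R : URep G, Function.Injective R.ρ := by
  obtain ⟨g, hg⟩ := exists_ne (1 : G)
  obtain ⟨R, hR⟩ := exists_urep_ne_one hg
  let N : Subgroup G := (R.ρ : G →* Matrix R.ι R.ι ℂ).ker
  have hN : IsClosed (N : Set G) := isClosed_singleton.preimage R.ρ.continuous_toFun
  have hfin : Finite N := h N inferInstance hN fun htop =>
    hR (MonoidHom.mem_ker.1 (show g ∈ N from htop ▸ Subgroup.mem_top g))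
  have hC : ((N : Set G) \ {1}).Finite :=
    Set.Finite.subset (Set.toFinite (N : Set G)) Set.sdiff_subset
  obtain ⟨R', hR'⟩ := exists_urep_ker_subset (hC.isClosed.isOpen_compl.mem_nhds fun h => h.2 rfl)
  refine ⟨R.sum R', ?_⟩
  refine (injective_iff_map_eq_one (R.sum R').ρ.toMonoidHom).2 fun a ha => ?_
  obtain ⟨h1, h2⟩ := (R.sum_eq_iff R' a 1).1 (ha.trans (map_one _).symm)
  by_contra hne
  exact hR' a (h2.trans (map_one _)) ⟨MonoidHom.mem_ker.2 (h1.trans (map_one _)), hne⟩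

theorem URep.exists_tracePos (R : URep G) :
    ∃ τ : Matrix R.ι R.ι ℂ →ₗ[ℝ] ℝ, (img R.ρ ⊤ isClosed_univ).TracePos τ := by
  refine ⟨Complex.reLm ∘ₗ (Matrix.traceLinearMap R.ι ℝ ℂ), fun a b => ?_, fun X hX h => ?_⟩
  · simp [Matrix.trace_mul_comm a b]
  · have hs : Xᴴ = -X := R.skew fun t => by
      obtain ⟨g, -, hg⟩ := hX t
      exact ⟨g, hg⟩
    have h0 : (Xᴴ * X).trace = 0 := by
      refine Complex.ext ?_ ?_
      · have : (Matrix.trace (X * X)).re = 0 := h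
        simp [hs, this]
      · have h1 : star (Xᴴ * X).trace = (Xᴴ * X).trace := by
          rw [← Matrix.trace_conjTranspose, Matrix.conjTranspose_mul,
            Matrix.conjTranspose_conjTranspose]
        exact Complex.conj_eq_iff_im.1 h1
    exact Matrix.trace_conjTranspose_mul_self_eq_zero_iff.1 h0

theorem exists_extension_of_homeo {A : Type*} [NormedRing A] [NormedAlgebra ℝ A]
    [FiniteDimensional ℝ A] (Γ : CptGrp A) {τ : A →ₗ[ℝ] ℝ} (hτ : Γ.TracePos τ)
    [SimplyConnectedSpace G] (e : G ≃ₜ Γ.K) : IsAE 3 G := by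
  classical
  have := simplyConnected_of_homeo e
  intro Z _ _ _ hZ Z₀ hZ₀ g₀
  obtain ⟨g, hg⟩ := Γ.exists_extension_of_tracePos hτ hZ hZ₀
    (f := fun z => if h : z ∈ Z₀ then e (g₀ ⟨z, h⟩) else 1)
    (continuousOn_iff_continuous_domRestrict.2
      ((e.continuous.comp g₀.continuous).congr fun z => by simp))
  refine ⟨⟨fun z => e.symm (g z), e.symm.continuous.comp g.continuous⟩, fun z => ?_⟩
  change e.symm (g z) = g₀ z
  rw [hg z z.2, dif_pos z.2, e.symm_apply_apply]

theorem URep.isAE [SimplyConnectedSpace G] (R : URep G) (hR : Function.Injective R.ρ) :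
    IsAE 3 G := by
  obtain ⟨τ, hτ⟩ := R.exists_tracePos
  let φ : G → (img R.ρ ⊤ isClosed_univ).K := fun g => ⟨R.ρ g, g, trivial, rfl⟩
  have hφ : Continuous φ := R.ρ.continuous_toFun.subtype_mk _
  have hb : Function.Bijective φ := by
    refine ⟨fun a b h => hR (congrArg Subtype.val h), ?_⟩
    rintro ⟨-, g, -, rfl⟩
    exact ⟨g, rfl⟩
  exact exists_extension_of_homeo _ hτ
    (hφ.homeoOfEquivCompactToT2 (f := Equiv.ofBijective φ hb))

theorem isAE_pi {n : ℕ} {T : Type u} {X : T → Type u} [∀ t, TopologicalSpace (X t)]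
    (h : ∀ t, IsAE n (X t)) : IsAE n (∀ t, X t) := by
  intro Z _ hc h2 hZ Z₀ hZ₀ g₀
  choose g hg using fun t => h t Z hc h2 hZ Z₀ hZ₀
    ⟨fun z => g₀ z t, (continuous_apply t).comp g₀.continuous⟩
  exact ⟨⟨fun z t => g t z, continuous_pi fun t => (g t).continuous⟩,
    fun z => funext fun t => hg t z⟩

theorem isAE_of_homeo {n : ℕ} {X Y : Type u} [TopologicalSpace X] [TopologicalSpace Y]
    (e : X ≃ₜ Y) (h : IsAE n Y) : IsAE n X := by
  intro Z _ hc h2 hZ Z₀ hZ₀ g₀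
  obtain ⟨g, hg⟩ := h Z hc h2 hZ Z₀ hZ₀ ⟨fun z => e (g₀ z), e.continuous.comp g₀.continuous⟩
  refine ⟨⟨fun z => e.symm (g z), e.symm.continuous.comp g.continuous⟩, fun z => ?_⟩
  change e.symm (g z) = g₀ z
  rw [hg z]
  exact e.symm_apply_apply _

theorem IsSimpleSCSCLieGroup.isAE {L : CompactGroupPkg.{u}} (hL : IsSimpleSCSCLieGroup L) :
    IsAE 3 L.carrier := by
  obtain ⟨-, -, hsc, ⟨a, b, hab⟩, hN⟩ := hL
  obtain ⟨R, hR⟩ := exists_injective_urep ⟨a * b, b * a, hab⟩ hN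
  exact R.isAE hR

end Assembly

end CompactGroupAE

open CompactGroupAE in
/-- For a compact Hausdorff topological group `G` the following are equivalent: (a) `G` is a
simply connected AE(1)-compactum; (b) `G` is an AE(2)-compactum; (c) `G` is an AE(3)-compactum;
(d) `G` is isomorphic as a topological group to a product of simple, connected and simply
connected compact Lie groups. -/
theorem compact_group_AE_tfae (G : Type u) [Group G] [TopologicalSpace G]
    [IsTopologicalGroup G] [CompactSpace G] [T2Space G] :
    List.TFAE
      [SimplyConnectedSpace G ∧ IsAE 1 G,
       IsAE 2 G,
       IsAE 3 G,
       ∃ (T : Type u) (L : T → CompactGroupPkg.{u}),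
         (∀ t, IsSimpleSCSCLieGroup (L t)) ∧
         ∃ e : G ≃* (∀ t, (L t).carrier), IsTopGroupIso e] := by
  tfae_have 3 → 2 := fun h => isAE_mono h (by norm_num)
  tfae_have 2 → 1 := fun h => ⟨simplyConnected_of_isAE h, isAE_mono h (by norm_num)⟩
  tfae_have 1 → 4 := by
    rintro ⟨h, h1⟩
    have := locallyPathConnected_of_isAE h1
    exact exists_iso_pi
  tfae_have 4 → 3 := by
    rintro ⟨T, L, hL, e, he⟩
    exact isAE_of_homeo ⟨e.toEquiv, he.1, he.2⟩ (isAE_pi fun t => (hL t).isAE)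
  tfae_finish
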